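/- Let Q ⊂ ℂⁿ be a Euclidean cube with center c(Q) and side length ℓ(Q), and let f be holomorphic on 2Q. (a) ℋ^{2n−2}({f = 0} ∩ Q) ≤ C·ℓ(Q)^{2n−2}·log( sup_{2Q}|f| / sup_Q|f| ). (b) If f(c(Q)) = 0 and f is not identically zero, then ℋ^{2n−2}({f = 0} ∩ Q) ≥ c·ℓ(Q)^{2n−2}, where C, c > 0 depend only on n. -/

import Mathlib

open MeasureTheory

noncomputable section

instance {n : ℕ} : MeasurableSpace (EuclideanSpace ℂ (Fin n)) := borel _
instance {n : ℕ} : BorelSpace (EuclideanSpace ℂ (Fin n)) := ⟨rfl⟩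

/-- The closed Euclidean cube in `ℂⁿ ≅ ℝ^{2n}` with center `c` and side length `ℓ`. -/
def cube {n : ℕ} (c : EuclideanSpace ℂ (Fin n)) (ℓ : ℝ) : Set (EuclideanSpace ℂ (Fin n)) :=
  { z | ∀ i : Fin n, |(z i - c i).re| ≤ ℓ / 2 ∧ |(z i - c i).im| ≤ ℓ / 2 }

section

open Metric Set Filter Topology Real
open scoped ENNReal NNReal

/-- Finite order of vanishing at a point can be divided out globally. -/
theorem exists_factor_pow_of_differentiableOn {U : Set ℂ} (hU : IsOpen U) (hc : IsPreconnected U)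
    {g : ℂ → ℂ} (hg : DifferentiableOn ℂ g U) {a : ℂ} (ha : a ∈ U)
    (hne : ∃ z ∈ U, g z ≠ 0) :
    ∃ (n : ℕ) (h : ℂ → ℂ), DifferentiableOn ℂ h U ∧ h a ≠ 0 ∧
      ∀ z ∈ U, g z = (z - a) ^ n * h z := by
  have hUa : U ∈ 𝓝 a := hU.mem_nhds ha
  have hga : AnalyticAt ℂ g a := hg.analyticAt hUa
  obtain ⟨p, hp⟩ := hga
  have hp0 : p ≠ 0 := by
    intro h0
    obtain ⟨z, hz, hgz⟩ := hne
    refine hgz ((hg.analyticOnNhd hU).eqOn_zero_of_preconnected_of_eventuallyEq_zero hc ha ?_ hz)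
    exact hp.locally_zero_iff.2 h0
  have hd : ∀ n : ℕ, DifferentiableOn ℂ ((Function.swap dslope a)^[n] g) U := by
    intro n
    induction n with
    | zero => simpa using hg
    | succ k ih =>
      rw [Function.iterate_succ_apply']
      exact (Complex.differentiableOn_dslope hUa).2 ih
  refine ⟨p.order, (Function.swap dslope a)^[p.order] g, hd _,
    hp.iterate_dslope_fslope_ne_zero hp0, ?_⟩
  exact fun z _ => by simpa using hp.eq_pow_order_mul_iterate_dslope z

theorem finite_zeros_of_differentiableOn {U K : Set ℂ} (hU : IsOpen U) (hc : IsPreconnected U)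
    (hK : IsCompact K) (hKU : K ⊆ U) {g : ℂ → ℂ} (hg : DifferentiableOn ℂ g U)
    (hne : ∃ z ∈ U, g z ≠ 0) : {z ∈ K | g z = 0}.Finite := by
  by_contra hinf
  obtain ⟨x, hx, hacc⟩ :=
    Set.Infinite.exists_accPt_of_subset_isCompact hinf hK (fun z hz => hz.1)
  obtain ⟨z, hz, hgz⟩ := hne
  refine hgz ((hg.analyticOnNhd hU).eqOn_zero_of_preconnected_of_frequently_eq_zero hc
    (hKU hx) ?_ hz)
  rw [accPt_iff_frequently_nhdsNE] at hacc
  exact hacc.mono fun y hy => hy.2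

/-- Dividing out the zeros in a compact set. -/
theorem exists_factorization {U K : Set ℂ} (hU : IsOpen U) (hc : IsPreconnected U)
    (hK : IsCompact K) (hKU : K ⊆ U) {g : ℂ → ℂ} (hg : DifferentiableOn ℂ g U)
    (hne : ∃ z ∈ U, g z ≠ 0) :
    ∃ (s : Finset ℂ) (m : ℂ → ℕ) (h : ℂ → ℂ), (∀ a, a ∈ s ↔ a ∈ K ∧ g a = 0) ∧
      (∀ a ∈ s, 1 ≤ m a) ∧
      DifferentiableOn ℂ h U ∧ (∀ z ∈ K, h z ≠ 0) ∧
      ∀ z ∈ U, g z = (∏ a ∈ s, (z - a) ^ m a) * h z := by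
  have hfin := finite_zeros_of_differentiableOn hU hc hK hKU hg hne
  have key : ∀ s : Finset ℂ, (∀ a ∈ s, a ∈ U) → ∃ (m : ℂ → ℕ) (h : ℂ → ℂ),
      DifferentiableOn ℂ h U ∧ (∀ z ∈ s, h z ≠ 0) ∧
      ∀ z ∈ U, g z = (∏ a ∈ s, (z - a) ^ m a) * h z := by
    intro s
    induction s using Finset.induction_on with
    | empty => intro _; exact ⟨fun _ => 0, g, hg, by simp, by simp⟩
    | insert b s hb ih =>
      intro hs
      obtain ⟨m, h, hh, hh0, hgh⟩ := ih fun a ha => hs a (Finset.mem_insert_of_mem ha)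
      have hbU := hs b (Finset.mem_insert_self _ _)
      have hne' : ∃ z ∈ U, h z ≠ 0 := by
        obtain ⟨z, hz, hgz⟩ := hne
        exact ⟨z, hz, fun h0 => hgz (by rw [hgh z hz, h0, mul_zero])⟩
      obtain ⟨n, k, hk, hkb, hhk⟩ := exists_factor_pow_of_differentiableOn hU hc hh hbU hne'
      refine ⟨Function.update m b n, k, hk, ?_, ?_⟩
      · intro z hz
        rcases Finset.mem_insert.1 hz with rfl | hz
        · exact hkb
        · have hzU := hs z (Finset.mem_insert_of_mem hz)
          intro h0
          exact hh0 z hz (by rw [hhk z hzU, h0, mul_zero])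
      · intro z hz
        rw [Finset.prod_insert hb, hgh z hz, hhk z hz, Function.update_self]
        have : ∏ a ∈ s, (z - a) ^ Function.update m b n a = ∏ a ∈ s, (z - a) ^ m a := by
          refine Finset.prod_congr rfl fun a ha => ?_
          rw [Function.update_of_ne (by rintro rfl; exact hb ha)]
        rw [this]; ring
  obtain ⟨m, h, hh, hh0, hgh⟩ := key hfin.toFinset fun a ha =>
    hKU (by simpa using (hfin.mem_toFinset.1 ha).1)
  refine ⟨hfin.toFinset, m, h, by simp, ?_, hh, ?_, hgh⟩
  · intro a ha
    have ha' := hfin.mem_toFinset.1 ha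
    by_contra hm
    have hm0 : m a = 0 := by omega
    have := hgh a (hKU ha'.1)
    rw [ha'.2, eq_comm, mul_eq_zero] at this
    rcases this with h1 | h1
    · rw [Finset.prod_eq_zero_iff] at h1
      obtain ⟨b, hb, hb0⟩ := h1
      have hab : a - b = 0 := by
        by_contra hne0
        exact pow_ne_zero _ hne0 hb0
      rw [sub_eq_zero] at hab
      subst hab
      simp [hm0] at hb0
    · exact hh0 a ha h1
  · intro z hz h0
    have hz0 : g z = 0 := by rw [hgh z (hKU hz), h0, mul_zero]
    exact hh0 z (hfin.mem_toFinset.2 ⟨hz, hz0⟩) h0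

section ZeroCount

theorem log_max_eq_log_add_posLog {s d : ℝ} (hs : 0 < s) (hd : 0 ≤ d) :
    log (max s d) = log s + posLog (s⁻¹ * d) := by
  have hp : posLog (s⁻¹ * d) = max 0 (log (s⁻¹ * d)) := rfl
  rw [hp]
  rcases le_total d s with h | h
  · rw [max_eq_left h, max_eq_left, add_zero]
    refine Real.log_nonpos (by positivity) ?_
    rw [inv_mul_le_iff₀ hs]; linarith
  · have hd' : 0 < d := lt_of_lt_of_le hs h
    rw [max_eq_right h, max_eq_right, Real.log_mul (by positivity) (by positivity), Real.log_inv]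
    · ring
    · refine Real.log_nonneg ?_
      rw [le_inv_mul_iff₀ hs]; linarith

/-- Circle averages of `log ‖g‖` in terms of a factorization of `g`. -/
theorem circleAverage_log_norm_of_factorization {U K : Set ℂ} (hU : IsOpen U) (hKU : K ⊆ U)
    {g h : ℂ → ℂ} {s : Finset ℂ} {m : ℂ → ℕ}
    (hh : DifferentiableOn ℂ h U) (hh0 : ∀ z ∈ K, h z ≠ 0)
    (hgh : ∀ z ∈ U, g z = (∏ a ∈ s, (z - a) ^ m a) * h z) {c : ℂ} {r : ℝ} (hr : 0 < r)
    (hcr : closedBall c r ⊆ K) :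
    circleAverage (fun z => log ‖g z‖) c r
      = log ‖h c‖ + ∑ a ∈ s, m a * log (max r ‖c - a‖) := by
  have habs : |r| = r := abs_of_pos hr
  have han : AnalyticOnNhd ℂ h (closedBall c |r|) := by
    rw [habs]
    exact (hh.analyticOnNhd hU).mono (hcr.trans hKU)
  have hmer : CircleIntegrable (fun z => log ‖h z‖) c r := by
    apply MeromorphicOn.circleIntegrable_log_norm
    intro z hz
    exact (han z (sphere_subset_closedBall hz)).meromorphicAt
  have hcong : circleAverage (fun z => log ‖g z‖) c r =
      circleAverage (fun z => log ‖h z‖ + ∑ a ∈ s, (m a : ℝ) • log ‖z - a‖) c r := by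
    apply circleAverage_congr_codiscreteWithin _ hr.ne'
    have hmem : ((s : Set ℂ))ᶜ ∈ codiscreteWithin (sphere c |r|) := by
      apply codiscreteWithin_iff_locallyFiniteComplementWithin.2
      intro z _
      refine ⟨univ, univ_mem, ?_⟩
      refine s.finite_toSet.subset ?_
      intro w hw
      simpa using hw.2.2
    have hmem2 : sphere c |r| ∈ codiscreteWithin (sphere c |r|) :=
      self_mem_codiscreteWithin _
    filter_upwards [hmem, hmem2] with z hz hz2
    have hzc : z ∈ closedBall c r := by rw [← habs]; exact sphere_subset_closedBall hz2
    have hz0 : ∀ a ∈ s, z - a ≠ 0 := by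
      intro a ha h0
      rw [sub_eq_zero] at h0
      exact hz (by simpa [h0] using ha)
    rw [hgh z (hKU (hcr hzc)), norm_mul, norm_prod, Real.log_mul, Real.log_prod, add_comm]
    · congr 1
      refine Finset.sum_congr rfl fun a _ => ?_
      rw [norm_pow, Real.log_pow, smul_eq_mul]
    · intro a ha
      rw [norm_ne_zero_iff]
      exact pow_ne_zero _ (hz0 a ha)
    · refine Finset.prod_ne_zero_iff.2 fun a ha => ?_
      rw [norm_ne_zero_iff]
      exact pow_ne_zero _ (hz0 a ha)
    · rw [norm_ne_zero_iff]
      exact hh0 z (hcr hzc)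
  have h_int : ∀ a ∈ s, CircleIntegrable (fun z => (m a : ℝ) • log ‖z - a‖) c r := fun a _ =>
    (circleIntegrable_log_norm_sub_const r).const_smul
  rw [hcong, circleAverage_fun_add hmer (CircleIntegrable.fun_sum _ h_int),
    circleAverage_fun_sum h_int]
  congr 1
  · apply han.circleAverage_log_norm_of_ne_zero
    rw [habs]
    exact fun u hu => hh0 u (hcr hu)
  · refine Finset.sum_congr rfl fun a _ => ?_
    rw [circleAverage_fun_smul, smul_eq_mul,
      circleAverage_log_norm_sub_const_eq_log_radius_add_posLog hr.ne',
      log_max_eq_log_add_posLog hr (norm_nonneg _)]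

theorem log_max_mono {r R d : ℝ} (hr : 0 < r) (hrR : r ≤ R) :
    log (max r d) ≤ log (max R d) :=
  Real.log_le_log (lt_of_lt_of_le hr (le_max_left _ _)) (max_le_max_right _ hrR)

theorem log_max_sub_le {r R d : ℝ} (hr : 0 < r) (hrR : r ≤ R) :
    log (max R d) - log (max r d) ≤ log R - log r := by
  rcases le_total d r with h | h
  · rw [max_eq_left h, max_eq_left (h.trans hrR)]
  · have hd : 0 < d := lt_of_lt_of_le hr h
    rw [max_eq_right h]
    rcases le_total d R with h' | h'
    · rw [max_eq_left h']
      have := Real.log_le_log hr h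
      linarith
    · rw [max_eq_right h']
      have := Real.log_le_log hr hrR
      linarith

variable {U : Set ℂ} {g : ℂ → ℂ} {c : ℂ} {r R : ℝ}

theorem circleAverage_log_norm_eq_zero_of_eqOn_zero (hg : ∀ z ∈ U, g z = 0) (hr : 0 < r)
    (hcr : closedBall c r ⊆ U) : circleAverage (fun z => log ‖g z‖) c r = 0 := by
  have : circleAverage (fun z => log ‖g z‖) c r = circleAverage (fun _ => (0 : ℝ)) c r := by
    apply circleAverage_congr_sphere
    intro z hz
    rw [abs_of_pos hr] at hz
    simp [hg z (hcr (sphere_subset_closedBall hz))]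
  rw [this, circleAverage_const]

theorem log_norm_le_circleAverage (hU : IsOpen U) (hc : IsPreconnected U)
    (hg : DifferentiableOn ℂ g U) (hr : 0 < r) (hcr : closedBall c r ⊆ U) (hgc : g c ≠ 0) :
    log ‖g c‖ ≤ circleAverage (fun z => log ‖g z‖) c r := by
  have hcU : c ∈ U := hcr (mem_closedBall_self hr.le)
  obtain ⟨s, m, h, hs, -, hh, hh0, hgh⟩ := exists_factorization hU hc
    (isCompact_closedBall c r) hcr hg ⟨c, hcU, hgc⟩
  rw [circleAverage_log_norm_of_factorization hU hcr hh hh0 hgh hr le_rfl]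
  have hca : ∀ a ∈ s, c - a ≠ 0 := by
    intro a ha h0
    rw [sub_eq_zero] at h0
    exact hgc (h0 ▸ ((hs a).1 ha).2)
  rw [hgh c hcU, norm_mul, norm_prod, Real.log_mul, Real.log_prod, add_comm]
  · gcongr with a ha
    rw [norm_pow, Real.log_pow]
    gcongr
    · exact norm_pos_iff.2 (hca a ha)
    · exact le_max_right _ _
  · intro a ha
    rw [norm_ne_zero_iff]
    exact pow_ne_zero _ (hca a ha)
  · refine Finset.prod_ne_zero_iff.2 fun a ha => ?_
    rw [norm_ne_zero_iff]
    exact pow_ne_zero _ (hca a ha)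
  · rw [norm_ne_zero_iff]
    exact hh0 c (mem_closedBall_self hr.le)

theorem circleAverage_log_norm_mono (hU : IsOpen U) (hc : IsPreconnected U)
    (hg : DifferentiableOn ℂ g U) (hr : 0 < r) (hrR : r ≤ R) (hcr : closedBall c R ⊆ U) :
    circleAverage (fun z => log ‖g z‖) c r ≤ circleAverage (fun z => log ‖g z‖) c R := by
  have hR : 0 < R := hr.trans_le hrR
  by_cases hne : ∃ z ∈ U, g z ≠ 0
  · obtain ⟨s, m, h, hs, -, hh, hh0, hgh⟩ := exists_factorization hU hc
      (isCompact_closedBall c R) hcr hg hne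
    rw [circleAverage_log_norm_of_factorization hU hcr hh hh0 hgh hr
      (closedBall_subset_closedBall hrR),
      circleAverage_log_norm_of_factorization hU hcr hh hh0 hgh hR le_rfl]
    gcongr with a ha
  · push Not at hne
    rw [circleAverage_log_norm_eq_zero_of_eqOn_zero hne hr
      ((closedBall_subset_closedBall hrR).trans hcr),
      circleAverage_log_norm_eq_zero_of_eqOn_zero hne hR hcr]

theorem log_sub_log_le_circleAverage_sub (hU : IsOpen U) (hc : IsPreconnected U)
    (hg : DifferentiableOn ℂ g U) (hr : 0 < r) (hrR : r ≤ R) (hcr : closedBall c R ⊆ U)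
    (hgc : g c = 0) (hne : ∃ z ∈ U, g z ≠ 0) :
    log R - log r ≤ circleAverage (fun z => log ‖g z‖) c R
      - circleAverage (fun z => log ‖g z‖) c r := by
  have hR : 0 < R := hr.trans_le hrR
  obtain ⟨s, m, h, hs, hm, hh, hh0, hgh⟩ := exists_factorization hU hc
    (isCompact_closedBall c R) hcr hg hne
  rw [circleAverage_log_norm_of_factorization hU hcr hh hh0 hgh hr
      (closedBall_subset_closedBall hrR),
    circleAverage_log_norm_of_factorization hU hcr hh hh0 hgh hR le_rfl, add_sub_add_left_eq_sub,
    ← Finset.sum_sub_distrib]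
  have hcs : c ∈ s := (hs c).2 ⟨mem_closedBall_self hR.le, hgc⟩
  have hnn : ∀ a ∈ s, 0 ≤ (m a : ℝ) * log (max R ‖c - a‖) - m a * log (max r ‖c - a‖) := by
    intro a _
    rw [← mul_sub]
    exact mul_nonneg (Nat.cast_nonneg _) (sub_nonneg.2 (log_max_mono hr hrR))
  refine le_trans ?_ (Finset.single_le_sum hnn hcs)
  rw [← mul_sub, sub_self, norm_zero, max_eq_left hR.le, max_eq_left hr.le]
  have h1 : (1 : ℝ) ≤ m c := by exact_mod_cast hm c hcs
  have h2 : 0 ≤ log R - log r := sub_nonneg.2 (Real.log_le_log hr hrR)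
  nlinarith

/-- Sums of increments of circle averages over boundedly overlapping discs. -/
theorem sum_circleAverage_sub_le (hg : DifferentiableOn ℂ g (ball 0 1))
    (hg1 : ∀ z ∈ ball (0 : ℂ) 1, ‖g z‖ ≤ 1) {ι : Type*} (I : Finset ι) (a : ι → ℂ) {R : ℝ}
    (hR : 0 < R) (ha : ∀ i ∈ I, ‖a i‖ + R ≤ 3 / 4) {K : ℕ}
    (hK : ∀ b : ℂ, {i ∈ I | ‖a i - b‖ < R}.card ≤ K) {t : ℝ} (ht : 0 < t) (ht1 : t ≤ 1)
    {ρ : ℝ} (hρ : 3 / 4 ≤ ρ) (hρ1 : ρ ≤ 4 / 5) :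
    ∑ i ∈ I, (circleAverage (fun z => log ‖g z‖) (a i) (R * t)
        - circleAverage (fun z => log ‖g z‖) (a i) (R / 2 * t))
      ≤ K * (log 2 / log (17 / 16)) * - circleAverage (fun z => log ‖g z‖) 0 ρ := by
  have hRt : 0 < R * t := by positivity
  have hRt2 : 0 < R / 2 * t := by positivity
  have hRle : R / 2 * t ≤ R * t := by nlinarith
  have hRt1 : R * t ≤ R := by nlinarith
  have hsub : ∀ i ∈ I, closedBall (a i) (R * t) ⊆ closedBall 0 (3 / 4) := by
    intro i hi
    apply closedBall_subset_closedBall'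
    rw [dist_zero_right]
    have := ha i hi
    linarith
  have hsub1 : closedBall (0 : ℂ) (17 / 20) ⊆ ball 0 1 := closedBall_subset_ball (by norm_num)
  have hsub2 : closedBall (0 : ℂ) (3 / 4) ⊆ closedBall 0 (17 / 20) :=
    closedBall_subset_closedBall (by norm_num)
  have hρ0 : 0 < ρ := by linarith
  by_cases hne : ∃ z ∈ ball (0 : ℂ) 1, g z ≠ 0
  swap
  · push Not at hne
    rw [circleAverage_log_norm_eq_zero_of_eqOn_zero hne hρ0
      ((closedBall_subset_closedBall (by linarith)).trans hsub1)]
    rw [Finset.sum_eq_zero]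
    · simp
    · intro i hi
      rw [circleAverage_log_norm_eq_zero_of_eqOn_zero hne hRt
        ((hsub i hi).trans (hsub2.trans hsub1)),
        circleAverage_log_norm_eq_zero_of_eqOn_zero hne hRt2
        ((closedBall_subset_closedBall hRle).trans ((hsub i hi).trans (hsub2.trans hsub1))),
        sub_zero]
  obtain ⟨s, m, h, hs, hm, hh, hh0, hgh⟩ := exists_factorization isOpen_ball
    (convex_ball (0 : ℂ) 1).isPreconnected (isCompact_closedBall (0 : ℂ) (17 / 20)) hsub1 hg hne
  have hform : ∀ {c : ℂ} {r : ℝ}, 0 < r → closedBall c r ⊆ closedBall 0 (17 / 20) →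
      circleAverage (fun z => log ‖g z‖) c r
      = log ‖h c‖ + ∑ a ∈ s, m a * log (max r ‖c - a‖) := fun hr hcr =>
    circleAverage_log_norm_of_factorization isOpen_ball hsub1 hh hh0 hgh hr hcr
  have hlog2 : 0 ≤ log 2 := Real.log_nonneg (by norm_num)
  have hlogk : 0 < log (17 / 16) := Real.log_pos (by norm_num)
  have hC : 0 ≤ K * (log 2 / log (17 / 16)) := by positivity
  have hle0 : circleAverage (fun z => log ‖g z‖) 0 (17 / 20) ≤ 0 := by
    apply circleAverage_mono_on_of_le_circle
    · apply MeromorphicOn.circleIntegrable_log_norm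
      intro z hz
      rw [abs_of_pos (by norm_num)] at hz
      exact ((hg.analyticOnNhd isOpen_ball) z
        (hsub1 (sphere_subset_closedBall hz))).meromorphicAt
    · intro z hz
      rw [abs_of_pos (by norm_num)] at hz
      exact Real.log_nonpos (norm_nonneg _) (hg1 z (hsub1 (sphere_subset_closedBall hz)))
  calc ∑ i ∈ I, (circleAverage (fun z => log ‖g z‖) (a i) (R * t)
        - circleAverage (fun z => log ‖g z‖) (a i) (R / 2 * t))
      = ∑ i ∈ I, ∑ b ∈ s, (m b : ℝ) *
          (log (max (R * t) ‖a i - b‖) - log (max (R / 2 * t) ‖a i - b‖)) := by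
        refine Finset.sum_congr rfl fun i hi => ?_
        rw [hform hRt ((hsub i hi).trans hsub2), hform hRt2 ((closedBall_subset_closedBall
          hRle).trans ((hsub i hi).trans hsub2)), add_sub_add_left_eq_sub,
          ← Finset.sum_sub_distrib]
        simp only [mul_sub]
    _ = ∑ b ∈ s, (m b : ℝ) * ∑ i ∈ I,
          (log (max (R * t) ‖a i - b‖) - log (max (R / 2 * t) ‖a i - b‖)) := by
        rw [Finset.sum_comm]
        simp only [Finset.mul_sum]
    _ ≤ ∑ b ∈ s, (m b : ℝ) * (K * (log 2 / log (17 / 16)) *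
          (log (max (17 / 20) ‖0 - b‖) - log (max ρ ‖0 - b‖))) := by
        refine Finset.sum_le_sum fun b _ => mul_le_mul_of_nonneg_left ?_ (Nat.cast_nonneg _)
        have hnn : 0 ≤ log (max (17 / 20) ‖0 - b‖) - log (max ρ ‖0 - b‖) :=
          sub_nonneg.2 (log_max_mono hρ0 (by linarith))
        have hterm : ∀ i ∈ I, log (max (R * t) ‖a i - b‖) - log (max (R / 2 * t) ‖a i - b‖) ≤
            if ‖a i - b‖ < R then log 2 else 0 := by
          intro i _
          split_ifs with hib
          · refine (log_max_sub_le hRt2 hRle).trans (le_of_eq ?_)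
            rw [← Real.log_div hRt.ne' hRt2.ne']
            congr 1
            field_simp
          · push Not at hib
            rw [max_eq_right (hRt1.trans hib), max_eq_right (hRle.trans (hRt1.trans hib)), sub_self]
        refine (Finset.sum_le_sum hterm).trans ?_
        rw [← Finset.sum_filter, Finset.sum_const, nsmul_eq_mul]
        by_cases hemp : {i ∈ I | ‖a i - b‖ < R} = ∅
        · rw [hemp]
          simpa using mul_nonneg hC hnn
        · obtain ⟨i, hi⟩ := Finset.nonempty_iff_ne_empty.2 hemp
          rw [Finset.mem_filter] at hi
          have hb : ‖0 - b‖ ≤ 3 / 4 := by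
            rw [zero_sub, norm_neg]
            have h1 := ha i hi.1
            have h2 : ‖b‖ ≤ ‖a i‖ + ‖a i - b‖ := by
              have := norm_sub_le (a i) (a i - b)
              simpa using this
            linarith [hi.2]
          rw [max_eq_left (by linarith : ‖0 - b‖ ≤ ρ),
            max_eq_left (by linarith : ‖0 - b‖ ≤ 17 / 20)]
          have h3 : log (17 / 16) ≤ log (17 / 20) - log ρ := by
            rw [← Real.log_div (by norm_num) hρ0.ne']
            apply Real.log_le_log (by norm_num)
            rw [le_div_iff₀ hρ0]
            linarith
          have h4 : (({i ∈ I | ‖a i - b‖ < R}.card : ℕ) : ℝ) ≤ K := by exact_mod_cast hK b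
          calc ({i ∈ I | ‖a i - b‖ < R}.card : ℝ) * log 2 ≤ K * log 2 := by gcongr
            _ = K * (log 2 / log (17 / 16)) * log (17 / 16) := by field_simp
            _ ≤ _ := by gcongr
    _ = K * (log 2 / log (17 / 16)) * (circleAverage (fun z => log ‖g z‖) 0 (17 / 20) -
          circleAverage (fun z => log ‖g z‖) 0 ρ) := by
        rw [hform (by norm_num) le_rfl, hform hρ0 (closedBall_subset_closedBall (by linarith)),
          add_sub_add_left_eq_sub, ← Finset.sum_sub_distrib, Finset.mul_sum]
        refine Finset.sum_congr rfl fun b _ => by ring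
    _ ≤ _ := by
        apply mul_le_mul_of_nonneg_left _ hC
        linarith

end ZeroCount

theorem Complex.volume_preimage_add_mul (p : ℂ) {a : ℂ} (ha : a ≠ 0) (s : Set ℂ) :
    volume ((fun z => p + a * z) ⁻¹' s) = ENNReal.ofReal ((‖a‖ ^ 2)⁻¹) * volume s := by
  have h1 : (fun z => p + a * z) ⁻¹' s = (LinearMap.mul ℝ ℂ a) ⁻¹' ((fun z => p + z) ⁻¹' s) := rfl
  have hdet : LinearMap.det (LinearMap.mul ℝ ℂ a) = ‖a‖ ^ 2 := by
    rw [← Complex.normSq_eq_norm_sq, ← Algebra.norm_complex_apply]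
    rfl
  rw [h1, Measure.addHaar_preimage_linearMap, hdet, measure_preimage_add, abs_of_nonneg]
  · positivity
  · rw [hdet]
    have := norm_pos_iff.2 ha
    positivity

section Pi

variable {n : ℕ}

theorem map_add_mul_volume (p : Fin n → ℂ) {a : Fin n → ℂ} (ha : ∀ j, a j ≠ 0) :
    Measure.map (fun x => p + a * x) volume =
      ENNReal.ofReal (∏ j, (‖a j‖ ^ 2)⁻¹) • (volume : Measure (Fin n → ℂ)) := by
  have hpos : ∀ j, 0 < ‖a j‖ ^ 2 := fun j => by
    have := norm_pos_iff.2 (ha j)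
    positivity
  have hC : ENNReal.ofReal (∏ j, ‖a j‖ ^ 2) * ENNReal.ofReal (∏ j, (‖a j‖ ^ 2)⁻¹) = 1 := by
    rw [← ENNReal.ofReal_mul (Finset.prod_nonneg fun j _ => (hpos j).le), ← Finset.prod_mul_distrib,
      Finset.prod_eq_one fun j _ => mul_inv_cancel₀ (hpos j).ne', ENNReal.ofReal_one]
  have hm : Measurable fun x : Fin n → ℂ => p + a * x := by fun_prop
  have key : (volume : Measure (Fin n → ℂ)) =
      ENNReal.ofReal (∏ j, ‖a j‖ ^ 2) • Measure.map (fun x => p + a * x) volume := by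
    rw [volume_pi]
    refine Measure.pi_eq fun s hs => ?_
    rw [Measure.smul_apply, Measure.map_apply hm (MeasurableSet.univ_pi hs)]
    have : (fun x => p + a * x) ⁻¹' (univ.pi s) =
        univ.pi fun j => (fun z => p j + a j * z) ⁻¹' s j := by
      ext x
      simp [Set.mem_pi]
    rw [this, Measure.pi_pi, smul_eq_mul]
    simp_rw [Complex.volume_preimage_add_mul _ (ha _)]
    rw [Finset.prod_mul_distrib, ← mul_assoc, ← ENNReal.ofReal_prod_of_nonneg, hC, one_mul]
    intro j _
    exact inv_nonneg.2 (hpos j).le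
  nth_rw 2 [key]
  rw [smul_smul, mul_comm, hC, one_smul]

/-- Change of variables for diagonal affine maps. -/
theorem lintegral_comp_add_mul (p : Fin n → ℂ) {a : Fin n → ℂ} (ha : ∀ j, a j ≠ 0)
    {F : (Fin n → ℂ) → ℝ≥0∞} (hF : Measurable F) :
    ∫⁻ x, F (p + a * x) = ENNReal.ofReal (∏ j, (‖a j‖ ^ 2)⁻¹) * ∫⁻ x, F x := by
  rw [← smul_eq_mul, ← lintegral_smul_measure, ← map_add_mul_volume p ha,
    lintegral_map hF (by fun_prop)]

theorem measurePreserving_mul_of_norm_eq_one {a : Fin n → ℂ} (ha : ∀ j, ‖a j‖ = 1) :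
    MeasurePreserving (fun x : Fin n → ℂ => a * x) := by
  refine ⟨by fun_prop, ?_⟩
  have h := map_add_mul_volume (0 : Fin n → ℂ) (a := a) fun j h0 => by
    have := ha j
    simp [h0] at this
  simpa [ha] using h

end Pi

section Rotation

variable {X : Type*} [MeasurableSpace X] {μ : Measure X} [SFinite μ] {φ : ℝ → X → X}

/-- Averaging over a one-parameter family of measure preserving maps. -/
theorem lintegral_average_comp (hφ : Measurable (Function.uncurry φ))
    (hμ : ∀ θ, MeasurePreserving (φ θ) μ μ) {D : X → ℝ≥0∞} (hD : Measurable D) :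
    ∫⁻ x, (∫⁻ θ in Ioc 0 (2 * π), D (φ θ x)) ∂μ = ENNReal.ofReal (2 * π) * ∫⁻ x, D x ∂μ := by
  have hm : Measurable (Function.uncurry fun (x : X) (θ : ℝ) => D (φ θ x)) := by
    have : (Function.uncurry fun (x : X) (θ : ℝ) => D (φ θ x)) =
        D ∘ (Function.uncurry φ) ∘ Prod.swap := rfl
    rw [this]
    exact hD.comp (hφ.comp measurable_swap)
  rw [lintegral_lintegral_swap hm.aemeasurable]
  have : ∀ θ, ∫⁻ x, D (φ θ x) ∂μ = ∫⁻ x, D x ∂μ := fun θ => (hμ θ).lintegral_comp hD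
  simp_rw [this]
  rw [setLIntegral_const, Real.volume_Ioc, sub_zero, mul_comm]

theorem integrable_uncurry_average_comp (hφ : Measurable (Function.uncurry φ))
    (hμ : ∀ θ, MeasurePreserving (φ θ) μ μ) {D : X → ℝ} (hD : Integrable D μ) :
    Integrable (Function.uncurry fun (x : X) (θ : ℝ) => D (φ θ x))
      (μ.prod (volume.restrict (Ioc 0 (2 * π)))) := by
  have h1 : MeasurePreserving (fun q : ℝ × X => (q.1, φ q.1 q.2))
      ((volume.restrict (Ioc 0 (2 * π))).prod μ) ((volume.restrict (Ioc 0 (2 * π))).prod μ) :=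
    (MeasurePreserving.id _).skew_product hφ (ae_of_all _ fun θ => (hμ θ).map_eq)
  have h2 : Integrable (fun q : ℝ × X => D q.2) ((volume.restrict (Ioc 0 (2 * π))).prod μ) :=
    hD.comp_snd _
  exact (h1.integrable_comp_of_integrable h2).swap

theorem integrable_average_comp (hφ : Measurable (Function.uncurry φ))
    (hμ : ∀ θ, MeasurePreserving (φ θ) μ μ) {D : X → ℝ} (hD : Integrable D μ) :
    Integrable (fun x => (2 * π)⁻¹ * ∫ θ in 0..2 * π, D (φ θ x)) μ := by
  simp_rw [intervalIntegral.integral_of_le two_pi_pos.le]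
  exact (integrable_uncurry_average_comp hφ hμ hD).integral_prod_left.const_mul _

theorem integral_average_comp (hφ : Measurable (Function.uncurry φ))
    (hμ : ∀ θ, MeasurePreserving (φ θ) μ μ) {D : X → ℝ} (hD : Integrable D μ) :
    ∫ x, ((2 * π)⁻¹ * ∫ θ in 0..2 * π, D (φ θ x)) ∂μ = ∫ x, D x ∂μ := by
  simp_rw [intervalIntegral.integral_of_le two_pi_pos.le]
  rw [integral_const_mul, integral_integral_swap (integrable_uncurry_average_comp hφ hμ hD)]
  have : ∀ θ, ∫ x, D (φ θ x) ∂μ = ∫ x, D x ∂μ := by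
    intro θ
    rw [← integral_map (hμ θ).measurable.aemeasurable, (hμ θ).map_eq]
    rw [(hμ θ).map_eq]
    exact hD.aestronglyMeasurable
  simp_rw [this]
  rw [setIntegral_const, smul_eq_mul, Measure.real, Real.volume_Ioc, sub_zero,
    ENNReal.toReal_ofReal two_pi_pos.le, inv_mul_cancel_left₀ two_pi_pos.ne']

end Rotation

/-- `-log ‖w‖`, with value `∞` at `w = 0` and truncated below at `0`. -/
def negLog (w : ℂ) : ℝ≥0∞ := if w = 0 then ⊤ else ENNReal.ofReal (-log ‖w‖)

theorem negLog_zero : negLog 0 = ⊤ := if_pos rfl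

theorem negLog_of_ne {w : ℂ} (hw : w ≠ 0) : negLog w = ENNReal.ofReal (-log ‖w‖) := if_neg hw

theorem measurable_negLog : Measurable negLog :=
  Measurable.ite (measurableSet_singleton 0) measurable_const (by fun_prop)

theorem lintegral_negLog_circleMap_le {U : Set ℂ} {g : ℂ → ℂ} {c : ℂ} {r : ℝ} (hU : IsOpen U)
    (hc : IsPreconnected U) (hg : DifferentiableOn ℂ g U) (hg1 : ∀ z ∈ U, ‖g z‖ ≤ 1) (hr : 0 < r)
    (hcr : closedBall c r ⊆ U) :
    ∫⁻ θ in Ioc 0 (2 * π), negLog (g (circleMap c r θ)) ≤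
      ENNReal.ofReal (2 * π) * negLog (g c) := by
  by_cases hgc : g c = 0
  · rw [hgc, negLog_zero, ENNReal.mul_top (by simpa using two_pi_pos)]
    exact le_top
  have hmemU : ∀ θ, circleMap c r θ ∈ U := fun θ =>
    hcr (sphere_subset_closedBall (circleMap_mem_sphere c hr.le θ))
  have hfin : {θ ∈ Ioc 0 (2 * π) | g (circleMap c r θ) = 0}.Finite := by
    have hz := finite_zeros_of_differentiableOn hU hc (isCompact_closedBall c r) hcr hg
      ⟨c, hcr (mem_closedBall_self hr.le), hgc⟩
    refine Finite.of_finite_image (f := circleMap c r) (hz.subset ?_) ?_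
    · rintro _ ⟨θ, hθ, rfl⟩
      exact ⟨sphere_subset_closedBall (circleMap_mem_sphere c hr.le θ), hθ.2⟩
    · intro θ hθ θ' hθ' h
      refine injOn_circleMap_of_abs_sub_le hr.ne' (a := 0) (b := 2 * π) ?_ ?_ ?_ h
      · rw [zero_sub, abs_neg, abs_of_pos two_pi_pos]
      · rw [uIoc_of_le two_pi_pos.le]
        exact hθ.1
      · rw [uIoc_of_le two_pi_pos.le]
        exact hθ'.1
  have hae : ∀ᵐ θ ∂(volume.restrict (Ioc 0 (2 * π))),
      negLog (g (circleMap c r θ)) = ENNReal.ofReal (-log ‖g (circleMap c r θ)‖) := by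
    rw [ae_restrict_iff' measurableSet_Ioc]
    have := hfin.measure_zero volume
    filter_upwards [compl_mem_ae_iff.2 this] with θ hθ hθ'
    exact negLog_of_ne fun h0 => hθ ⟨hθ', h0⟩
  have h_int : CircleIntegrable (fun z => log ‖g z‖) c r := by
    apply MeromorphicOn.circleIntegrable_log_norm
    intro z hz
    rw [abs_of_pos hr] at hz
    exact ((hg.analyticOnNhd hU) z (hcr (sphere_subset_closedBall hz))).meromorphicAt
  have h_int' : IntegrableOn (fun θ => -log ‖g (circleMap c r θ)‖) (Ioc 0 (2 * π)) := by
    have : IntervalIntegrable (fun θ => log ‖g (circleMap c r θ)‖) volume 0 (2 * π) := h_int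
    exact ((intervalIntegrable_iff_integrableOn_Ioc_of_le two_pi_pos.le).1 this).neg
  have hle := log_norm_le_circleAverage hU hc hg hr hcr hgc
  rw [lintegral_congr_ae hae, ← ofReal_integral_eq_lintegral_ofReal h_int', negLog_of_ne hgc,
    ← ENNReal.ofReal_mul two_pi_pos.le]
  · apply ENNReal.ofReal_le_ofReal
    rw [circleAverage_def, intervalIntegral.integral_of_le two_pi_pos.le, smul_eq_mul] at hle
    rw [integral_neg, mul_neg, neg_le_neg_iff]
    rw [← div_eq_inv_mul, le_div_iff₀ two_pi_pos] at hle
    linarith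
  · exact ae_of_all _ fun θ => neg_nonneg.2 (Real.log_nonpos (norm_nonneg _) (hg1 _ (hmemU θ)))

section Pi

variable {n : ℕ} {f : (Fin n → ℂ) → ℂ}

theorem setLIntegral_negLog_le (hfm : Measurable f) (hf : DifferentiableOn ℂ f (ball 0 1))
    (hf1 : ∀ z ∈ ball (0 : Fin n → ℂ) 1, ‖f z‖ ≤ 1) {p : Fin n → ℂ} {s : ℝ}
    (hps : ball p s ⊆ ball 0 1) :
    ∫⁻ x in ball p s, negLog (f x) ≤ volume (ball p s) * negLog (f p) := by
  have hB : MeasurableSet (ball (0 : Fin n → ℂ) s) := measurableSet_ball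
  have hmp : ∀ θ : ℝ, MeasurePreserving (fun x : Fin n → ℂ => circleMap 0 1 θ • x)
      (volume.restrict (ball 0 s)) (volume.restrict (ball 0 s)) := by
    intro θ
    have h := measurePreserving_mul_of_norm_eq_one (n := n) (a := fun _ => circleMap 0 1 θ)
      (fun _ => by simp)
    have h2 := h.restrict_preimage hB
    have : ((fun x : Fin n → ℂ => (fun _ => circleMap 0 1 θ) * x) ⁻¹' ball 0 s) = ball 0 s := by
      ext x
      have : ((fun _ => circleMap 0 1 θ) * x) = circleMap 0 1 θ • x := rfl
      rw [mem_preimage, this, mem_ball_zero_iff, mem_ball_zero_iff, norm_smul]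
      simp
    rw [this] at h2
    exact h2
  have hφ : Measurable (Function.uncurry fun (θ : ℝ) (x : Fin n → ℂ) => circleMap 0 1 θ • x) := by
    apply Continuous.measurable
    unfold Function.uncurry
    fun_prop
  have htrans : ∫⁻ x in ball p s, negLog (f x) = ∫⁻ x in ball 0 s, negLog (f (p + x)) := by
    have h := (measurePreserving_add_left volume p).restrict_preimage
      (measurableSet_ball (x := p) (ε := s))
    have h2 := h.lintegral_comp (measurable_negLog.comp hfm)
    rw [show (fun x => p + x) ⁻¹' ball p s = ball 0 s by ext x; simp] at h2
    exact h2.symm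
  have hvol : volume (ball p s) = volume (ball (0 : Fin n → ℂ) s) :=
    Measure.addHaar_ball_center volume p s
  have hD : Measurable fun x => negLog (f (p + x)) :=
    measurable_negLog.comp (hfm.comp (measurable_const_add p))
  have havg := lintegral_average_comp hφ hmp hD
  have hne : ENNReal.ofReal (2 * π) ≠ 0 := by simpa using two_pi_pos
  rw [htrans, hvol, ← ENNReal.mul_le_mul_iff_right hne ENNReal.ofReal_ne_top, ← havg]
  calc ∫⁻ x in ball 0 s, ∫⁻ θ in Ioc 0 (2 * π), negLog (f (p + circleMap 0 1 θ • x))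
      ≤ ∫⁻ _ in ball (0 : Fin n → ℂ) s, ENNReal.ofReal (2 * π) * negLog (f p) := by
        refine setLIntegral_mono measurable_const fun x hx => ?_
        set U : Set ℂ := (fun w : ℂ => p + w • x) ⁻¹' ball p s with hUdef
        have hUo : IsOpen U := isOpen_ball.preimage (by fun_prop)
        have hUc : Convex ℝ U := by
          intro a ha b hb α β hα hβ hαβ
          have := convex_ball p s ha hb hα hβ hαβ
          rw [hUdef, mem_preimage]
          convert this using 1
          have : p = α • p + β • p := by rw [← add_smul, hαβ, one_smul]
          nth_rw 1 [this]
          simp only [smul_add, add_smul, smul_assoc]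
          abel
        have hsub : closedBall (0 : ℂ) 1 ⊆ U := by
          intro w hw
          rw [mem_closedBall_zero_iff] at hw
          rw [mem_ball_zero_iff] at hx
          rw [hUdef, mem_preimage, mem_ball_iff_norm, add_sub_cancel_left, norm_smul]
          nlinarith [norm_nonneg x]
        have := lintegral_negLog_circleMap_le (g := fun w => f (p + w • x)) hUo hUc.isPreconnected
          (hf.comp (by fun_prop) fun w hw => hps hw) (fun w hw => hf1 _ (hps hw)) one_pos hsub
        simpa using this
    _ = _ := by
        rw [setLIntegral_const]
        ring

theorem exists_negLog_le (hfm : Measurable f) (hf : DifferentiableOn ℂ f (ball 0 1))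
    (hf1 : ∀ z ∈ ball (0 : Fin n → ℂ) 1, ‖f z‖ ≤ 1) {p q : Fin n → ℂ} {s ε : ℝ} (hε : 0 < ε)
    (hps : ball p s ⊆ ball 0 1) (hq : ball q ε ⊆ ball p s) :
    ∃ x ∈ ball q ε, negLog (f x) ≤ ENNReal.ofReal ((s / ε) ^ (2 * n)) * negLog (f p) := by
  have hs : 0 < s := by
    have := hq (mem_ball_self hε)
    rw [mem_ball] at this
    exact dist_nonneg.trans_lt this
  have hv0 : volume (ball q ε) ≠ 0 := (measure_ball_pos volume q hε).ne'
  obtain ⟨x, hx, hle⟩ := exists_le_setLAverage hv0 measure_ball_lt_top.ne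
    (measurable_negLog.comp hfm).aemeasurable
  refine ⟨x, hx, hle.trans ?_⟩
  rw [setLAverage_eq, ENNReal.div_le_iff hv0 measure_ball_lt_top.ne]
  refine (lintegral_mono_set hq).trans ((setLIntegral_negLog_le hfm hf hf1 hps).trans
    (le_of_eq ?_))
  rw [Measure.addHaar_ball_of_pos volume p hs, Measure.addHaar_ball_of_pos volume q hε]
  have : Module.finrank ℝ (Fin n → ℂ) = 2 * n := by
    rw [Module.finrank_pi_fintype]
    simp [mul_comm]
  rw [this, div_pow, ENNReal.ofReal_div_of_pos (by positivity), ← mul_assoc,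
    mul_right_comm _ (negLog (f p)), ENNReal.div_mul_cancel, mul_right_comm]
  · simpa using pow_pos hε _
  · exact ENNReal.ofReal_ne_top

/-- A quantitative form of local integrability of `log ‖f‖`. -/
theorem exists_setLIntegral_negLog_le (n : ℕ) : ∃ C : ℝ, 0 < C ∧ ∀ f : (Fin n → ℂ) → ℂ,
    Measurable f → DifferentiableOn ℂ f (ball 0 1) →
    (∀ z ∈ ball (0 : Fin n → ℂ) 1, ‖f z‖ ≤ 1) → ∀ p : Fin n → ℂ, ‖p‖ ≤ 71 / 100 →
    ∫⁻ x in ball 0 (4 / 5), negLog (f x) ≤ ENNReal.ofReal C * negLog (f p) := by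
  set κ : ℝ := ((28 / 100) / (3 / 1000)) ^ (2 * n) with hκ
  have hκ0 : 0 < κ := by positivity
  set v : ℝ := (volume (ball (0 : Fin n → ℂ) (89 / 100))).toReal with hv
  have hv0 : 0 < v := ENNReal.toReal_pos (measure_ball_pos volume _ (by norm_num)).ne'
    measure_ball_lt_top.ne
  refine ⟨v * κ ^ 7, by positivity, fun f hfm hf hf1 p hp => ?_⟩
  have hstep : ∀ k : ℕ, ∃ q : Fin n → ℂ, ‖q‖ ≤ 71 / 100 ∧ ‖q‖ ≤ 71 / 100 * (7 / 10) ^ k + 1 / 100 ∧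
      negLog (f q) ≤ ENNReal.ofReal (κ ^ k) * negLog (f p) := by
    intro k
    induction k with
    | zero => exact ⟨p, hp, by norm_num; linarith, by simp⟩
    | succ k ih =>
      obtain ⟨q, hq, hqk, hle⟩ := ih
      have hsub : ball q (28 / 100) ⊆ ball 0 1 := by
        apply ball_subset_ball'
        rw [dist_zero_right]
        linarith
      have hsub2 : ball ((7 / 10 : ℝ) • q) (3 / 1000) ⊆ ball q (28 / 100) := by
        apply ball_subset_ball'
        have : (7 / 10 : ℝ) • q - q = (-(3 / 10) : ℝ) • q := by
          rw [← one_smul ℝ q, smul_smul, ← sub_smul, smul_smul]; norm_num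
        rw [dist_eq_norm, this, norm_smul, norm_neg, Real.norm_of_nonneg (by norm_num)]
        linarith
      obtain ⟨x, hx, hxle⟩ := exists_negLog_le hfm hf hf1 (by norm_num) hsub hsub2
      have hxn : ‖x‖ ≤ 7 / 10 * ‖q‖ + 3 / 1000 := by
        rw [mem_ball_iff_norm] at hx
        have h1 := norm_le_norm_add_norm_sub' x ((7 / 10 : ℝ) • q)
        rw [norm_smul, Real.norm_of_nonneg (by norm_num)] at h1
        linarith
      refine ⟨x, by linarith, ?_, hxle.trans ?_⟩
      · rw [pow_succ]
        linarith
      · rw [pow_succ', ENNReal.ofReal_mul hκ0.le, mul_assoc]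
        gcongr
  obtain ⟨q, -, hq, hle⟩ := hstep 7
  norm_num at hq
  have h1 : ball (0 : Fin n → ℂ) (4 / 5) ⊆ ball q (89 / 100) := by
    apply ball_subset_ball'
    rw [dist_zero_left]
    linarith
  have h2 : ball q (89 / 100) ⊆ ball 0 1 := by
    apply ball_subset_ball'
    rw [dist_zero_right]
    linarith
  refine (lintegral_mono_set h1).trans ((setLIntegral_negLog_le hfm hf hf1 h2).trans ?_)
  rw [Measure.addHaar_ball_center, ENNReal.ofReal_mul hv0.le, mul_assoc, hv,
    ENNReal.ofReal_toReal measure_ball_lt_top.ne]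
  gcongr

end Pi

theorem integral_comp_add_circleMap_mul (h : ℂ → ℝ) (c z : ℂ) :
    (2 * π)⁻¹ * ∫ θ in 0..2 * π, h (c + circleMap 0 1 θ * z) = circleAverage h c ‖z‖ := by
  rw [circleAverage_eq_integral_add (Complex.arg z), smul_eq_mul]
  congr 2
  ext θ
  congr 1
  have hz := Complex.norm_mul_exp_arg_mul_I z
  simp only [circleMap, zero_add, Complex.ofReal_one, one_mul, Complex.ofReal_add, add_mul,
    Complex.exp_add]
  nth_rw 1 [← hz]
  ring

theorem ofReal_neg_log_le_negLog (w : ℂ) : ENNReal.ofReal (-log ‖w‖) ≤ negLog w := by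
  unfold negLog
  split_ifs with h
  · exact le_top
  · exact le_rfl

section Pi

variable {n : ℕ}

theorem card_filter_norm_sub_lt_le {I : Finset (Fin n → ℂ)} {R : ℝ} (hR : 0 < R)
    (hI : ∀ p ∈ I, ∀ q ∈ I, p ≠ q → R ≤ ‖p - q‖) (x : Fin n → ℂ) :
    {p ∈ I | ‖p - x‖ < R}.card ≤ 5 ^ (2 * n) := by
  classical
  set J := ({p ∈ I | ‖p - x‖ < R}).image fun p => R⁻¹ • (p - x) with hJ
  have hinj : Function.Injective fun p : Fin n → ℂ => R⁻¹ • (p - x) := by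
    intro p q h
    simpa using smul_right_injective _ (inv_ne_zero hR.ne') h
  have hcard : J.card = {p ∈ I | ‖p - x‖ < R}.card := Finset.card_image_of_injective _ hinj
  have : Module.finrank ℝ (Fin n → ℂ) = 2 * n := by
    rw [Module.finrank_pi_fintype]
    simp [mul_comm]
  rw [← hcard, ← this]
  refine Besicovitch.card_le_of_separated J ?_ ?_
  · intro c hc
    obtain ⟨p, hp, rfl⟩ := Finset.mem_image.1 hc
    rw [Finset.mem_filter] at hp
    rw [norm_smul, norm_inv, Real.norm_of_nonneg hR.le, inv_mul_le_iff₀ hR]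
    linarith
  · intro c hc d hd hcd
    obtain ⟨p, hp, rfl⟩ := Finset.mem_image.1 hc
    obtain ⟨q, hq, rfl⟩ := Finset.mem_image.1 hd
    rw [Finset.mem_filter] at hp hq
    have hpq : p ≠ q := fun h => hcd (by rw [h])
    have heq : R⁻¹ • (p - x) - R⁻¹ • (q - x) = R⁻¹ • (p - q) := by
      rw [← smul_sub]; congr 1; abel
    rw [heq, norm_smul, norm_inv, Real.norm_of_nonneg hR.le, le_inv_mul_iff₀ hR, mul_one]
    exact hI p hp.1 q hq.1 hpq

/-- The polyannulus with radii `15 / 16` and `1`. -/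
def polyannulus (n : ℕ) : Set (Fin n → ℂ) := {x | ∀ j, 15 / 16 < ‖x j‖ ∧ ‖x j‖ < 1}

theorem isOpen_polyannulus : IsOpen (polyannulus n) := by
  have : polyannulus n = univ.pi fun _ => ball 0 1 \ closedBall 0 (15 / 16) := by
    ext x
    simp [polyannulus, and_comm]
  rw [this]
  exact isOpen_set_pi finite_univ fun _ _ => isOpen_ball.sdiff isClosed_closedBall

theorem measurableSet_polyannulus : MeasurableSet (polyannulus n) :=
  isOpen_polyannulus.measurableSet

theorem polyannulus_subset_ball : polyannulus n ⊆ ball 0 1 := by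
  intro x hx
  rw [mem_ball_zero_iff, pi_norm_lt_iff one_pos]
  exact fun j => (hx j).2

theorem volume_polyannulus_ne_zero : volume (polyannulus n) ≠ 0 := by
  refine (isOpen_polyannulus.measure_pos volume ⟨fun _ => (31 / 32 : ℝ), fun j => ?_⟩).ne'
  rw [Complex.norm_real]
  norm_num

theorem volume_polyannulus_ne_top : volume (polyannulus n) ≠ ⊤ :=
  ((measure_mono polyannulus_subset_ball).trans_lt measure_ball_lt_top).ne

end Pi

section Pi

variable {n : ℕ} {f : (Fin n → ℂ) → ℂ}

theorem integrableOn_log_norm (hfm : Measurable f)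
    (hf1 : ∀ z ∈ ball (0 : Fin n → ℂ) 1, ‖f z‖ ≤ 1)
    (hJ : ∫⁻ x in ball 0 (4 / 5), negLog (f x) ≠ ⊤) :
    IntegrableOn (fun x => log ‖f x‖) (ball 0 (4 / 5)) := by
  refine ⟨(by fun_prop : Measurable fun x => log ‖f x‖).aestronglyMeasurable, ?_⟩
  refine lt_of_le_of_lt ?_ hJ.lt_top
  refine setLIntegral_mono (measurable_negLog.comp hfm) fun x hx => ?_
  have hx1 : log ‖f x‖ ≤ 0 := Real.log_nonpos (norm_nonneg _)
    (hf1 x (ball_subset_ball (by norm_num) hx))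
  rw [← ofReal_norm, Real.norm_of_nonpos hx1]
  exact ofReal_neg_log_le_negLog _

theorem ae_ne_zero_of_lintegral_negLog (hfm : Measurable f)
    (hJ : ∫⁻ x in ball 0 (4 / 5), negLog (f x) ≠ ⊤) :
    ∀ᵐ x ∂(volume.restrict (ball 0 (4 / 5))), f x ≠ 0 := by
  filter_upwards [ae_lt_top (measurable_negLog.comp hfm) hJ] with x hx h0
  simp [h0, negLog_zero] at hx

theorem map_restrict_add_mul (p : Fin n → ℂ) {a : Fin n → ℂ} (ha : ∀ j, a j ≠ 0)
    {B : Set (Fin n → ℂ)} (hB : MeasurableSet B) :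
    Measure.map (fun x => p + a * x) (volume.restrict ((fun x => p + a * x) ⁻¹' B)) =
      ENNReal.ofReal (∏ j, (‖a j‖ ^ 2)⁻¹) • volume.restrict B := by
  rw [← Measure.restrict_map (by fun_prop) hB, map_add_mul_volume p ha, Measure.restrict_smul]

theorem IntegrableOn.comp_add_mul {v : (Fin n → ℂ) → ℝ} {B S : Set (Fin n → ℂ)}
    (hv : IntegrableOn v B) (hB : MeasurableSet B) {p a : Fin n → ℂ} (ha : ∀ j, a j ≠ 0)
    (hS : ∀ x ∈ S, p + a * x ∈ B) : IntegrableOn (fun x => v (p + a * x)) S := by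
  have h1 : Integrable v (Measure.map (fun x => p + a * x)
      (volume.restrict ((fun x => p + a * x) ⁻¹' B))) := by
    rw [map_restrict_add_mul p ha hB]
    exact hv.smul_measure ENNReal.ofReal_ne_top
  have h2 : IntegrableOn (fun x => v (p + a * x)) ((fun x => p + a * x) ⁻¹' B) :=
    h1.comp_measurable (by fun_prop)
  exact h2.mono_set hS

theorem ae_restrict_comp_add_mul {P : (Fin n → ℂ) → Prop} {B S : Set (Fin n → ℂ)}
    (hP : ∀ᵐ x ∂(volume.restrict B), P x) (hB : MeasurableSet B) {p a : Fin n → ℂ}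
    (ha : ∀ j, a j ≠ 0) (hS : ∀ x ∈ S, p + a * x ∈ B) :
    ∀ᵐ x ∂(volume.restrict S), P (p + a * x) := by
  have h1 : ∀ᵐ x ∂(Measure.map (fun x => p + a * x)
      (volume.restrict ((fun x => p + a * x) ⁻¹' B))), P x := by
    rw [map_restrict_add_mul p ha hB]
    exact Measure.ae_smul_measure hP _
  exact ae_mono (Measure.restrict_mono hS le_rfl) (ae_of_ae_map (by fun_prop) h1)

theorem add_mul_mem_ball {p : Fin n → ℂ} {r s : ℝ} (hp : ‖p‖ ≤ r) {a : Fin n → ℂ} (hs : 0 ≤ s)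
    (ha : ∀ j, ‖a j‖ ≤ s) (hrs : r + s < 4 / 5) :
    ∀ x ∈ polyannulus n, p + a * x ∈ ball (0 : Fin n → ℂ) (4 / 5) := by
  intro x hx
  have h0 : 0 ≤ ‖p‖ := norm_nonneg p
  rw [mem_ball_zero_iff, pi_norm_lt_iff (by norm_num)]
  intro j
  calc ‖p j + a j * x j‖ ≤ ‖p j‖ + ‖a j‖ * ‖x j‖ := (norm_add_le _ _).trans_eq (by rw [norm_mul])
    _ ≤ r + s * 1 := by
      gcongr
      · exact (norm_le_pi_norm p j).trans hp
      · exact ha j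
      · exact (hx j).2.le
    _ < 4 / 5 := by linarith

theorem restrict_polyannulus_measurePreserving {a : Fin n → ℂ} (ha : ∀ j, ‖a j‖ = 1) :
    MeasurePreserving (fun x : Fin n → ℂ => a * x) (volume.restrict (polyannulus n))
      (volume.restrict (polyannulus n)) := by
  have h := (measurePreserving_mul_of_norm_eq_one ha).restrict_preimage
    (measurableSet_polyannulus (n := n))
  have : (fun x : Fin n → ℂ => a * x) ⁻¹' polyannulus n = polyannulus n := by
    ext x
    simp [polyannulus, ha]
  rwa [this] at h

theorem circleIntegrable_log_norm_of_differentiableOn {U : Set ℂ} {g : ℂ → ℂ} {c : ℂ} {r : ℝ}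
    (hU : IsOpen U) (hg : DifferentiableOn ℂ g U) (hcr : sphere c |r| ⊆ U) :
    CircleIntegrable (fun z => log ‖g z‖) c r := by
  apply MeromorphicOn.circleIntegrable_log_norm
  intro z hz
  exact ((hg.analyticOnNhd hU) z (hcr hz)).meromorphicAt

/-- Lower bound for the growth of the averages of `log ‖f‖` at a zero of `f`. -/
theorem log_two_mul_volume_le (hfm : Measurable f) (hf : DifferentiableOn ℂ f (ball 0 1))
    (hf1 : ∀ z ∈ ball (0 : Fin n → ℂ) 1, ‖f z‖ ≤ 1)
    (hJ : ∫⁻ x in ball 0 (4 / 5), negLog (f x) ≠ ⊤) {p : Fin n → ℂ} (hp : ‖p‖ ≤ 71 / 100)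
    (hfp : f p = 0) {R : ℝ} (hR : 0 < R) (hR1 : R ≤ 1 / 25) :
    log 2 * (volume (polyannulus n)).toReal ≤
      ∫ x in polyannulus n, (log ‖f (p + (fun _ => (R : ℂ)) * x)‖ -
        log ‖f (p + (fun _ => ((R / 2 : ℝ) : ℂ)) * x)‖) := by
  have hRC : ∀ j : Fin n, (fun _ => (R : ℂ) : Fin n → ℂ) j ≠ 0 := fun _ => by
    simpa using hR.ne'
  have hRC2 : ∀ j : Fin n, (fun _ => ((R / 2 : ℝ) : ℂ) : Fin n → ℂ) j ≠ 0 := fun _ => by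
    simpa using hR.ne'
  have hmem := add_mul_mem_ball hp (a := fun _ => (R : ℂ)) hR.le
    (fun _ => by simp [abs_of_pos hR]) (by linarith)
  have hmem2 := add_mul_mem_ball hp (a := fun _ => ((R / 2 : ℝ) : ℂ)) hR.le
    (fun _ => by rw [Complex.norm_real, Real.norm_of_nonneg (by positivity)]; linarith)
    (by linarith)
  have hv := integrableOn_log_norm hfm hf1 hJ
  have hi1 := IntegrableOn.comp_add_mul hv measurableSet_ball hRC hmem
  have hi2 := IntegrableOn.comp_add_mul hv measurableSet_ball hRC2 hmem2
  have hD : Integrable (fun x => log ‖f (p + (fun _ => (R : ℂ)) * x)‖ -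
        log ‖f (p + (fun _ => ((R / 2 : ℝ) : ℂ)) * x)‖) (volume.restrict (polyannulus n)) :=
    Integrable.sub hi1 hi2
  have hφ : Measurable (Function.uncurry fun (θ : ℝ) (x : Fin n → ℂ) =>
      (fun _ => circleMap 0 1 θ) * x) := by
    apply Continuous.measurable
    unfold Function.uncurry
    fun_prop
  have hmp : ∀ θ : ℝ, MeasurePreserving (fun x : Fin n → ℂ => (fun _ => circleMap 0 1 θ) * x)
      (volume.restrict (polyannulus n)) (volume.restrict (polyannulus n)) := fun θ =>
    restrict_polyannulus_measurePreserving fun _ => by simp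
  rw [← integral_average_comp hφ hmp hD]
  have hconst : ∫ _ in polyannulus n, log 2 = log 2 * (volume (polyannulus n)).toReal := by
    rw [setIntegral_const, smul_eq_mul, mul_comm]
    rfl
  rw [← hconst]
  refine integral_mono_ae (integrableOn_const volume_polyannulus_ne_top)
    (integrable_average_comp hφ hmp hD) ?_
  filter_upwards [ae_restrict_comp_add_mul (ae_ne_zero_of_lintegral_negLog hfm hJ)
    measurableSet_ball hRC hmem, ae_restrict_mem measurableSet_polyannulus] with x hx0 hx
  set y : Fin n → ℂ := (fun _ => (R : ℂ)) * x with hy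
  have hyn : ‖y‖ ≤ R := by
    rw [pi_norm_le_iff_of_nonneg hR.le]
    intro j
    simp only [hy, Pi.mul_apply, norm_mul, Complex.norm_real, Real.norm_of_nonneg hR.le]
    nlinarith [(hx j).2]
  set U : Set ℂ := (fun w : ℂ => p + w • y) ⁻¹' ball 0 1 with hUdef
  have hUo : IsOpen U := isOpen_ball.preimage (by fun_prop)
  have hUc : Convex ℝ U := by
    intro a ha b hb α β hα hβ hαβ
    have := convex_ball (0 : Fin n → ℂ) 1 ha hb hα hβ hαβ
    rw [hUdef, mem_preimage]
    convert this using 1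
    have : p = α • p + β • p := by rw [← add_smul, hαβ, one_smul]
    nth_rw 1 [this]
    simp only [smul_add, add_smul, smul_assoc]
    abel
  have hsub : closedBall (0 : ℂ) 1 ⊆ U := by
    intro w hw
    rw [mem_closedBall_zero_iff] at hw
    rw [hUdef, mem_preimage, mem_ball_zero_iff]
    calc ‖p + w • y‖ ≤ ‖p‖ + ‖w‖ * ‖y‖ := (norm_add_le _ _).trans_eq (by rw [norm_smul])
      _ ≤ 71 / 100 + 1 * R := by gcongr
      _ < 1 := by linarith
  have hg : DifferentiableOn ℂ (fun w : ℂ => f (p + w • y)) U :=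
    hf.comp (by fun_prop) fun w hw => hw
  have key := log_sub_log_le_circleAverage_sub hUo hUc.isPreconnected hg
    (c := 0) (r := 1 / 2) (R := 1) (by norm_num) (by norm_num) hsub (by simpa using hfp)
    ⟨1, hsub (by simp), by simpa using hx0⟩
  have hc1 : CircleIntegrable (fun z => log ‖f (p + z • y)‖) 0 1 :=
    circleIntegrable_log_norm_of_differentiableOn hUo hg
      (by rw [abs_one]; exact sphere_subset_closedBall.trans hsub)
  have hc2 : CircleIntegrable (fun z => log ‖f (p + z • y)‖) 0 (1 / 2) :=
    circleIntegrable_log_norm_of_differentiableOn hUo hg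
      (by rw [abs_of_pos (by norm_num)]
          exact (sphere_subset_closedBall.trans (closedBall_subset_closedBall (by norm_num))).trans
            hsub)
  have hlog : log 1 - log (1 / 2) = log 2 := by
    rw [Real.log_one, one_div, Real.log_inv]; ring
  rw [hlog, circleAverage_def, circleAverage_def, ← smul_sub,
    ← intervalIntegral.integral_sub hc1 hc2,
    smul_eq_mul] at key
  refine key.trans (le_of_eq ?_)
  congr 2
  ext θ
  have e1 : (fun _ => (R : ℂ)) * ((fun _ => circleMap 0 1 θ) * x) = circleMap 0 1 θ • y := by
    ext j
    simp [hy]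
    ring
  have e2 : (fun _ => ((R / 2 : ℝ) : ℂ)) * ((fun _ => circleMap 0 1 θ) * x) =
      circleMap 0 (1 / 2) θ • y := by
    ext j
    simp [hy, circleMap]
    ring
  rw [e1, e2]

end Pi

theorem ofReal_integral_le_lintegral {X : Type*} [MeasurableSpace X] {μ : Measure X} (h : X → ℝ) :
    ENNReal.ofReal (∫ x, h x ∂μ) ≤ ∫⁻ x, ENNReal.ofReal (h x) ∂μ := by
  by_cases hi : Integrable h μ
  · rw [integral_eq_lintegral_pos_part_sub_lintegral_neg_part hi]
    refine (ENNReal.ofReal_le_ofReal (sub_le_self _ ENNReal.toReal_nonneg)).trans ?_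
    exact ENNReal.ofReal_toReal_le
  · rw [integral_undef hi]
    simp

section Pi

variable {n : ℕ} {f : (Fin n → ℂ) → ℂ}

/-- Increment between radii `R / 2 * ‖z k‖` and `R * ‖z k‖` of the circle averages of `log ‖f‖`
around `c` in the `k`-th coordinate direction. -/
def sliceIncr (f : (Fin n → ℂ) → ℂ) (k : Fin n) (c : ℂ) (R : ℝ) (z : Fin n → ℂ) : ℝ :=
  circleAverage (fun w => log ‖f (Function.update z k w)‖) c (R * ‖z k‖) -
    circleAverage (fun w => log ‖f (Function.update z k w)‖) c (R / 2 * ‖z k‖)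

theorem continuous_update_circleMap (k : Fin n) (c : ℂ) (R : ℝ) :
    Continuous fun q : (Fin n → ℂ) × ℝ =>
      Function.update q.1 k (circleMap c (R * ‖q.1 k‖) q.2) := by
  refine Continuous.update continuous_fst k ?_
  unfold circleMap
  fun_prop

theorem measurable_circleAverage_update (hfm : Measurable f) (k : Fin n) (c : ℂ) (R : ℝ) :
    Measurable fun z : Fin n → ℂ =>
      circleAverage (fun w => log ‖f (Function.update z k w)‖) c (R * ‖z k‖) := by
  simp only [circleAverage_def, intervalIntegral.integral_of_le two_pi_pos.le]
  have h : StronglyMeasurable (Function.uncurry fun (z : Fin n → ℂ) (θ : ℝ) =>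
      log ‖f (Function.update z k (circleMap c (R * ‖z k‖) θ))‖) := by
    apply Measurable.stronglyMeasurable
    unfold Function.uncurry
    have := hfm.comp (continuous_update_circleMap k c R).measurable
    exact Real.measurable_log.comp (measurable_norm.comp this)
  exact (h.integral_prod_right (ν := volume.restrict (Ioc 0 (2 * π)))).measurable.const_smul
    (2 * π)⁻¹

theorem measurable_sliceIncr (hfm : Measurable f) (k : Fin n) (c : ℂ) (R : ℝ) :
    Measurable (sliceIncr f k c R) :=
  (measurable_circleAverage_update hfm k c R).sub (measurable_circleAverage_update hfm k c (R / 2))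

theorem differentiableOn_update_slice (hf : DifferentiableOn ℂ f (ball 0 1)) (k : Fin n)
    {z : Fin n → ℂ} (hz : ∀ j ≠ k, ‖z j‖ < 1) :
    DifferentiableOn ℂ (fun w => f (Function.update z k w)) (ball 0 1) := by
  refine hf.comp ?_ ?_
  · intro w _
    exact (differentiable_pi.2 fun j => by
      by_cases hj : j = k
      · subst hj; simp
      · simp [hj]).differentiableAt.differentiableWithinAt
  · intro w hw
    rw [mem_ball_zero_iff] at hw ⊢
    rw [pi_norm_lt_iff one_pos]
    intro j
    by_cases hj : j = k
    · subst hj; simpa using hw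
    · simpa [hj] using hz j hj

theorem update_mem_ball (k : Fin n) {z : Fin n → ℂ} (hz : ∀ j ≠ k, ‖z j‖ < 1) {w : ℂ}
    (hw : w ∈ ball (0 : ℂ) 1) : Function.update z k w ∈ ball (0 : Fin n → ℂ) 1 := by
  rw [mem_ball_zero_iff] at hw ⊢
  rw [pi_norm_lt_iff one_pos]
  intro j
  by_cases hj : j = k
  · subst hj; simpa using hw
  · simpa [hj] using hz j hj

/-- Domain of the transversal variables around `p`. -/
def slabAround (p : Fin n → ℂ) (k : Fin n) (R : ℝ) : Set (Fin n → ℂ) :=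
  {z | (∀ j ≠ k, ‖z j - p j‖ < R) ∧ 15 / 16 < ‖z k‖ ∧ ‖z k‖ < 1}

theorem measurableSet_slabAround (p : Fin n → ℂ) (k : Fin n) (R : ℝ) :
    MeasurableSet (slabAround p k R) := by
  apply IsOpen.measurableSet
  have : slabAround p k R = (univ.pi fun j => if j = k then ball 0 1 \ closedBall 0 (15 / 16)
      else ball (p j) R) := by
    ext z
    simp only [slabAround, mem_ofPred_eq, mem_univ_pi]
    constructor
    · intro h j
      by_cases hj : j = k
      · subst hj
        simpa [and_comm] using h.2
      · simpa [hj, dist_eq_norm] using h.1 j hj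
    · intro h
      refine ⟨fun j hj => ?_, ?_⟩
      · simpa [hj, dist_eq_norm] using h j
      · simpa [and_comm] using h k
  rw [this]
  refine isOpen_set_pi finite_univ fun j _ => ?_
  split_ifs
  · exact isOpen_ball.sdiff isClosed_closedBall
  · exact isOpen_ball

/-- Increasing one radius increases the average of `log ‖f‖` in a controlled manner. -/
theorem ofReal_integral_sub_le (hfm : Measurable f) (hf : DifferentiableOn ℂ f (ball 0 1))
    (hf1 : ∀ z ∈ ball (0 : Fin n → ℂ) 1, ‖f z‖ ≤ 1)
    (hJ : ∫⁻ x in ball 0 (4 / 5), negLog (f x) ≠ ⊤) {p : Fin n → ℂ} (hp : ‖p‖ ≤ 71 / 100)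
    {R : ℝ} (hR : 0 < R) (hR1 : R ≤ 1 / 25) {ρ : Fin n → ℝ} (hρ1 : ∀ j, R / 2 ≤ ρ j)
    (hρ2 : ∀ j, ρ j ≤ R) {k : Fin n} (hk : ρ k = R / 2) :
    ENNReal.ofReal (∫ x in polyannulus n,
      (log ‖f (p + (fun j => ((Function.update ρ k R j : ℝ) : ℂ)) * x)‖ -
        log ‖f (p + (fun j => (ρ j : ℂ)) * x)‖)) ≤
      ENNReal.ofReal (((R / 2) ^ (2 * n - 2))⁻¹) *
        ∫⁻ z in slabAround p k R, ENNReal.ofReal (sliceIncr f k (p k) R z) := by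
  have hρ0 : ∀ j, 0 < ρ j := fun j => lt_of_lt_of_le (by positivity) (hρ1 j)
  have hρn : ∀ j, ‖(ρ j : ℂ)‖ = ρ j := fun j => by
    rw [Complex.norm_real, Real.norm_of_nonneg (hρ0 j).le]
  have hρC : ∀ j, (fun j => (ρ j : ℂ)) j ≠ 0 := fun j => by
    simpa using (hρ0 j).ne'
  have hρC' : ∀ j, (fun j => ((Function.update ρ k R j : ℝ) : ℂ)) j ≠ 0 := fun j => by
    by_cases hj : j = k
    · subst hj; simpa using hR.ne'
    · simpa [hj] using (hρ0 j).ne'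
  have hρn' : ∀ j, ‖((Function.update ρ k R j : ℝ) : ℂ)‖ ≤ R := fun j => by
    by_cases hj : j = k
    · subst hj; simp [abs_of_pos hR]
    · simpa [hj, abs_of_pos (hρ0 j)] using hρ2 j
  have hmem := add_mul_mem_ball hp (a := fun j => (ρ j : ℂ)) hR.le
    (fun j => by rw [hρn]; exact hρ2 j) (by linarith)
  have hmem' := add_mul_mem_ball hp (a := fun j => ((Function.update ρ k R j : ℝ) : ℂ)) hR.le
    hρn' (by linarith)
  have hv := integrableOn_log_norm hfm hf1 hJ
  have hi1 := IntegrableOn.comp_add_mul hv measurableSet_ball hρC hmem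
  have hi2 := IntegrableOn.comp_add_mul hv measurableSet_ball hρC' hmem'
  have hD : Integrable (fun x => log ‖f (p + (fun j => ((Function.update ρ k R j : ℝ) : ℂ)) * x)‖ -
        log ‖f (p + (fun j => (ρ j : ℂ)) * x)‖) (volume.restrict (polyannulus n)) :=
    Integrable.sub hi2 hi1
  have hφ : Measurable (Function.uncurry fun (θ : ℝ) (x : Fin n → ℂ) =>
      Function.update (1 : Fin n → ℂ) k (circleMap 0 1 θ) * x) := by
    apply Continuous.measurable
    unfold Function.uncurry
    have : Continuous fun q : ℝ × (Fin n → ℂ) =>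
        Function.update (1 : Fin n → ℂ) k (circleMap 0 1 q.1) :=
      Continuous.update continuous_const k (by fun_prop)
    fun_prop
  have hmp : ∀ θ : ℝ, MeasurePreserving
      (fun x : Fin n → ℂ => Function.update (1 : Fin n → ℂ) k (circleMap 0 1 θ) * x)
      (volume.restrict (polyannulus n)) (volume.restrict (polyannulus n)) := fun θ =>
    restrict_polyannulus_measurePreserving fun j => by
      by_cases hj : j = k
      · subst hj; simp
      · simp [hj]
  set p' : Fin n → ℂ := Function.update p k 0 with hp'
  set a' : Fin n → ℂ := Function.update (fun j => (ρ j : ℂ)) k 1 with ha'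
  have ha0 : ∀ j, a' j ≠ 0 := fun j => by
    by_cases hj : j = k
    · subst hj; simp [ha']
    · simpa [ha', hj] using (hρ0 j).ne'
  have hψk : ∀ x, (p' + a' * x) k = x k := fun x => by simp [hp', ha']
  have hψj : ∀ x, ∀ j ≠ k, (p' + a' * x) j = p j + ρ j * x j := fun x j hj => by
    simp [hp', ha', hj]
  have hslice : ∀ x ∈ polyannulus n, ∀ j ≠ k, ‖(p' + a' * x) j‖ < 1 := by
    intro x hx j hj
    rw [hψj x j hj]
    have h1 := hmem x hx
    rw [mem_ball_zero_iff, pi_norm_lt_iff (by norm_num)] at h1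
    have := h1 j
    simp only [Pi.add_apply, Pi.mul_apply] at this
    linarith
  have hB : ∀ x ∈ polyannulus n, (2 * π)⁻¹ * ∫ θ in 0..2 * π,
      (log ‖f (p + (fun j => ((Function.update ρ k R j : ℝ) : ℂ)) *
        (Function.update (1 : Fin n → ℂ) k (circleMap 0 1 θ) * x))‖ -
        log ‖f (p + (fun j => (ρ j : ℂ)) *
          (Function.update (1 : Fin n → ℂ) k (circleMap 0 1 θ) * x))‖)
      = sliceIncr f k (p k) R (p' + a' * x) := by
    intro x hx
    set g : ℂ → ℂ := fun w => f (Function.update (p' + a' * x) k w) with hgdef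
    have hg : DifferentiableOn ℂ g (ball 0 1) := differentiableOn_update_slice hf k (hslice x hx)
    have e1 : ∀ θ, p + (fun j => ((Function.update ρ k R j : ℝ) : ℂ)) *
        (Function.update (1 : Fin n → ℂ) k (circleMap 0 1 θ) * x) =
        Function.update (p' + a' * x) k (p k + circleMap 0 1 θ * (R * x k)) := by
      intro θ
      ext j
      by_cases hj : j = k
      · subst hj; simp; ring
      · simp [hj, hp', ha']
    have e2 : ∀ θ, p + (fun j => (ρ j : ℂ)) *
        (Function.update (1 : Fin n → ℂ) k (circleMap 0 1 θ) * x) =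
        Function.update (p' + a' * x) k (p k + circleMap 0 1 θ * ((R / 2 : ℝ) * x k)) := by
      intro θ
      ext j
      by_cases hj : j = k
      · subst hj; simp [hk]; ring
      · simp [hj, hp', ha']
    have hxk := hx k
    have hsub : ∀ s : ℝ, 0 ≤ s → s ≤ R → sphere (p k) |s * ‖x k‖| ⊆ ball 0 1 := by
      intro s hs hsR w hw
      rw [mem_sphere_iff_norm, abs_of_nonneg (by positivity)] at hw
      rw [mem_ball_zero_iff]
      have h1 := norm_le_norm_add_norm_sub' w (p k)
      have h2 := (norm_le_pi_norm p k).trans hp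
      have h3 : s * ‖x k‖ ≤ R * 1 := by
        gcongr
        exact hxk.2.le
      linarith
    have hnorm : ∀ s : ℝ, 0 ≤ s → ‖(s : ℂ) * x k‖ = s * ‖x k‖ := fun s hs => by
      rw [norm_mul, Complex.norm_real, Real.norm_of_nonneg hs]
    have hc : ∀ s : ℝ, 0 ≤ s → s ≤ R → IntervalIntegrable
        (fun θ => log ‖g (p k + circleMap 0 1 θ * ((s : ℂ) * x k))‖) volume 0 (2 * π) := by
      intro s hs hsR
      have h1 : CircleIntegrable (fun w => log ‖g w‖) (p k) (s * ‖x k‖) :=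
        circleIntegrable_log_norm_of_differentiableOn isOpen_ball hg (hsub s hs hsR)
      have h2 : CircleIntegrable (fun w => log ‖g (p k + w * ((s : ℂ) * x k))‖) 0 1 := by
        apply MeromorphicOn.circleIntegrable_log_norm (f := fun w => g (p k + w * ((s : ℂ) * x k)))
        intro w hw
        refine AnalyticAt.meromorphicAt ?_
        refine AnalyticAt.fun_comp (g := g) ?_ (by fun_prop)
        apply (hg.analyticOnNhd isOpen_ball)
        apply hsub s hs hsR
        rw [abs_one, mem_sphere_zero_iff_norm] at hw
        rw [mem_sphere_iff_norm, add_sub_cancel_left, norm_mul, hw, one_mul, hnorm s hs,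
          abs_of_nonneg (by positivity)]
      exact h2
    simp only [e1, e2]
    rw [intervalIntegral.integral_sub (hc R hR.le le_rfl)
      (hc (R / 2) (by positivity) (by linarith)),
      mul_sub, integral_comp_add_circleMap_mul (fun w => log ‖g w‖),
      integral_comp_add_circleMap_mul (fun w => log ‖g w‖), hnorm R hR.le,
      hnorm (R / 2) (by positivity)]
    simp only [sliceIncr, hψk]
    rfl
  rw [← integral_average_comp hφ hmp hD, setIntegral_congr_fun measurableSet_polyannulus hB]
  refine (ofReal_integral_le_lintegral _).trans ?_
  have hmeas : Measurable ((slabAround p k R).indicator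
      fun z => ENNReal.ofReal (sliceIncr f k (p k) R z)) :=
    (measurable_sliceIncr hfm k (p k) R).ennreal_ofReal.indicator (measurableSet_slabAround p k R)
  calc ∫⁻ x in polyannulus n, ENNReal.ofReal (sliceIncr f k (p k) R (p' + a' * x))
      ≤ ∫⁻ x in polyannulus n, (slabAround p k R).indicator
          (fun z => ENNReal.ofReal (sliceIncr f k (p k) R z)) (p' + a' * x) := by
        refine setLIntegral_mono' measurableSet_polyannulus fun x hx => ?_
        rw [indicator_of_mem]
        refine ⟨fun j hj => ?_, ?_⟩
        · rw [hψj x j hj, add_sub_cancel_left, norm_mul, hρn]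
          calc ρ j * ‖x j‖ < ρ j * 1 := by
                gcongr
                · exact hρ0 j
                · exact (hx j).2
            _ ≤ R := by linarith [hρ2 j]
        · rw [hψk]
          exact hx k
    _ ≤ ∫⁻ x, (slabAround p k R).indicator
          (fun z => ENNReal.ofReal (sliceIncr f k (p k) R z)) (p' + a' * x) :=
        setLIntegral_le_lintegral _ _
    _ = ENNReal.ofReal (∏ j, (‖a' j‖ ^ 2)⁻¹) *
          ∫⁻ z in slabAround p k R, ENNReal.ofReal (sliceIncr f k (p k) R z) := by
        rw [lintegral_comp_add_mul p' ha0 hmeas,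
          lintegral_indicator (measurableSet_slabAround p k R)]
    _ ≤ _ := by
        gcongr
        rw [← Finset.mul_prod_erase _ _ (Finset.mem_univ k)]
        have hk1 : (‖a' k‖ ^ 2)⁻¹ = 1 := by simp [ha']
        rw [hk1, one_mul]
        calc ∏ j ∈ Finset.univ.erase k, (‖a' j‖ ^ 2)⁻¹
            ≤ ∏ j ∈ Finset.univ.erase k, ((R / 2) ^ 2)⁻¹ := by
              refine Finset.prod_le_prod (fun j _ => by positivity) fun j hj => ?_
              have hj' : j ≠ k := (Finset.mem_erase.1 hj).1
              have : ‖a' j‖ = ρ j := by simp only [ha', ne_eq, hj', not_false_eq_true,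
                Function.update_of_ne, hρn]
              rw [this]
              have := hρ1 j
              gcongr
          _ = ((R / 2) ^ (2 * n - 2))⁻¹ := by
              rw [Finset.prod_const, Finset.card_erase_of_mem (Finset.mem_univ k), Finset.card_univ,
                Fintype.card_fin, inv_pow, ← pow_mul]
              congr 2
              omega

end Pi

section Pi

variable {n : ℕ} {f : (Fin n → ℂ) → ℂ}

theorem setLIntegral_circleAverage_update_le (hfm : Measurable f) (k : Fin n) :
    ∫⁻ z in slabAround 0 k (3 / 4), ENNReal.ofReal
        (-circleAverage (fun w => log ‖f (Function.update z k w)‖) 0 (4 / 5 * ‖z k‖)) ≤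
      ENNReal.ofReal (25 / 16) * ∫⁻ x in ball 0 (4 / 5), negLog (f x) := by
  classical
  have hG := measurableSet_slabAround (0 : Fin n → ℂ) k (3 / 4)
  set G := slabAround (0 : Fin n → ℂ) k (3 / 4) with hGdef
  set b : Fin n → ℂ := Function.update 1 k ((4 / 5 : ℝ) : ℂ) with hb
  have hb0 : ∀ j, b j ≠ 0 := fun j => by
    by_cases hj : j = k
    · subst hj; simp [hb]
    · simp [hb, hj]
  have hφ : Measurable (Function.uncurry fun (θ : ℝ) (x : Fin n → ℂ) =>
      Function.update (1 : Fin n → ℂ) k (circleMap 0 1 θ) * x) := by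
    apply Continuous.measurable
    unfold Function.uncurry
    have : Continuous fun q : ℝ × (Fin n → ℂ) =>
        Function.update (1 : Fin n → ℂ) k (circleMap 0 1 q.1) :=
      Continuous.update continuous_const k (by fun_prop)
    fun_prop
  have hnorm : ∀ (θ : ℝ) j, ‖Function.update (1 : Fin n → ℂ) k (circleMap 0 1 θ) j‖ = 1 := by
    intro θ j
    by_cases hj : j = k
    · subst hj; simp
    · simp [hj]
  have hmp : ∀ θ : ℝ, MeasurePreserving
      (fun x : Fin n → ℂ => Function.update (1 : Fin n → ℂ) k (circleMap 0 1 θ) * x)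
      (volume.restrict G) (volume.restrict G) := by
    intro θ
    have h := (measurePreserving_mul_of_norm_eq_one (hnorm θ)).restrict_preimage hG
    have : (fun x : Fin n → ℂ => Function.update (1 : Fin n → ℂ) k (circleMap 0 1 θ) * x) ⁻¹' G
        = G := by
      ext x
      simp only [hGdef, slabAround, mem_preimage, mem_ofPred_eq, Pi.zero_apply, sub_zero,
        Pi.mul_apply, norm_mul, hnorm, one_mul]
    rwa [this] at h
  have hD : Measurable fun x : Fin n → ℂ => negLog (f (b * x)) :=
    measurable_negLog.comp (hfm.comp (measurable_const_mul b))
  have havg := lintegral_average_comp hφ hmp hD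
  have h2π : ENNReal.ofReal (2 * π)⁻¹ * ENNReal.ofReal (2 * π) = 1 := by
    rw [← ENNReal.ofReal_mul (by positivity), inv_mul_cancel₀ two_pi_pos.ne', ENNReal.ofReal_one]
  calc ∫⁻ z in G, ENNReal.ofReal
        (-circleAverage (fun w => log ‖f (Function.update z k w)‖) 0 (4 / 5 * ‖z k‖))
      ≤ ∫⁻ z in G, ENNReal.ofReal (2 * π)⁻¹ * ∫⁻ θ in Ioc 0 (2 * π),
          negLog (f (b * (Function.update (1 : Fin n → ℂ) k (circleMap 0 1 θ) * z))) := by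
        refine lintegral_mono fun z => ?_
        have e1 : 4 / 5 * ‖z k‖ = ‖((4 / 5 : ℝ) : ℂ) * z k‖ := by
          rw [norm_mul, Complex.norm_real, Real.norm_of_nonneg (by norm_num)]
        have e2 : ∀ θ, b * (Function.update (1 : Fin n → ℂ) k (circleMap 0 1 θ) * z) =
            Function.update z k (0 + circleMap 0 1 θ * (((4 / 5 : ℝ) : ℂ) * z k)) := by
          intro θ
          ext j
          by_cases hj : j = k
          · subst hj; simp [hb]; ring
          · simp [hb, hj]
        simp only [e1, e2]
        rw [← integral_comp_add_circleMap_mul (fun w => log ‖f (Function.update z k w)‖),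
          ← mul_neg, ENNReal.ofReal_mul (by positivity),
          intervalIntegral.integral_of_le two_pi_pos.le, ← integral_neg]
        gcongr
        refine (ofReal_integral_le_lintegral _).trans (lintegral_mono fun θ => ?_)
        exact ofReal_neg_log_le_negLog _
    _ = ∫⁻ z in G, negLog (f (b * z)) := by
        rw [lintegral_const_mul' _ _ ENNReal.ofReal_ne_top, havg, ← mul_assoc, h2π, one_mul]
    _ ≤ ∫⁻ z in G, (ball 0 (4 / 5)).indicator (fun x => negLog (f x)) (0 + b * z) := by
        refine setLIntegral_mono' hG fun z hz => ?_
        rw [zero_add, indicator_of_mem]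
        rw [mem_ball_zero_iff, pi_norm_lt_iff (by norm_num)]
        intro j
        by_cases hj : j = k
        · subst hj
          have := hz.2.2
          simp only [hb, Pi.mul_apply, Function.update_self, norm_mul, Complex.norm_real,
            Real.norm_of_nonneg (by norm_num : (0 : ℝ) ≤ 4 / 5)]
          linarith
        · have := hz.1 j hj
          simp only [Pi.zero_apply, sub_zero] at this
          simp only [hb, Pi.mul_apply, ne_eq, hj, not_false_eq_true, Function.update_of_ne,
            Pi.one_apply, one_mul]
          linarith
    _ ≤ ∫⁻ z, (ball 0 (4 / 5)).indicator (fun x => negLog (f x)) (0 + b * z) :=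
        setLIntegral_le_lintegral _ _
    _ = ENNReal.ofReal (25 / 16) * ∫⁻ x in ball 0 (4 / 5), negLog (f x) := by
        have hm : Measurable ((ball 0 (4 / 5)).indicator fun x => negLog (f x)) :=
          Measurable.indicator (measurable_negLog.comp hfm) measurableSet_ball
        rw [lintegral_comp_add_mul 0 hb0 hm,
          lintegral_indicator measurableSet_ball]
        congr 2
        rw [← Finset.mul_prod_erase _ _ (Finset.mem_univ k), Finset.prod_eq_one]
        · simp only [hb, Function.update_self, Complex.norm_real,
            Real.norm_of_nonneg (by norm_num : (0 : ℝ) ≤ 4 / 5)]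
          norm_num
        · intro j hj
          simp [hb, (Finset.mem_erase.1 hj).1]

theorem sum_setLIntegral_sliceIncr_le (hfm : Measurable f) (hf : DifferentiableOn ℂ f (ball 0 1))
    (hf1 : ∀ z ∈ ball (0 : Fin n → ℂ) 1, ‖f z‖ ≤ 1) (k : Fin n) {R : ℝ} (hR : 0 < R)
    (hR1 : R ≤ 1 / 25) {I : Finset (Fin n → ℂ)} (hI : ∀ p ∈ I, ‖p‖ ≤ 71 / 100)
    (hsep : ∀ p ∈ I, ∀ q ∈ I, p ≠ q → R ≤ ‖p - q‖) :
    ∑ p ∈ I, ∫⁻ z in slabAround p k R, ENNReal.ofReal (sliceIncr f k (p k) R z) ≤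
      ENNReal.ofReal (5 ^ (2 * n) * (log 2 / log (17 / 16))) *
        ∫⁻ z in slabAround 0 k (3 / 4), ENNReal.ofReal
          (-circleAverage (fun w => log ‖f (Function.update z k w)‖) 0 (4 / 5 * ‖z k‖)) := by
  classical
  have hm : ∀ p : Fin n → ℂ, Measurable ((slabAround p k R).indicator
      fun z => ENNReal.ofReal (sliceIncr f k (p k) R z)) := fun p =>
    (measurable_sliceIncr hfm k (p k) R).ennreal_ofReal.indicator (measurableSet_slabAround p k R)
  simp_rw [← lintegral_indicator (measurableSet_slabAround _ k _)]
  rw [← lintegral_finsetSum _ fun p _ => hm p, ← lintegral_const_mul' _ _ ENNReal.ofReal_ne_top]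
  refine lintegral_mono fun z => ?_
  simp only [indicator_apply]
  rw [← Finset.sum_filter]
  set J := I.filter fun p => z ∈ slabAround p k R with hJ
  rcases J.eq_empty_or_nonempty with hemp | ⟨q, hq⟩
  · rw [hemp]
    simp
  have hqI := (Finset.mem_filter.1 hq).1
  have hzq := (Finset.mem_filter.1 hq).2
  have hzG : z ∈ slabAround 0 k (3 / 4) := by
    refine ⟨fun j hj => ?_, hzq.2⟩
    have h1 := hzq.1 j hj
    have h2 := (norm_le_pi_norm q j).trans (hI q hqI)
    have h3 := norm_le_norm_add_norm_sub' (z j) (q j)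
    rw [Pi.zero_apply, sub_zero]
    linarith
  rw [if_pos hzG]
  have hz1 : ∀ j ≠ k, ‖z j‖ < 1 := fun j hj => by
    have := hzG.1 j hj
    rw [Pi.zero_apply, sub_zero] at this
    linarith
  have hz0 : 0 < ‖z k‖ := by linarith [hzG.2.1]
  have hg := differentiableOn_update_slice hf k hz1
  have hg1 : ∀ w ∈ ball (0 : ℂ) 1, ‖f (Function.update z k w)‖ ≤ 1 := fun w hw =>
    hf1 _ (update_mem_ball k hz1 hw)
  have hnn : ∀ p ∈ J, 0 ≤ sliceIncr f k (p k) R z := by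
    intro p hp
    have hpI := (Finset.mem_filter.1 hp).1
    refine sub_nonneg.2 (circleAverage_log_norm_mono isOpen_ball
      (convex_ball (0 : ℂ) 1).isPreconnected hg (by positivity) ?_ ?_)
    · gcongr
      linarith
    · apply closedBall_subset_ball'
      rw [dist_zero_right]
      have h2 := (norm_le_pi_norm p k).trans (hI p hpI)
      have h3 : R * ‖z k‖ ≤ R * 1 := by
        gcongr
        exact hzG.2.2.le
      linarith
  rw [← ENNReal.ofReal_sum_of_nonneg hnn, ← ENNReal.ofReal_mul]
  · apply ENNReal.ofReal_le_ofReal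
    have := sum_circleAverage_sub_le hg hg1 J (fun p => p k) hR (K := 5 ^ (2 * n)) ?_ ?_ hz0
      hzG.2.2.le (ρ := 4 / 5 * ‖z k‖) (by linarith [hzG.2.1]) (by linarith [hzG.2.2])
    · push_cast at this
      exact this
    · intro p hp
      have := (norm_le_pi_norm p k).trans (hI p (Finset.mem_filter.1 hp).1)
      linarith
    · intro b
      refine le_trans (Finset.card_le_card ?_)
        (card_filter_norm_sub_lt_le hR hsep (Function.update z k b))
      intro p hp
      rw [Finset.mem_filter] at hp
      rw [Finset.mem_filter]
      refine ⟨(Finset.mem_filter.1 hp.1).1, ?_⟩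
      rw [pi_norm_lt_iff hR]
      intro j
      by_cases hj : j = k
      · subst hj; simpa using hp.2
      · have := (Finset.mem_filter.1 hp.1).2.1 j hj
        rw [norm_sub_rev] at this
        simpa [hj] using this
  · have h1 : 0 ≤ log 2 := Real.log_nonneg (by norm_num)
    have h2 : 0 ≤ log (17 / 16) := Real.log_nonneg (by norm_num)
    positivity

/-- Radii equal to `R` in the first `m` coordinates and to `R / 2` in the others. -/
def hybridRadius (n : ℕ) (R : ℝ) (m : ℕ) : Fin n → ℝ := fun j => if (j : ℕ) < m then R else R / 2

theorem hybridRadius_succ (R : ℝ) (k : Fin n) :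
    hybridRadius n R (k + 1) = Function.update (hybridRadius n R k) k R := by
  ext j
  by_cases hj : j = k
  · subst hj; simp [hybridRadius]
  · have : (j : ℕ) ≠ k := fun h => hj (Fin.ext h)
    simp only [hybridRadius, ne_eq, hj, not_false_eq_true, Function.update_of_ne]
    congr 1
    simp only [eq_iff_iff]
    omega

/-- The contribution of a single zero. -/
theorem ofReal_log_two_mul_le (hfm : Measurable f) (hf : DifferentiableOn ℂ f (ball 0 1))
    (hf1 : ∀ z ∈ ball (0 : Fin n → ℂ) 1, ‖f z‖ ≤ 1)
    (hJ : ∫⁻ x in ball 0 (4 / 5), negLog (f x) ≠ ⊤) {p : Fin n → ℂ} (hp : ‖p‖ ≤ 71 / 100)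
    (hfp : f p = 0) {R : ℝ} (hR : 0 < R) (hR1 : R ≤ 1 / 25) :
    ENNReal.ofReal (log 2 * (volume (polyannulus n)).toReal) ≤
      ENNReal.ofReal (((R / 2) ^ (2 * n - 2))⁻¹) * ∑ k,
        ∫⁻ z in slabAround p k R, ENNReal.ofReal (sliceIncr f k (p k) R z) := by
  have hr1 : ∀ m j, R / 2 ≤ hybridRadius n R m j := fun m j => by
    unfold hybridRadius
    split_ifs <;> linarith
  have hr2 : ∀ m j, hybridRadius n R m j ≤ R := fun m j => by
    unfold hybridRadius
    split_ifs <;> linarith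
  have hr0 : ∀ m j, 0 < hybridRadius n R m j := fun m j => by linarith [hr1 m j]
  have h_int : ∀ m, Integrable (fun x => log ‖f (p + (fun j => (hybridRadius n R m j : ℂ)) * x)‖)
      (volume.restrict (polyannulus n)) := fun m =>
    IntegrableOn.comp_add_mul (integrableOn_log_norm hfm hf1 hJ) measurableSet_ball
      (fun j => by simpa using (hr0 m j).ne')
      (add_mul_mem_ball hp hR.le (fun j => by
        rw [Complex.norm_real, Real.norm_of_nonneg (hr0 m j).le]; exact hr2 m j) (by linarith))
  set T : ℕ → ℝ := fun m =>
    ∫ x in polyannulus n, log ‖f (p + (fun j => (hybridRadius n R m j : ℂ)) * x)‖ with hT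
  have htel : ∑ k : Fin n, (T (k + 1) - T k) = T n - T 0 := by
    rw [Fin.sum_univ_eq_sum_range (fun m => T (m + 1) - T m), Finset.sum_range_sub]
  have h0 := log_two_mul_volume_le hfm hf hf1 hJ hp hfp hR hR1
  have hn : (fun j : Fin n => (hybridRadius n R n j : ℂ)) = fun _ => (R : ℂ) := by
    ext j; simp [hybridRadius]
  have hz : (fun j : Fin n => (hybridRadius n R 0 j : ℂ)) = fun _ => ((R / 2 : ℝ) : ℂ) := by
    ext j; simp [hybridRadius]
  rw [← hn, ← hz, integral_sub (h_int n) (h_int 0)] at h0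
  change _ ≤ T n - T 0 at h0
  rw [← htel] at h0
  refine (ENNReal.ofReal_le_ofReal h0).trans ?_
  refine (Finset.le_sum_of_subadditive ENNReal.ofReal ENNReal.ofReal_zero.le
    (fun _ _ => ENNReal.ofReal_add_le) _ _).trans ?_
  rw [Finset.mul_sum]
  refine Finset.sum_le_sum fun k _ => ?_
  have := ofReal_integral_sub_le hfm hf hf1 hJ hp hR hR1 (hr1 k) (hr2 k)
    (k := k) (by simp [hybridRadius])
  rw [← hybridRadius_succ, integral_sub (h_int _) (h_int _)] at this
  exact this

/-- The number of separated zeros is controlled by the integral of `-log ‖f‖`. -/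
theorem exists_card_mul_le (n : ℕ) : ∃ C : ℝ, 0 < C ∧ ∀ f : (Fin n → ℂ) → ℂ,
    Measurable f → DifferentiableOn ℂ f (ball 0 1) →
    (∀ z ∈ ball (0 : Fin n → ℂ) 1, ‖f z‖ ≤ 1) → ∫⁻ x in ball 0 (4 / 5), negLog (f x) ≠ ⊤ →
    ∀ (R : ℝ), 0 < R → R ≤ 1 / 25 → ∀ I : Finset (Fin n → ℂ),
    (∀ p ∈ I, ‖p‖ ≤ 71 / 100 ∧ f p = 0) → (∀ p ∈ I, ∀ q ∈ I, p ≠ q → R ≤ ‖p - q‖) →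
    (I.card : ℝ≥0∞) * ENNReal.ofReal (R ^ (2 * n - 2)) ≤
      ENNReal.ofReal C * ∫⁻ x in ball 0 (4 / 5), negLog (f x) := by
  have hl2 : 0 < log 2 := Real.log_pos (by norm_num)
  have hl3 : 0 < log (17 / 16) := Real.log_pos (by norm_num)
  set c₀ : ℝ := log 2 * (volume (polyannulus n)).toReal with hc₀
  have hc₀0 : 0 < c₀ :=
    mul_pos hl2 (ENNReal.toReal_pos volume_polyannulus_ne_zero volume_polyannulus_ne_top)
  set c₁ : ℝ := 5 ^ (2 * n) * (log 2 / log (17 / 16)) with hc₁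
  have hc₁0 : 0 < c₁ := by positivity
  refine ⟨c₀⁻¹ * 2 ^ (2 * n - 2) * ((n + 1) * (c₁ * (25 / 16))), by positivity, ?_⟩
  intro f hfm hf hf1 hJ R hR hR1 I hI hsep
  set J := ∫⁻ x in ball 0 (4 / 5), negLog (f x) with hJdef
  have h1 : (I.card : ℝ≥0∞) * ENNReal.ofReal c₀ ≤ ENNReal.ofReal (((R / 2) ^ (2 * n - 2))⁻¹) *
      (ENNReal.ofReal ((n + 1) * (c₁ * (25 / 16))) * J) := by
    calc (I.card : ℝ≥0∞) * ENNReal.ofReal c₀ = ∑ p ∈ I, ENNReal.ofReal c₀ := by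
          rw [Finset.sum_const, nsmul_eq_mul]
      _ ≤ ∑ p ∈ I, ENNReal.ofReal (((R / 2) ^ (2 * n - 2))⁻¹) * ∑ k,
            ∫⁻ z in slabAround p k R, ENNReal.ofReal (sliceIncr f k (p k) R z) :=
          Finset.sum_le_sum fun p hp =>
            ofReal_log_two_mul_le hfm hf hf1 hJ (hI p hp).1 (hI p hp).2 hR hR1
      _ = ENNReal.ofReal (((R / 2) ^ (2 * n - 2))⁻¹) * ∑ k, ∑ p ∈ I,
            ∫⁻ z in slabAround p k R, ENNReal.ofReal (sliceIncr f k (p k) R z) := by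
          rw [← Finset.mul_sum, Finset.sum_comm]
      _ ≤ ENNReal.ofReal (((R / 2) ^ (2 * n - 2))⁻¹) * ∑ _k : Fin n,
            ENNReal.ofReal c₁ * (ENNReal.ofReal (25 / 16) * J) := by
          gcongr with k
          refine (sum_setLIntegral_sliceIncr_le hfm hf hf1 k hR hR1 (fun p hp => (hI p hp).1)
            hsep).trans ?_
          gcongr
          exact setLIntegral_circleAverage_update_le hfm k
      _ ≤ _ := by
          gcongr
          rw [Finset.sum_const, Finset.card_univ, Fintype.card_fin, nsmul_eq_mul,
            ENNReal.ofReal_mul (p := (n : ℝ) + 1) (by positivity),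
            ENNReal.ofReal_mul (p := c₁) hc₁0.le, mul_assoc, mul_assoc]
          gcongr
          rw [← ENNReal.ofReal_natCast]
          exact ENNReal.ofReal_le_ofReal (by linarith)
  have h2 := mul_le_mul_right h1 (ENNReal.ofReal (c₀⁻¹ * R ^ (2 * n - 2)))
  have e1 : ENNReal.ofReal (c₀⁻¹ * R ^ (2 * n - 2)) * (I.card * ENNReal.ofReal c₀) =
      I.card * ENNReal.ofReal (R ^ (2 * n - 2)) := by
    rw [mul_left_comm, ← ENNReal.ofReal_mul (by positivity)]
    congr 2
    field_simp
  have e2 : ENNReal.ofReal (c₀⁻¹ * R ^ (2 * n - 2)) *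
      (ENNReal.ofReal (((R / 2) ^ (2 * n - 2))⁻¹) *
      (ENNReal.ofReal ((n + 1) * (c₁ * (25 / 16))) * J)) =
      ENNReal.ofReal (c₀⁻¹ * 2 ^ (2 * n - 2) * ((n + 1) * (c₁ * (25 / 16)))) * J := by
    rw [← mul_assoc, ← mul_assoc, ← ENNReal.ofReal_mul (by positivity),
      ← ENNReal.ofReal_mul (by positivity)]
    congr 2
    rw [div_pow]
    field_simp
  rwa [e1, e2] at h2

end Pi

/-- Bounding Hausdorff measure by counting separated points. -/
theorem hausdorffMeasure_le_of_card_mul_le {X : Type*} [MetricSpace X] [MeasurableSpace X]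
    [BorelSpace X] {s : Set X} (hs : TotallyBounded s) (m : ℕ) (A : ℝ≥0∞) {R₀ : ℝ} (hR₀ : 0 < R₀)
    (h : ∀ R, 0 < R → R ≤ R₀ → ∀ I : Finset X, (∀ p ∈ I, p ∈ s) →
      (∀ p ∈ I, ∀ q ∈ I, p ≠ q → R ≤ dist p q) → (I.card : ℝ≥0∞) * ENNReal.ofReal (R ^ m) ≤ A) :
    μH[m] s ≤ 2 ^ m * A := by
  have key : ∀ R : ℝ≥0, 0 < R → ∃ I : Finset X, (∀ p ∈ I, p ∈ s) ∧
      (∀ p ∈ I, ∀ q ∈ I, p ≠ q → (R : ℝ) ≤ dist p q) ∧ s ⊆ ⋃ p : I, closedBall (p : X) R := by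
    intro R hR
    have hfin : packingNumber R s ≠ ⊤ := by
      obtain ⟨N, -, hN, hc⟩ := exists_finite_isCover_of_totallyBounded (ε := R / 2)
        (by positivity) hs
      have h1 := packingNumber_two_mul_le_externalCoveringNumber (R / 2) s
      rw [mul_div_cancel₀ _ two_ne_zero] at h1
      exact ((h1.trans hc.externalCoveringNumber_le_encard).trans_lt
        (encard_lt_top_iff.2 hN)).ne
    have hf : (maximalSeparatedSet R s).Finite := by
      rw [← encard_ne_top_iff, encard_maximalSeparatedSet hfin]
      exact hfin
    refine ⟨hf.toFinset, fun p hp => maximalSeparatedSet_subset (hf.mem_toFinset.1 hp), ?_, ?_⟩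
    · intro p hp q hq hpq
      have : (R : ℝ≥0∞) < edist p q :=
        isSeparated_maximalSeparatedSet (hf.mem_toFinset.1 hp) (hf.mem_toFinset.1 hq) hpq
      rw [edist_nndist, ENNReal.coe_lt_coe] at this
      exact_mod_cast this.le
    · have := isCover_iff_subset_iUnion_closedBall.1 (isCover_maximalSeparatedSet hfin)
      refine this.trans fun x hx => ?_
      simp only [mem_iUnion, exists_prop] at hx ⊢
      obtain ⟨y, hy, hxy⟩ := hx
      exact ⟨⟨y, hf.mem_toFinset.2 hy⟩, hxy⟩
  set R : ℕ → ℝ≥0 := fun k => R₀.toNNReal / (k + 1) with hRdef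
  have hR0 : ∀ k, 0 < R k := fun k => by
    have : 0 < R₀.toNNReal := by simpa using hR₀
    positivity
  have hRle : ∀ k, (R k : ℝ) ≤ R₀ := fun k => by
    rw [hRdef]
    push_cast
    rw [Real.coe_toNNReal _ hR₀.le]
    exact div_le_self hR₀.le (by linarith [k.cast_nonneg (α := ℝ)])
  choose! I hI1 hI2 hI3 using fun k => key (R k) (hR0 k)
  have hlim : Tendsto (fun k => ((2 * R k : ℝ≥0) : ℝ≥0∞)) atTop (𝓝 0) := by
    rw [← ENNReal.coe_zero, ENNReal.tendsto_coe]
    have : Tendsto R atTop (𝓝 0) := by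
      rw [← NNReal.tendsto_coe]
      have := tendsto_const_div_atTop_nhds_zero_nat R₀
      have := (tendsto_add_atTop_iff_nat 1).2 this
      refine this.congr fun k => ?_
      rw [hRdef]
      push_cast
      rw [Real.coe_toNNReal _ hR₀.le]
    simpa using this.const_mul 2
  have hd : ∀ k (p : I k), ediam (closedBall (p : X) (R k)) ≤ ((2 * R k : ℝ≥0) : ℝ≥0∞) := by
    intro k p
    rw [← closedEBall_coe]
    exact ediam_closedEBall_le.trans (by simp)
  refine (Measure.hausdorffMeasure_le_liminf_sum (m : ℝ) s _ hlim
    (fun k (p : I k) => closedBall (p : X) (R k)) (Eventually.of_forall hd)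
    (Eventually.of_forall hI3)).trans ?_
  have hb : ∀ k, ∑ p : I k, ediam (closedBall (p : X) (R k)) ^ (m : ℝ) ≤ 2 ^ m * A := by
    intro k
    calc ∑ p : I k, ediam (closedBall (p : X) (R k)) ^ (m : ℝ)
        ≤ ∑ p : I k, ((2 * R k : ℝ≥0) : ℝ≥0∞) ^ m := by
          refine Finset.sum_le_sum fun p _ => ?_
          rw [ENNReal.rpow_natCast]
          gcongr
          exact hd k p
      _ = 2 ^ m * ((I k).card * ENNReal.ofReal ((R k : ℝ) ^ m)) := by
          rw [Finset.sum_const, Finset.card_univ, Fintype.card_coe, nsmul_eq_mul,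
            ENNReal.ofReal_pow (by positivity), ENNReal.ofReal_coe_nnreal]
          push_cast
          ring
      _ ≤ 2 ^ m * A := by
          gcongr
          exact h _ (hR0 k) (hRle k) _ (hI1 k) (hI2 k)
  exact liminf_le_of_le (by isBoundedDefault) fun b hb' => by
    obtain ⟨k, hk⟩ := hb'.exists
    exact hk.trans (hb k)

theorem exists_hausdorffMeasure_zeros_le (n : ℕ) : ∃ C : ℝ, 0 < C ∧ ∀ f : (Fin n → ℂ) → ℂ,
    DifferentiableOn ℂ f (ball 0 1) → (∀ z ∈ ball (0 : Fin n → ℂ) 1, ‖f z‖ ≤ 1) →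
    ∀ p : Fin n → ℂ, ‖p‖ ≤ 71 / 100 → f p ≠ 0 →
    μH[((2 * n - 2 : ℕ) : ℝ)] {z : Fin n → ℂ | ‖z‖ ≤ 71 / 100 ∧ f z = 0} ≤
      ENNReal.ofReal (C * -log ‖f p‖) := by
  obtain ⟨C₁, hC₁, h₁⟩ := exists_setLIntegral_negLog_le n
  obtain ⟨C₂, hC₂, h₂⟩ := exists_card_mul_le n
  refine ⟨2 ^ (2 * n - 2) * (C₂ * C₁), by positivity, fun f₀ hf₀ hf₀1 p hp hfp₀ => ?_⟩
  set f : (Fin n → ℂ) → ℂ := (ball 0 1).indicator f₀ with hfdef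
  have hff : ∀ z ∈ ball (0 : Fin n → ℂ) 1, f z = f₀ z := fun z hz => indicator_of_mem hz _
  have hb : ∀ z : Fin n → ℂ, ‖z‖ ≤ 71 / 100 → z ∈ ball (0 : Fin n → ℂ) 1 := fun z hz => by
    rw [mem_ball_zero_iff]; linarith
  have hfm : Measurable f := by
    classical
    rw [hfdef, ← piecewise_eq_indicator]
    exact hf₀.continuousOn.measurable_piecewise continuousOn_const measurableSet_ball
  have hf : DifferentiableOn ℂ f (ball 0 1) := hf₀.congr hff
  have hf1 : ∀ z ∈ ball (0 : Fin n → ℂ) 1, ‖f z‖ ≤ 1 := fun z hz => by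
    rw [hff z hz]; exact hf₀1 z hz
  have hJ := h₁ f hfm hf hf1 p hp
  rw [negLog_of_ne (by rwa [hff p (hb p hp)]), hff p (hb p hp)] at hJ
  have hset : {z : Fin n → ℂ | ‖z‖ ≤ 71 / 100 ∧ f₀ z = 0} =
      {z : Fin n → ℂ | ‖z‖ ≤ 71 / 100 ∧ f z = 0} := by
    ext z
    exact and_congr_right fun hz => by rw [hff z (hb z hz)]
  rw [hset]
  have htb : TotallyBounded {z : Fin n → ℂ | ‖z‖ ≤ 71 / 100 ∧ f z = 0} :=
    (isCompact_closedBall (0 : Fin n → ℂ) (71 / 100)).totallyBounded.subset fun z hz =>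
      mem_closedBall_zero_iff.2 hz.1
  refine (hausdorffMeasure_le_of_card_mul_le htb _
    (ENNReal.ofReal C₂ * (ENNReal.ofReal C₁ * ENNReal.ofReal (-log ‖f₀ p‖)))
    (R₀ := 1 / 25) (by norm_num)
    fun R hR hR1 I hI hsep => ?_).trans ?_
  · refine (h₂ f hfm hf hf1 (hJ.trans_lt (by finiteness)).ne R hR hR1 I hI
      fun p hp q hq hpq => ?_).trans ?_
    · rw [← dist_eq_norm]; exact hsep p hp q hq hpq
    · gcongr
  · rw [ENNReal.ofReal_mul (by positivity), ENNReal.ofReal_mul (by positivity),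
      ENNReal.ofReal_mul hC₂.le, ENNReal.ofReal_pow (by norm_num), ENNReal.ofReal_ofNat, mul_assoc,
      mul_assoc]

section CubeChart

/-- The affine chart sending the unit polydisc into the cube of side `2 * ℓ` around `c`. -/
def cubeChart {n : ℕ} (c : EuclideanSpace ℂ (Fin n)) (ℓ : ℝ) (ξ : Fin n → ℂ) :
    EuclideanSpace ℂ (Fin n) :=
  c + (ℓ : ℂ) • WithLp.toLp 2 ξ

variable {n : ℕ} {c : EuclideanSpace ℂ (Fin n)} {ℓ : ℝ}

theorem cubeChart_apply (ξ : Fin n → ℂ) (i : Fin n) : cubeChart c ℓ ξ i = c i + ℓ * ξ i := by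
  simp [cubeChart]

theorem differentiable_cubeChart : Differentiable ℂ (cubeChart c ℓ) := by
  have : Differentiable ℂ fun ξ : Fin n → ℂ => WithLp.toLp 2 ξ :=
    (PiLp.continuousLinearEquiv 2 ℂ fun _ : Fin n => ℂ).symm.differentiable
  exact (this.const_smul (ℓ : ℂ)).const_add c

theorem cubeChart_mem_cube {r : ℝ} (hℓ : 0 ≤ ℓ) {ξ : Fin n → ℂ}
    (hξ : ‖ξ‖ ≤ r / 2) : cubeChart c ℓ ξ ∈ cube c (r * ℓ) := by
  intro i
  have h : ‖ξ i‖ ≤ r / 2 := (norm_le_pi_norm ξ i).trans hξ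
  rw [cubeChart_apply, add_sub_cancel_left, Complex.re_ofReal_mul, Complex.im_ofReal_mul, abs_mul,
    abs_mul, abs_of_nonneg hℓ]
  constructor
  · nlinarith [Complex.abs_re_le_norm (ξ i)]
  · nlinarith [Complex.abs_im_le_norm (ξ i)]

theorem cubeChart_inv (hℓ : 0 < ℓ) (z : EuclideanSpace ℂ (Fin n)) :
    cubeChart c ℓ (WithLp.ofLp ((ℓ : ℂ)⁻¹ • (z - c))) = z := by
  ext i
  have : (ℓ : ℂ) ≠ 0 := by exact_mod_cast hℓ.ne'
  rw [cubeChart_apply]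
  simp only [PiLp.smul_apply, PiLp.sub_apply, smul_eq_mul]
  field_simp
  ring

theorem exists_cubeChart_eq {r : ℝ} (hℓ : 0 < ℓ) (hr : 0 ≤ r) {z : EuclideanSpace ℂ (Fin n)}
    (hz : z ∈ cube c (r * ℓ)) : ∃ ξ : Fin n → ℂ, ‖ξ‖ ≤ 71 / 100 * r ∧ cubeChart c ℓ ξ = z := by
  refine ⟨_, ?_, cubeChart_inv hℓ z⟩
  rw [pi_norm_le_iff_of_nonneg (by positivity)]
  intro i
  obtain ⟨h1, h2⟩ := hz i
  simp only [PiLp.smul_apply, PiLp.sub_apply, smul_eq_mul, norm_mul, norm_inv, Complex.norm_real,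
    Real.norm_of_nonneg hℓ.le]
  rw [inv_mul_le_iff₀ hℓ]
  refine abs_le_of_sq_le_sq' ?_ (by positivity) |>.2
  rw [Complex.sq_norm, Complex.normSq_apply, ← sq, ← sq, ← sq_abs (_ : ℂ).re,
    ← sq_abs (_ : ℂ).im]
  nlinarith [pow_le_pow_left₀ (abs_nonneg _) h1 2, pow_le_pow_left₀ (abs_nonneg _) h2 2,
    sq_nonneg (r * ℓ)]

theorem isCompact_cube (hℓ : 0 < ℓ) : IsCompact (cube c ℓ) := by
  have hcl : IsClosed (cube c ℓ) := by
    have : cube c ℓ = ⋂ i : Fin n, {z | |(z i - c i).re| ≤ ℓ / 2 ∧ |(z i - c i).im| ≤ ℓ / 2} := by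
      ext z; simp [cube]
    rw [this]
    refine isClosed_iInter fun i => IsClosed.inter ?_ ?_
    · exact isClosed_le (f := fun z : EuclideanSpace ℂ (Fin n) => |(z i - c i).re|)
        (by fun_prop) continuous_const
    · exact isClosed_le (f := fun z : EuclideanSpace ℂ (Fin n) => |(z i - c i).im|)
        (by fun_prop) continuous_const
  refine ((isCompact_closedBall (0 : Fin n → ℂ) (71 / 100 * 1)).image
    (differentiable_cubeChart (c := c) (ℓ := ℓ)).continuous).of_isClosed_subset hcl fun z hz => ?_
  rw [← one_mul ℓ] at hz
  obtain ⟨ξ, hξ, rfl⟩ := exists_cubeChart_eq hℓ zero_le_one hz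
  exact ⟨ξ, mem_closedBall_zero_iff.2 hξ, rfl⟩

theorem mem_cube_self (hℓ : 0 < ℓ) : c ∈ cube c ℓ := fun i => by
  simp only [sub_self, Complex.zero_re, Complex.zero_im, abs_zero]
  exact ⟨by positivity, by positivity⟩

theorem lipschitzWith_cubeChart (hℓ : 0 ≤ ℓ) :
    LipschitzWith (ℓ.toNNReal * (Fintype.card (Fin n)) ^ (1 / (2 : ℝ≥0∞)).toReal)
      (cubeChart c ℓ) := by
  have h1 := PiLp.lipschitzWith_toLp 2 (fun _ : Fin n => ℂ)
  have h2 := (lipschitzWith_smul (β := EuclideanSpace ℂ (Fin n)) (ℓ : ℂ)).comp h1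
  have h3 : ‖(ℓ : ℂ)‖₊ = ℓ.toNNReal := by
    ext
    simp [hℓ, abs_of_nonneg]
  rw [h3] at h2
  intro x y
  simpa only [cubeChart, edist_add_left, Function.comp_apply] using h2 x y

theorem exists_zeros_cube_le (n : ℕ) : ∃ C : ℝ, 0 < C ∧
      ∀ (ctr : EuclideanSpace ℂ (Fin n)) (ℓ : ℝ) (f : EuclideanSpace ℂ (Fin n) → ℂ),
        0 < ℓ → DifferentiableOn ℂ f (cube ctr (2 * ℓ)) →
        0 < sSup ((fun w => ‖f w‖) '' cube ctr ℓ) →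
        μH[(2 * n - 2 : ℝ)] { z ∈ cube ctr ℓ | f z = 0 } ≤
          ENNReal.ofReal (C * ℓ ^ (2 * n - 2) *
            Real.log (sSup ((fun w => ‖f w‖) '' cube ctr (2 * ℓ)) /
              sSup ((fun w => ‖f w‖) '' cube ctr ℓ))) := by
  obtain ⟨C₀, hC₀, h₀⟩ := exists_hausdorffMeasure_zeros_le n
  set L : ℝ≥0 := (Fintype.card (Fin n)) ^ (1 / (2 : ℝ≥0∞)).toReal with hL
  refine ⟨((L : ℝ) ^ (2 * n - 2) + 1) * C₀, by positivity, ?_⟩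
  intro c ℓ f hℓ hf hpos
  have hsub : cube c ℓ ⊆ cube c (2 * ℓ) := fun z hz i =>
    ⟨(hz i).1.trans (by linarith), (hz i).2.trans (by linarith)⟩
  have hne : (cube c ℓ).Nonempty := ⟨c, mem_cube_self hℓ⟩
  have hcont : ContinuousOn (fun w => ‖f w‖) (cube c (2 * ℓ)) := hf.continuousOn.norm
  obtain ⟨z₁, hz₁, hmax₁⟩ := (isCompact_cube hℓ).exists_isMaxOn hne (hcont.mono hsub)
  obtain ⟨z₂, hz₂, hmax₂⟩ := (isCompact_cube (by positivity : 0 < 2 * ℓ)).exists_isMaxOn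
    (hne.mono hsub) hcont
  have e₁ : sSup ((fun w => ‖f w‖) '' cube c ℓ) = ‖f z₁‖ :=
    IsGreatest.csSup_eq ⟨mem_image_of_mem _ hz₁, forall_mem_image.2 fun z hz => hmax₁ hz⟩
  have e₂ : sSup ((fun w => ‖f w‖) '' cube c (2 * ℓ)) = ‖f z₂‖ :=
    IsGreatest.csSup_eq ⟨mem_image_of_mem _ hz₂, forall_mem_image.2 fun z hz => hmax₂ hz⟩
  rw [e₁] at hpos
  rw [e₁, e₂]
  have h12 : ‖f z₁‖ ≤ ‖f z₂‖ := hmax₂ (hsub hz₁)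
  have hpos₂ : 0 < ‖f z₂‖ := hpos.trans_le h12
  rcases Nat.eq_zero_or_pos n with rfl | hn
  · have : {z ∈ cube c ℓ | f z = 0} = ∅ := by
      refine eq_empty_iff_forall_notMem.2 fun z hz => ?_
      rw [Subsingleton.elim z z₁] at hz
      exact hpos.ne' (by rw [hz.2, norm_zero])
    rw [this, measure_empty]
    exact zero_le
  have hdim : (2 * n - 2 : ℝ) = ((2 * n - 2 : ℕ) : ℝ) := by
    rw [Nat.cast_sub (by omega)]; push_cast; ring
  rw [hdim]
  set g : (Fin n → ℂ) → ℂ := fun ξ => f (cubeChart c ℓ ξ) / (‖f z₂‖ : ℂ) with hg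
  have hmem : ∀ ξ ∈ ball (0 : Fin n → ℂ) 1, cubeChart c ℓ ξ ∈ cube c (2 * ℓ) := fun ξ hξ =>
    cubeChart_mem_cube hℓ.le (by simpa using (mem_ball_zero_iff.1 hξ).le)
  have hgd : DifferentiableOn ℂ g (ball 0 1) := by
    have h := hf.comp (differentiable_cubeChart (c := c) (ℓ := ℓ)).differentiableOn hmem
    simp only [hg, div_eq_mul_inv]
    exact h.mul_const _
  have hnorm : ∀ ξ, ‖g ξ‖ = ‖f (cubeChart c ℓ ξ)‖ / ‖f z₂‖ := fun ξ => by
    rw [hg]; simp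
  obtain ⟨p, hp, hpz⟩ := exists_cubeChart_eq hℓ zero_le_one (by rwa [one_mul] : z₁ ∈ cube c (1 * ℓ))
  rw [mul_one] at hp
  have hgp : ‖g p‖ = ‖f z₁‖ / ‖f z₂‖ := by rw [hnorm, hpz]
  have key := h₀ g hgd (fun ξ hξ => by
    rw [hnorm]; exact div_le_one_of_le₀ (hmax₂ (hmem ξ hξ)) (norm_nonneg _)) p hp
    (norm_pos_iff.1 (by rw [hgp]; positivity))
  have hlog : -log ‖g p‖ = log (‖f z₂‖ / ‖f z₁‖) := by
    rw [hgp, ← log_inv, inv_div]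
  have hlog0 : 0 ≤ log (‖f z₂‖ / ‖f z₁‖) := log_nonneg ((one_le_div hpos).2 h12)
  rw [hlog] at key
  have himg : {z ∈ cube c ℓ | f z = 0} ⊆
      cubeChart c ℓ '' {z : Fin n → ℂ | ‖z‖ ≤ 71 / 100 ∧ g z = 0} := by
    rintro z ⟨hz, hfz⟩
    obtain ⟨ξ, hξ, rfl⟩ := exists_cubeChart_eq hℓ zero_le_one
      (by rwa [one_mul] : z ∈ cube c (1 * ℓ))
    exact ⟨ξ, ⟨by linarith, by rw [hg]; simp [hfz]⟩, rfl⟩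
  refine (measure_mono himg).trans ?_
  refine ((lipschitzWith_cubeChart hℓ.le).hausdorffMeasure_image_le (Nat.cast_nonneg _) _).trans ?_
  refine (mul_le_mul_right key _).trans ?_
  rw [← hL, ENNReal.rpow_natCast, ← ENNReal.ofReal_coe_nnreal, ← ENNReal.ofReal_pow (by positivity),
    ← ENNReal.ofReal_mul (by positivity)]
  refine ENNReal.ofReal_le_ofReal ?_
  push_cast
  rw [Real.coe_toNNReal _ hℓ.le, mul_pow]
  have : 0 ≤ C₀ * ℓ ^ (2 * n - 2) * log (‖f z₂‖ / ‖f z₁‖) := by positivity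
  linarith

end CubeChart

/-- The argument principle, as a circle average. -/
theorem exists_circleAverage_mul_logDeriv_eq {g F : ℂ → ℂ} {c : ℂ} {δ ρ : ℝ} (hδ : 0 < δ)
    (hδρ : δ < ρ) (hg : DifferentiableOn ℂ g (ball c ρ)) (hF : DifferentiableOn ℂ F (ball c ρ))
    (hne : ∀ w ∈ sphere c δ, g w ≠ 0) :
    ∃ (s : Finset ℂ) (m : ℂ → ℕ), (∀ a, a ∈ s ↔ a ∈ ball c δ ∧ g a = 0) ∧ (∀ a ∈ s, 1 ≤ m a) ∧
      circleAverage (fun w => (w - c) * (F w * (deriv g w / g w))) c δ = ∑ a ∈ s, m a * F a := by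
  have hKU : closedBall c δ ⊆ ball c ρ := closedBall_subset_ball hδρ
  have hsph : sphere c δ ⊆ ball c ρ := sphere_subset_closedBall.trans hKU
  obtain ⟨w₀, hw₀⟩ : (sphere c δ).Nonempty := NormedSpace.sphere_nonempty.2 hδ.le
  obtain ⟨s, m, h, hs, hm, hh, hh0, hgh⟩ := exists_factorization isOpen_ball
    (convex_ball c ρ).isPreconnected (isCompact_closedBall c δ) hKU hg ⟨w₀, hsph hw₀, hne _ hw₀⟩
  have hs' : ∀ a, a ∈ s ↔ a ∈ ball c δ ∧ g a = 0 := fun a => by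
    rw [hs]
    refine ⟨fun ⟨h1, h2⟩ => ⟨?_, h2⟩, fun ⟨h1, h2⟩ => ⟨ball_subset_closedBall h1, h2⟩⟩
    rcases (mem_closedBall.1 h1).lt_or_eq with h3 | h3
    · exact h3
    · exact absurd h2 (hne a h3)
  refine ⟨s, m, hs', hm, ?_⟩
  have hFc : DiffContOnCl ℂ F (ball c |δ|) := by
    rw [abs_of_pos hδ]
    exact hF.diffContOnCl_ball hKU
  have hne' : ∀ w ∈ sphere c δ, ∀ a ∈ s, w - a ≠ 0 := fun w hw a ha h0 =>
    hne w hw (by rw [sub_eq_zero.1 h0]; exact ((hs' a).1 ha).2)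
  have hh' : DifferentiableOn ℂ (deriv h) (ball c ρ) := hh.deriv isOpen_ball
  have hlast : DiffContOnCl ℂ (fun w => (w - c) * (F w * (deriv h w / h w))) (ball c |δ|) := by
    rw [abs_of_pos hδ]
    have hcl : closure (ball c δ) ⊆ closedBall c δ := closure_ball_subset_closedBall
    refine ⟨?_, ?_⟩
    · have hsub := ball_subset_closedBall.trans hKU
      exact ((differentiableOn_id.sub_const c).mul ((hF.mono hsub).mul
        ((hh'.mono hsub).div (hh.mono hsub) fun z hz => hh0 z (ball_subset_closedBall hz))))
    · have hsub := hcl.trans hKU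
      exact ((continuousOn_id.sub continuousOn_const).mul ((hF.continuousOn.mono hsub).mul
        ((hh'.continuousOn.mono hsub).div (hh.continuousOn.mono hsub) fun z hz => hh0 z (hcl hz))))
  have hterm : ∀ a ∈ s, circleAverage (fun w => (w - c) / (w - a) * F w) c δ = F a := fun a ha =>
    hFc.circleAverage_smul_div (by rw [abs_of_pos hδ]; exact ((hs' a).1 ha).1)
  have h_int : ∀ a ∈ s, CircleIntegrable (fun w => (m a : ℂ) • ((w - c) / (w - a) * F w)) c δ := by
    intro a ha
    refine ContinuousOn.circleIntegrable hδ.le ?_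
    refine ContinuousOn.const_smul (M := ℂ) (α := ℂ) (((continuousOn_id.sub continuousOn_const).div
      (continuousOn_id.sub continuousOn_const) fun w hw => hne' w hw a ha).mul
      (hF.continuousOn.mono hsph)) _
  have hlint : CircleIntegrable (fun w => (w - c) * (F w * (deriv h w / h w))) c δ := by
    refine ContinuousOn.circleIntegrable hδ.le ?_
    refine hlast.continuousOn.mono ?_
    rw [abs_of_pos hδ, closure_ball c hδ.ne']
    exact sphere_subset_closedBall
  have hcongr : EqOn (fun w => (w - c) * (F w * (deriv g w / g w)))
      (fun w => ∑ a ∈ s, (m a : ℂ) • ((w - c) / (w - a) * F w) +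
        (w - c) * (F w * (deriv h w / h w))) (sphere c |δ|) := by
    intro w hw
    rw [abs_of_pos hδ] at hw
    have hwρ := hsph hw
    have hev : g =ᶠ[𝓝 w] fun z => (∏ a ∈ s, (z - a) ^ m a) * h z := by
      filter_upwards [isOpen_ball.mem_nhds hwρ] with z hz using hgh z hz
    have hdh : DifferentiableAt ℂ h w := hh.differentiableAt (isOpen_ball.mem_nhds hwρ)
    have hpow : ∀ a ∈ s, (w - a) ^ m a ≠ 0 := fun a ha => pow_ne_zero _ (hne' w hw a ha)
    have hl : deriv g w / g w = ∑ a ∈ s, (m a : ℂ) / (w - a) + deriv h w / h w := by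
      rw [← logDeriv_apply, ← logDeriv_apply, show logDeriv g w = _ by
          rw [logDeriv_apply, hev.deriv_eq, hev.eq_of_nhds, ← logDeriv_apply],
        logDeriv_mul w (Finset.prod_ne_zero_iff.2 hpow) (hh0 w (sphere_subset_closedBall hw))
          (by fun_prop) hdh, logDeriv_prod hpow (fun a _ => by fun_prop)]
      congr 1
      refine Finset.sum_congr rfl fun a ha => ?_
      have h0 := hne' w hw a ha
      have : HasDerivAt (fun z => (z - a) ^ m a) (m a * (w - a) ^ (m a - 1) * 1) w :=
        ((hasDerivAt_id w).sub_const a).pow (m a)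
      rw [logDeriv_apply, this.deriv]
      obtain ⟨k, hk⟩ := Nat.exists_eq_add_of_le (hm a ha)
      rw [hk, Nat.add_sub_cancel_left, mul_one, pow_add, pow_one]
      field_simp
    simp only
    rw [hl, mul_add, mul_add, Finset.mul_sum, Finset.mul_sum]
    congr 1
    refine Finset.sum_congr rfl fun a _ => ?_
    rw [smul_eq_mul]
    ring
  rw [circleAverage_congr_sphere hcongr, circleAverage_fun_add _ hlint, circleAverage_fun_sum h_int,
    hlast.circleAverage]
  · simp only [sub_self, zero_mul, add_zero]
    refine Finset.sum_congr rfl fun a ha => ?_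
    rw [← hterm a ha, ← smul_eq_mul]
    exact circleAverage_fun_smul
  · exact CircleIntegrable.fun_sum s h_int

theorem ContinuousOn.circleAverage_param {X : Type*} [TopologicalSpace X] {J : X → ℂ → ℂ}
    {S : Set X} {b : ℂ} {r : ℝ} (hJ : ContinuousOn (Function.uncurry J) (S ×ˢ sphere b |r|)) :
    ContinuousOn (fun x => Real.circleAverage (J x) b r) S := by
  rw [continuousOn_iff_continuous_domRestrict]
  simp only [circleAverage_def]
  refine Continuous.const_smul ?_ _
  refine intervalIntegral.continuous_parametric_intervalIntegral_of_continuous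
    (f := fun (x : S) θ => J x (circleMap b r θ)) ?_ continuous_const
  refine hJ.comp_continuous (f := fun p : S × ℝ => ((p.1 : X), circleMap b r p.2)) (by fun_prop) ?_
  exact fun p => ⟨p.1.2, circleMap_mem_sphere' _ _ _⟩

theorem circleAverage_circleAverage_swap {J : ℂ → ℂ → ℂ} {a b : ℂ} {r s : ℝ}
    (hJ : ContinuousOn (Function.uncurry J) (sphere a |r| ×ˢ sphere b |s|)) :
    circleAverage (fun z => circleAverage (J z) b s) a r =
      circleAverage (fun w => circleAverage (fun z => J z w) a r) b s := by
  simp only [circleAverage_def, intervalIntegral.integral_smul]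
  rw [intervalIntegral_intervalIntegral_swap]
  have : Continuous (Function.uncurry fun θ φ => J (circleMap a r θ) (circleMap b s φ)) :=
    hJ.comp_continuous (f := fun p : ℝ × ℝ => (circleMap a r p.1, circleMap b s p.2))
      (by fun_prop) fun p => ⟨circleMap_mem_sphere' _ _ _, circleMap_mem_sphere' _ _ _⟩
  exact (this.continuousOn.integrableOn_compact
    (isCompact_uIcc.prod isCompact_uIcc)).mono_set
    (prod_mono uIoc_subset_uIcc uIoc_subset_uIcc)

theorem DifferentiableOn.curry_left {f : ℂ × ℂ → ℂ} {q : ℂ × ℂ} {R : ℝ}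
    (hf : DifferentiableOn ℂ f (ball q R)) {w : ℂ} (hw : w ∈ ball q.2 R) :
    DifferentiableOn ℂ (fun z => f (z, w)) (ball q.1 R) := by
  refine hf.comp (f := fun z => (z, w)) (by fun_prop) fun z hz => ?_
  rw [← Prod.mk.eta (p := q), ← ball_prod_same]
  exact ⟨hz, hw⟩

theorem DifferentiableOn.curry_right {f : ℂ × ℂ → ℂ} {q : ℂ × ℂ} {R : ℝ}
    (hf : DifferentiableOn ℂ f (ball q R)) {z : ℂ} (hz : z ∈ ball q.1 R) :
    DifferentiableOn ℂ (fun w => f (z, w)) (ball q.2 R) := by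
  refine hf.comp (f := fun w => (z, w)) (by fun_prop) fun w hw => ?_
  rw [← Prod.mk.eta (p := q), ← ball_prod_same]
  exact ⟨hz, hw⟩

theorem circleAverage_cauchy_deriv {g : ℂ → ℂ} {b w : ℂ} {δ R : ℝ} (hδ : 0 < δ) (hδR : δ < R)
    (hg : DifferentiableOn ℂ g (ball b R)) (hw : w ∈ ball b δ) :
    circleAverage (fun ζ => (ζ - b) / (ζ - w) ^ 2 * g ζ) b δ = deriv g w := by
  rw [← Complex.two_pi_I_inv_smul_circleIntegral_sub_sq_inv_smul_of_differentiable isOpen_ball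
    (closedBall_subset_ball hδR) hg hw, circleAverage_eq_circleIntegral hδ.ne']
  congr 1
  refine circleIntegral.integral_congr hδ.le fun ζ hζ => ?_
  have : ζ - b ≠ 0 := by
    rw [sub_ne_zero]
    rintro rfl
    simp at hζ
    exact hδ.ne hζ
  simp only [smul_eq_mul]
  field_simp

/-- If `f q = 0` and `q.2` is an isolated zero of `f (q.1, ·)`, then on every small circle around
`q.1` there is a zero of `f` at which a given holomorphic function `F` has positive real part. -/
theorem exists_zero_re_pos {f : ℂ × ℂ → ℂ} {q : ℂ × ℂ} {δ R : ℝ} (hδ : 0 < δ) (hδR : δ < R)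
    (hf : DifferentiableOn ℂ f (ball q R)) (hq : f q = 0)
    (hne : ∀ w ∈ closedBall q.2 δ, w ≠ q.2 → f (q.1, w) ≠ 0) :
    ∃ ρ₀ > 0, ∀ ρ, 0 < ρ → ρ < ρ₀ → ∀ F : ℂ × ℂ → ℂ, DifferentiableOn ℂ F (ball q R) →
      0 < (F q).re → ∃ z ∈ sphere q.1 ρ, ∃ w ∈ ball q.2 δ, f (z, w) = 0 ∧ 0 < (F (z, w)).re := by
  obtain ⟨a, b⟩ := q
  simp only at *
  have hsub : ball a R ×ˢ ball b R = ball (a, b) R := ball_prod_same _ _ _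
  have hδ' : sphere b δ ⊆ ball b R := sphere_subset_ball hδR
  have hnes : ∀ w ∈ sphere b δ, f (a, w) ≠ 0 := fun w hw =>
    hne w (sphere_subset_closedBall hw) (ne_of_mem_sphere hw hδ.ne')
  have hR : 0 < R := hδ.trans hδR
  have hev : ∀ᶠ z in 𝓝 a, ∀ w ∈ sphere b δ, f (z, w) ≠ 0 := by
    refine (isCompact_sphere b δ).eventually_forall_of_forall_eventually
      (P := fun z w => f (z, w) ≠ 0) fun w hw => ?_
    have hmem : (a, w) ∈ ball (a, b) R := by
      rw [← hsub]
      exact ⟨mem_ball_self hR, hδ' hw⟩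
    exact (hf.continuousOn.continuousAt (isOpen_ball.mem_nhds hmem)).eventually_ne (hnes w hw)
  obtain ⟨ρ₁, hρ₁, hball⟩ := Metric.eventually_nhds_iff_ball.1 hev
  refine ⟨min ρ₁ R, lt_min hρ₁ hR, fun ρ hρ hρlt F hF hFq => ?_⟩
  have hρR : ρ < R := hρlt.trans_le (min_le_right _ _)
  have hcb : closedBall a ρ ⊆ ball a R := closedBall_subset_ball hρR
  have hne0 : ∀ z ∈ closedBall a ρ, ∀ w ∈ sphere b δ, f (z, w) ≠ 0 := fun z hz w hw =>
    hball z (closedBall_subset_ball (hρlt.trans_le (min_le_left _ _)) hz) w hw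
  obtain ⟨δ', hδδ', hδ'R⟩ := exists_between hδR
  have hδ'0 : 0 < δ' := hδ.trans hδδ'
  set K : ℂ → ℂ → ℂ := fun w ζ => (ζ - b) / (ζ - w) ^ 2 with hK
  have hKne : ∀ w ∈ sphere b δ, ∀ ζ ∈ sphere b δ', (ζ - w) ^ 2 ≠ 0 := by
    intro w hw ζ hζ
    refine pow_ne_zero _ (sub_ne_zero.2 ?_)
    rintro rfl
    exact hδδ'.ne ((mem_sphere.1 hw).symm.trans (mem_sphere.1 hζ))
  have hD : ∀ z ∈ ball a R, ∀ w ∈ sphere b δ,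
      circleAverage (fun ζ => K w ζ * f (z, ζ)) b δ' = deriv (fun w => f (z, w)) w :=
    fun z hz w hw => circleAverage_cauchy_deriv hδ'0 hδ'R (hf.curry_right (q := (a, b)) hz)
      (sphere_subset_ball hδδ' hw)
  set D : ℂ → ℂ → ℂ := fun z w => circleAverage (fun ζ => K w ζ * f (z, ζ)) b δ' with hDdef
  have hcS : closedBall a ρ ×ˢ sphere b δ ⊆ ball (a, b) R := by
    rw [← hsub]; exact prod_mono hcb hδ'
  have hDc : ContinuousOn (fun p : ℂ × ℂ => D p.1 p.2) (closedBall a ρ ×ˢ sphere b δ) := by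
    refine ContinuousOn.circleAverage_param
      (J := fun (p : ℂ × ℂ) ζ => K p.2 ζ * f (p.1, ζ)) ?_
    rw [abs_of_pos hδ'0]
    refine ContinuousOn.mul (ContinuousOn.div (by fun_prop) (by fun_prop) ?_) ?_
    · exact fun p hp => hKne _ hp.1.2 _ hp.2
    · refine hf.continuousOn.comp (f := fun x : (ℂ × ℂ) × ℂ => (x.1.1, x.2)) (by fun_prop) ?_
      intro x hx
      rw [← hsub]
      exact ⟨hcb hx.1.1, sphere_subset_ball hδ'R hx.2⟩
  set H : ℂ → ℂ → ℂ := fun z w => (w - b) * (F (z, w) * (D z w / f (z, w))) with hH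
  have hHc : ContinuousOn (Function.uncurry H) (closedBall a ρ ×ˢ sphere b δ) := by
    refine ContinuousOn.mul (by fun_prop) (ContinuousOn.mul (hF.continuousOn.mono hcS) ?_)
    exact hDc.div (hf.continuousOn.mono hcS) fun p hp => hne0 _ hp.1 _ hp.2
  have hsum : ∀ z ∈ closedBall a ρ, ∃ (s : Finset ℂ) (m : ℂ → ℕ),
      (∀ w, w ∈ s ↔ w ∈ ball b δ ∧ f (z, w) = 0) ∧ (∀ w ∈ s, 1 ≤ m w) ∧
      circleAverage (H z) b δ = ∑ w ∈ s, m w * F (z, w) := by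
    intro z hz
    obtain ⟨s, m, hs, hm, h⟩ := exists_circleAverage_mul_logDeriv_eq hδ hδR
      (hf.curry_right (q := (a, b)) (hcb hz)) (hF.curry_right (q := (a, b)) (hcb hz)) (hne0 z hz)
    refine ⟨s, m, hs, hm, ?_⟩
    rw [← h]
    refine circleAverage_congr_sphere fun w hw => ?_
    rw [abs_of_pos hδ] at hw
    simp only [hH]
    rw [← hD z (hcb hz) w hw]
  have hmean : ∀ w ∈ sphere b δ, circleAverage (fun z => H z w) a ρ = H a w := by
    intro w hw
    set u : ℂ → ℂ := fun z => (w - b) * (F (z, w) / f (z, w)) with hu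
    have hud : DifferentiableOn ℂ u (closedBall a ρ) :=
      (differentiableOn_const _).mul (((hF.curry_left (q := (a, b)) (hδ' hw)).mono hcb).div
        ((hf.curry_left (q := (a, b)) (hδ' hw)).mono hcb) fun z hz => hne0 z hz w hw)
    have hHu : ∀ z, H z w = circleAverage (fun ζ => u z * (K w ζ * f (z, ζ))) b δ' := by
      intro z
      have : circleAverage (fun ζ => u z * (K w ζ * f (z, ζ))) b δ' = u z * D z w := by
        rw [← smul_eq_mul]
        exact circleAverage_fun_smul (a := u z) (f := fun ζ => K w ζ * f (z, ζ))
      rw [this]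
      simp only [hH, hu]
      ring
    simp only [hHu]
    rw [circleAverage_circleAverage_swap (J := fun z ζ => u z * (K w ζ * f (z, ζ)))]
    · refine circleAverage_congr_sphere fun ζ hζ => ?_
      rw [abs_of_pos hδ'0] at hζ
      refine DiffContOnCl.circleAverage (f := fun z => u z * (K w ζ * f (z, ζ))) ?_
      rw [abs_of_pos hρ]
      refine DifferentiableOn.diffContOnCl ?_
      rw [closure_ball _ hρ.ne']
      exact hud.mul ((differentiableOn_const _).mul
        ((hf.curry_left (q := (a, b)) (sphere_subset_ball hδ'R hζ)).mono hcb))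
    · rw [abs_of_pos hρ, abs_of_pos hδ'0]
      refine ContinuousOn.mul ?_ (ContinuousOn.mul ?_ ?_)
      · exact hud.continuousOn.comp (f := Prod.fst) (by fun_prop)
          fun p hp => sphere_subset_closedBall hp.1
      · exact ContinuousOn.div (by fun_prop) (by fun_prop) fun p hp => hKne _ hw _ hp.2
      · refine hf.continuousOn.mono ?_
        rw [← hsub]
        exact prod_mono (sphere_subset_closedBall.trans hcb) (sphere_subset_ball hδ'R)
  have hGa : circleAverage (fun z => circleAverage (H z) b δ) a ρ = circleAverage (H a) b δ := by
    rw [circleAverage_circleAverage_swap]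
    · refine circleAverage_congr_sphere fun w hw => ?_
      rw [abs_of_pos hδ] at hw
      exact hmean w hw
    · rw [abs_of_pos hρ, abs_of_pos hδ]
      exact hHc.mono (prod_mono sphere_subset_closedBall subset_rfl)
  have hGpos : 0 < (circleAverage (H a) b δ).re := by
    obtain ⟨s, m, hs, hm, h⟩ := hsum a (mem_closedBall_self hρ.le)
    have hsb : s = {b} := by
      ext w
      rw [hs, Finset.mem_singleton]
      refine ⟨fun h => ?_, ?_⟩
      · by_contra hw
        exact hne w (ball_subset_closedBall h.1) hw h.2
      · rintro rfl
        exact ⟨mem_ball_self hδ, hq⟩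
    rw [h, hsb, Finset.sum_singleton, ← nsmul_eq_mul, Complex.re_nsmul]
    exact nsmul_pos hFq (by have := hm b (by simp [hsb]); omega)
  by_contra! hcon
  have hGc : ContinuousOn (fun z => circleAverage (H z) b δ) (closedBall a ρ) := by
    refine ContinuousOn.circleAverage_param ?_
    rwa [abs_of_pos hδ]
  have hle : (circleAverage (fun z => circleAverage (H z) b δ) a ρ).re ≤ 0 := by
    have hci : CircleIntegrable (fun z => circleAverage (H z) b δ) a ρ :=
      (hGc.mono sphere_subset_closedBall).circleIntegrable hρ.le
    have := Complex.reCLM.circleAverage_comp_comm hci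
    rw [Complex.reCLM_apply] at this
    rw [← this]
    refine circleAverage_mono_on_of_le_circle ?_ fun z hz => ?_
    · exact (Complex.continuous_re.comp_continuousOn
        (hGc.mono sphere_subset_closedBall)).circleIntegrable hρ.le
    · rw [abs_of_pos hρ] at hz
      obtain ⟨s, m, hs, hm, h⟩ := hsum z (sphere_subset_closedBall hz)
      simp only [Function.comp_apply, Complex.reCLM_apply]
      rw [h, Complex.re_sum]
      refine Finset.sum_nonpos fun w hw => ?_
      rw [← nsmul_eq_mul, Complex.re_nsmul]
      have hw' := (hs w).1 hw
      exact nsmul_nonpos (hcon z hz w hw'.1 hw'.2) _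
  rw [hGa] at hle
  exact absurd hGpos hle.not_gt

/-- A maximum principle for real parts of holomorphic functions on the zero set of a holomorphic
function of two variables. -/
theorem exists_zero_boundary_le_re {f : ℂ × ℂ → ℂ} {ρ s s' M : ℝ} (hs : 0 < s) (hs' : 0 < s')
    (hsρ : s < ρ) (hsρ' : s' < ρ) (hf : DifferentiableOn ℂ f (ball 0 ρ)) (hf0 : f 0 = 0)
    {F : ℂ × ℂ → ℂ} (hF : Differentiable ℂ F) (hM : M < (F 0).re) :
    ∃ z ∈ closedBall 0 s, ∃ w ∈ closedBall 0 s', f (z, w) = 0 ∧ (z ∈ sphere 0 s ∨ w ∈ sphere 0 s') ∧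
      M ≤ (F (z, w)).re := by
  by_contra! hcon
  have hρ : 0 < ρ := hs.trans hsρ
  have hballρ : ball (0 : ℂ) ρ ×ˢ ball (0 : ℂ) ρ = ball 0 ρ := ball_prod_same _ _ _
  obtain ⟨ε, hε, hεs⟩ : ∃ ε > 0, M + ε * s ^ 2 < (F 0).re := by
    refine ⟨((F 0).re - M) / 2 / s ^ 2, by have := sub_pos.2 hM; positivity, ?_⟩
    rw [div_mul_cancel₀ _ (by positivity)]
    linarith
  set ψ : ℂ × ℂ → ℝ := fun z => (F z).re + ε * ‖z.1‖ ^ 2 with hψ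
  have hψc : Continuous ψ := by
    have := hF.continuous
    fun_prop
  set D : Set (ℂ × ℂ) := closedBall 0 s ×ˢ closedBall 0 s' with hD
  have hDρ : D ⊆ ball 0 ρ := by
    rw [← hballρ]
    exact prod_mono (closedBall_subset_ball hsρ) (closedBall_subset_ball hsρ')
  have hDc : IsCompact D := (isCompact_closedBall _ _).prod (isCompact_closedBall _ _)
  have hZc : IsCompact (D ∩ f ⁻¹' {0}) := hDc.of_isClosed_subset
    ((hf.continuousOn.mono hDρ).preimage_isClosed_of_isClosed hDc.isClosed isClosed_singleton)
    inter_subset_left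
  have h0D : (0 : ℂ × ℂ) ∈ D := ⟨mem_closedBall_self hs.le, mem_closedBall_self hs'.le⟩
  obtain ⟨⟨a, b⟩, ⟨⟨ha, hb⟩, hq⟩, hmax⟩ := hZc.exists_isMaxOn ⟨0, h0D, hf0⟩ hψc.continuousOn
  simp only at ha hb
  have hq0 : (F 0).re ≤ ψ (a, b) := by
    refine le_trans ?_ (hmax ⟨h0D, hf0⟩)
    simp [hψ]
  have hbdry : ∀ z ∈ closedBall (0 : ℂ) s, ∀ w, (F (z, w)).re ≤ M → ψ (z, w) < (F 0).re := by
    intro z hz w hw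
    rw [mem_closedBall_zero_iff] at hz
    have : ε * ‖z‖ ^ 2 ≤ ε * s ^ 2 := by gcongr
    simp only [hψ]
    linarith
  have hnb : ¬ (a ∈ sphere 0 s ∨ b ∈ sphere 0 s') := fun h =>
    absurd (hbdry a ha b (hcon a ha b hb hq h).le) hq0.not_gt
  have ha' : ‖a‖ < s := lt_of_le_of_ne (mem_closedBall_zero_iff.1 ha) fun h =>
    hnb (Or.inl (mem_sphere_zero_iff_norm.2 h))
  have hb' : ‖b‖ < s' := lt_of_le_of_ne (mem_closedBall_zero_iff.1 hb) fun h =>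
    hnb (Or.inr (mem_sphere_zero_iff_norm.2 h))
  have haρ : a ∈ ball (0 : ℂ) ρ := mem_ball_zero_iff.2 (ha'.trans hsρ)
  have hbρ : b ∈ ball (0 : ℂ) ρ := mem_ball_zero_iff.2 (hb'.trans hsρ')
  have hg : DifferentiableOn ℂ (fun w => f (a, w)) (ball 0 ρ) := hf.curry_right (q := 0) haρ
  have hga : AnalyticOnNhd ℂ (fun w => f (a, w)) (ball 0 ρ) := hg.analyticOnNhd isOpen_ball
  rcases (hga b hbρ).eventually_eq_zero_or_eventually_ne_zero with h | h
  · have hz := hga.eqOn_zero_of_preconnected_of_eventuallyEq_zero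
      (convex_ball _ _).isPreconnected hbρ h
    have hd : Differentiable ℂ fun w => Complex.exp (F (a, w)) := by
      have : Differentiable ℂ fun w => F (a, w) := hF.comp (by fun_prop)
      exact this.cexp
    have hle := Complex.norm_le_of_forall_mem_frontier_norm_le (U := ball (0 : ℂ) s')
      isBounded_ball (f := fun w => Complex.exp (F (a, w))) (C := Real.exp M)
      hd.diffContOnCl (fun w hw => by
        rw [frontier_ball _ hs'.ne'] at hw
        rw [Complex.norm_exp]
        exact Real.exp_le_exp.2 (hcon a ha w (sphere_subset_closedBall hw)
          (hz (sphere_subset_ball hsρ' hw)) (Or.inr hw)).le)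
      (subset_closure (mem_ball_zero_iff.2 hb'))
    rw [Complex.norm_exp, Real.exp_le_exp] at hle
    exact absurd (hbdry a ha b hle) hq0.not_gt
  · obtain ⟨R, hR, hRa, hRb⟩ : ∃ R > 0, R ≤ s - ‖a‖ ∧ R ≤ s' - ‖b‖ :=
      ⟨min (s - ‖a‖) (s' - ‖b‖), lt_min (sub_pos.2 ha') (sub_pos.2 hb'), min_le_left _ _,
        min_le_right _ _⟩
    have hRs : ball a R ⊆ closedBall 0 s := fun z hz => by
      rw [mem_ball_iff_norm] at hz
      rw [mem_closedBall_zero_iff]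
      linarith [norm_le_norm_add_norm_sub' z a]
    have hRs' : ball b R ⊆ closedBall 0 s' := fun z hz => by
      rw [mem_ball_iff_norm] at hz
      rw [mem_closedBall_zero_iff]
      linarith [norm_le_norm_add_norm_sub' z b]
    have hRD : ball (a, b) R ⊆ D := by
      rw [← ball_prod_same]
      exact prod_mono hRs hRs'
    rw [eventually_nhdsWithin_iff, Metric.eventually_nhds_iff_ball] at h
    obtain ⟨δ₁, hδ₁, h⟩ := h
    obtain ⟨δ, hδ, hδlt⟩ := exists_between (lt_min hδ₁ hR)
    obtain ⟨ρ₀, hρ₀, hloc⟩ := exists_zero_re_pos (q := (a, b)) hδ (hδlt.trans_le (min_le_right _ _))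
      (hf.mono (hRD.trans hDρ)) hq fun w hw hwb =>
        h w (closedBall_subset_ball (hδlt.trans_le (min_le_left _ _)) hw) hwb
    obtain ⟨r, hr, hrlt⟩ := exists_between (lt_min hρ₀ hR)
    obtain ⟨z, hz, w, hw, hzw, hpos⟩ := hloc r hr (hrlt.trans_le (min_le_left _ _))
      (fun p => F p + ε * (‖a‖ ^ 2 + r ^ 2 + 2 * (starRingEnd ℂ a * (p.1 - a))) - ψ (a, b))
      (Differentiable.differentiableOn (by fun_prop)) (by
        simp only [hψ, sub_self, mul_zero, add_zero]
        norm_cast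
        simp only [Complex.sub_re, Complex.add_re, Complex.ofReal_re]
        nlinarith [mul_pos hε (pow_pos hr 2)])
    have hzR : z ∈ ball a R := sphere_subset_ball (hrlt.trans_le (min_le_right _ _)) hz
    have hwR : w ∈ ball b R := ball_subset_ball (hδlt.trans_le (min_le_right _ _)).le hw
    have hle : ψ (z, w) ≤ ψ (a, b) := hmax ⟨⟨hRs hzR, hRs' hwR⟩, hzw⟩
    have hnorm : ‖z‖ ^ 2 = ‖a‖ ^ 2 + r ^ 2 + 2 * (starRingEnd ℂ a * (z - a)).re := by
      rw [mem_sphere_iff_norm] at hz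
      rw [← hz]
      simp only [Complex.sq_norm, Complex.normSq_apply, Complex.sub_re, Complex.sub_im,
        Complex.mul_re, Complex.conj_re, Complex.conj_im]
      ring
    refine absurd hpos (not_lt.2 ?_)
    have : (F (z, w) + ε * (‖a‖ ^ 2 + r ^ 2 + 2 * (starRingEnd ℂ a * (z - a))) - ψ (a, b)).re =
        ψ (z, w) - ψ (a, b) := by
      simp only [hψ]
      rw [hnorm]
      have e : ((‖a‖ : ℂ) ^ 2 + (r : ℂ) ^ 2) = ((‖a‖ ^ 2 + r ^ 2 : ℝ) : ℂ) := by push_cast; rfl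
      rw [e, Complex.sub_re, Complex.add_re, Complex.ofReal_re, Complex.re_ofReal_mul,
        Complex.add_re, Complex.ofReal_re]
      have : (2 * (starRingEnd ℂ a * (z - a))).re = 2 * (starRingEnd ℂ a * (z - a)).re := by
        rw [show (2 : ℂ) = ((2 : ℝ) : ℂ) by norm_num, Complex.re_ofReal_mul]
      rw [this]
    rw [this]
    linarith

/-- Continuous functions on the unit circle are uniformly approximated by real parts of entire
functions. -/
theorem exists_entire_re_approx {u : ℂ → ℝ} (hu : Continuous u) {η : ℝ} (hη : 0 < η) :
    ∃ A : ℂ → ℂ, Differentiable ℂ A ∧ ∀ z ∈ sphere (0 : ℂ) 1, |(A z).re - u z| < η := by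
  have : Fact (0 < 2 * π) := ⟨two_pi_pos⟩
  let tc : AddCircle (2 * π) → ℂ := fun t => (AddCircle.toCircle t : ℂ)
  have htc : Continuous tc := continuous_subtype_val.comp AddCircle.continuous_toCircle
  let v : C(AddCircle (2 * π), ℂ) := ⟨fun t => (u (tc t) : ℂ), by fun_prop⟩
  have hv : v ∈ closure (Submodule.span ℂ (range (@fourier (2 * π))) : Set _) := by
    rw [← Submodule.topologicalClosure_coe, span_fourier_closure_eq_top]
    trivial
  obtain ⟨P, hP, hPv⟩ := Metric.mem_closure_iff.1 hv η hη
  clear hv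
  have key : ∃ A B : ℂ → ℂ, Differentiable ℂ A ∧ Differentiable ℂ B ∧
      ∀ t, P t = A (tc t) + starRingEnd ℂ (B (tc t)) := by
    clear hPv
    induction hP using Submodule.span_induction with
    | mem x hx =>
      obtain ⟨n, rfl⟩ := hx
      rcases Int.eq_nat_or_neg n with ⟨k, rfl | rfl⟩
      · refine ⟨fun z => z ^ k, fun _ => 0, by fun_prop, by fun_prop, fun t => ?_⟩
        simp [tc, fourier_apply, AddCircle.toCircle_nsmul]
      · refine ⟨fun _ => 0, fun z => z ^ k, by fun_prop, by fun_prop, fun t => ?_⟩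
        rw [fourier_neg]
        simp [tc, fourier_apply, AddCircle.toCircle_nsmul]
    | zero => exact ⟨fun _ => 0, fun _ => 0, by fun_prop, by fun_prop, fun t => by simp⟩
    | add x y _ _ hx hy =>
      obtain ⟨A, B, hA, hB, h⟩ := hx
      obtain ⟨A', B', hA', hB', h'⟩ := hy
      refine ⟨fun z => A z + A' z, fun z => B z + B' z, by fun_prop, by fun_prop, fun t => ?_⟩
      rw [ContinuousMap.add_apply, h, h', map_add]
      ring
    | smul c x _ hx =>
      obtain ⟨A, B, hA, hB, h⟩ := hx
      refine ⟨fun z => c * A z, fun z => starRingEnd ℂ c * B z, by fun_prop, by fun_prop,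
        fun t => ?_⟩
      rw [ContinuousMap.smul_apply, h, smul_eq_mul, map_mul, Complex.conj_conj]
      ring
  obtain ⟨A, B, hA, hB, hAB⟩ := key
  refine ⟨fun z => A z + B z, by fun_prop, fun z hz => ?_⟩
  have hz1 : ‖z‖ = 1 := mem_sphere_zero_iff_norm.1 hz
  obtain ⟨t, ht⟩ : ∃ t : AddCircle (2 * π), tc t = z := by
    refine ⟨((Complex.arg z : ℝ) : AddCircle (2 * π)), ?_⟩
    simp only [tc]
    rw [AddCircle.toCircle_apply_mk, div_self two_pi_pos.ne', one_mul, Circle.coe_exp]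
    have := Complex.norm_mul_exp_arg_mul_I z
    rwa [hz1, Complex.ofReal_one, one_mul] at this
  have h1 : dist (v t) (P t) < η := (ContinuousMap.dist_apply_le_dist t).trans_lt hPv
  rw [dist_comm, dist_eq_norm] at h1
  have h2 := (Complex.abs_re_le_norm _).trans_lt h1
  rw [hAB, ht] at h2
  simpa [v, ht] using h2

theorem re_le_of_re_le_on_sphere {A : ℂ → ℂ} (hA : Differentiable ℂ A) {r M : ℝ} (hr : 0 < r)
    (h : ∀ z ∈ sphere (0 : ℂ) r, (A z).re ≤ M) {z : ℂ} (hz : z ∈ closedBall (0 : ℂ) r) :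
    (A z).re ≤ M := by
  have hle := Complex.norm_le_of_forall_mem_frontier_norm_le (U := ball (0 : ℂ) r)
    isBounded_ball (f := fun w => Complex.exp (A w)) (C := Real.exp M)
    hA.cexp.diffContOnCl (fun w hw => by
      rw [frontier_ball _ hr.ne'] at hw
      rw [Complex.norm_exp]
      exact Real.exp_le_exp.2 (h w hw))
    (by rwa [closure_ball _ hr.ne'])
  rwa [Complex.norm_exp, Real.exp_le_exp] at hle

theorem exists_continuous_circleAverage_lt {K : Set ℂ} (hK : IsClosed K)
    (hm : volume {θ ∈ Ioc (-π) π | circleMap 0 1 θ ∈ K} < ENNReal.ofReal π) :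
    ∃ χ : ℂ → ℝ, Continuous χ ∧ (∀ z, 0 ≤ χ z) ∧ (∀ z ∈ K, χ z = 1) ∧
      circleAverage χ 0 1 < 1 / 2 := by
  set ν : Measure ℝ := volume.restrict (Ioc (-π) π)
  have hcm : Measurable (circleMap 0 1) := (continuous_circleMap 0 1).measurable
  set μ : Measure ℂ := ν.map (circleMap 0 1) with hμ
  have : IsFiniteMeasure μ := by rw [hμ]; infer_instance
  have hμK : μ K < ENNReal.ofReal π := by
    rw [hμ, Measure.map_apply hcm hK.measurableSet,
      Measure.restrict_apply (hcm hK.measurableSet), inter_comm]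
    exact hm
  obtain ⟨k, hk⟩ := ((HasOuterApproxClosed.tendsto_lintegral_apprSeq hK μ).eventually_lt_const
    hμK).exists
  set φ := hK.apprSeq k
  refine ⟨fun z => (φ z : ℝ), by fun_prop, fun z => NNReal.coe_nonneg _, fun z hz => ?_, ?_⟩
  · simp only [φ, NNReal.coe_eq_one]
    exact HasOuterApproxClosed.apprSeq_apply_eq_one hK k hz
  · have h1 : circleAverage (fun z => (φ z : ℝ)) 0 1 =
        (2 * π)⁻¹ * ∫ θ in Ioc (-π) π, (φ (circleMap 0 1 θ) : ℝ) := by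
      rw [circleAverage_def, smul_eq_mul]
      congr 1
      have hper : Function.Periodic (fun θ => (φ (circleMap 0 1 θ) : ℝ)) (2 * π) := fun θ => by
        simp only [periodic_circleMap 0 1 θ]
      have := hper.intervalIntegral_add_eq 0 (-π)
      rw [zero_add, show -π + 2 * π = π by ring] at this
      rw [this, intervalIntegral.integral_of_le (by linarith [pi_pos])]
    have h2 : ENNReal.ofReal (∫ θ in Ioc (-π) π, (φ (circleMap 0 1 θ) : ℝ)) <
        ENNReal.ofReal π := by
      rw [hμ, lintegral_map (by fun_prop) hcm] at hk
      convert hk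
      rw [ofReal_integral_eq_lintegral_ofReal]
      · simp [ν]
      · have : Continuous fun θ => (φ (circleMap 0 1 θ) : ℝ) :=
          NNReal.continuous_coe.comp (φ.continuous.comp (continuous_circleMap 0 1))
        exact (this.integrableOn_Icc (a := -π) (b := π)).mono_set Ioc_subset_Icc_self
      · exact Eventually.of_forall fun θ => NNReal.coe_nonneg _
    rw [ENNReal.ofReal_lt_ofReal_iff pi_pos] at h2
    rw [h1, inv_mul_lt_iff₀ two_pi_pos]
    linarith

theorem exists_entire_re_lt_of_volume_lt {K : Set ℂ} (hK : IsClosed K) {s : ℝ} (hs : 0 < s)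
    (hm : volume {θ ∈ Ioc (-π) π | circleMap 0 s θ ∈ K} < ENNReal.ofReal π) :
    ∃ A : ℂ → ℂ, Differentiable ℂ A ∧ (∀ z ∈ closedBall (0 : ℂ) s, (A z).re ≤ 0) ∧
      (∀ z ∈ sphere (0 : ℂ) s, z ∈ K → (A z).re < -1) ∧ -(1 / 2) < (A 0).re := by
  obtain ⟨χ, hχ, hχ0, hχK, hχa⟩ := exists_continuous_circleAverage_lt
    (K := (fun z : ℂ => (s : ℂ) * z) ⁻¹' K) (hK.preimage (by fun_prop)) (by
      simpa [circleMap] using hm)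
  set η := (1 / 2 - circleAverage χ 0 1) / 4 with hη
  have hη0 : 0 < η := by rw [hη]; linarith
  obtain ⟨A, hA, hAu⟩ := exists_entire_re_approx (u := fun z => -χ z - 2 * η) (by fun_prop) hη0
  have hs' : (s : ℂ) ≠ 0 := by exact_mod_cast hs.ne'
  have hsph : ∀ z ∈ sphere (0 : ℂ) s, z / s ∈ sphere (0 : ℂ) 1 := fun z hz => by
    rw [mem_sphere_zero_iff_norm] at hz ⊢
    rw [norm_div, hz, Complex.norm_real, norm_of_nonneg hs.le, div_self hs.ne']
  have hA' : Differentiable ℂ fun z => A (z / s) := hA.comp (by fun_prop)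
  refine ⟨fun z => A (z / s), hA', fun z hz => ?_, fun z hz hzK => ?_, ?_⟩
  · refine re_le_of_re_le_on_sphere hA' hs (fun z hz => ?_) hz
    have := abs_lt.1 (hAu _ (hsph z hz))
    linarith [hχ0 (z / s)]
  · have := abs_lt.1 (hAu _ (hsph z hz))
    rw [hχK (z / s) (by simpa [mul_div_cancel₀ _ hs'] using hzK)] at this
    linarith
  · have hci : ∀ {g : ℂ → ℝ}, Continuous g → CircleIntegrable g 0 1 := fun hg =>
      hg.continuousOn.circleIntegrable zero_le_one
    have hAc : CircleIntegrable A 0 1 := hA.continuous.continuousOn.circleIntegrable zero_le_one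
    have h0 : (A 0).re = circleAverage (fun z => (A z).re) 0 1 := by
      have := Complex.reCLM.circleAverage_comp_comm hAc
      rw [hA.diffContOnCl.circleAverage] at this
      exact this.symm
    have hle : circleAverage (fun z => -(χ z + 3 * η)) 0 1 ≤
        circleAverage (fun z => (A z).re) 0 1 := by
      refine circleAverage_mono (hci (by fun_prop))
        (hci (Complex.continuous_re.comp hA.continuous)) fun z hz => ?_
      rw [abs_one] at hz
      have := abs_lt.1 (hAu z hz)
      linarith
    have heq : circleAverage (fun z => -(χ z + 3 * η)) 0 1 =
        -(circleAverage χ 0 1 + 3 * η) := by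
      have h1 := circleAverage_fun_add (hci hχ) (hci (continuous_const (y := 3 * η)))
      rw [circleAverage_const] at h1
      rw [← h1]
      have := circleAverage_fun_smul (a := (-1 : ℝ)) (f := fun z => χ z + 3 * η) (c := 0) (R := 1)
      simpa using this
    simp only [zero_div]
    rw [h0]
    linarith

theorem exists_volume_angle_lt {U : Set ℂ} (hU : IsClosed U) {r : ℝ} (hr : 0 < r)
    (h : volume U < ENNReal.ofReal (π * r ^ 2 / 2)) :
    ∃ s ∈ Ioo 0 r, volume {θ ∈ Ioc (-π) π | circleMap 0 s θ ∈ U} < ENNReal.ofReal π := by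
  by_contra! hcon
  refine absurd h (not_lt.2 ?_)
  have hpi := pi_pos
  have hmeas : MeasurableSet {p : ℝ × ℝ | circleMap 0 p.1 p.2 ∈ U} := by
    refine (hU.preimage (f := fun p : ℝ × ℝ => circleMap 0 p.1 p.2) ?_).measurableSet
    unfold circleMap
    fun_prop
  have hpolar : volume U = ∫⁻ x in Ioi (0 : ℝ), ∫⁻ y in Ioo (-π) π,
      ENNReal.ofReal x * {p : ℝ × ℝ | circleMap 0 p.1 p.2 ∈ U}.indicator 1 (x, y) := by
    rw [← lintegral_indicator_one hU.measurableSet, ← Complex.lintegral_comp_polarCoord_symm]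
    rw [polarCoord_target, Measure.volume_eq_prod, setLIntegral_prod]
    · refine lintegral_congr fun x => lintegral_congr fun y => ?_
      rw [smul_eq_mul]
      congr 1
      have : Complex.polarCoord.symm (x, y) = circleMap 0 x y := by
        rw [Complex.polarCoord_symm_apply, circleMap_zero, Complex.exp_mul_I]
        push_cast
        ring
      simp only [indicator, mem_ofPred_eq, Pi.one_apply]
      rw [this]
    · refine Measurable.aemeasurable ?_
      refine Measurable.mul (by fun_prop) ?_
      refine (measurable_one.indicator hU.measurableSet).comp ?_
      have : (Complex.polarCoord.symm : ℝ × ℝ → ℂ) = fun p => circleMap 0 p.1 p.2 := by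
        ext1 p
        rw [Complex.polarCoord_symm_apply, circleMap_zero, Complex.exp_mul_I]
        push_cast
        ring
      rw [this]
      unfold circleMap
      fun_prop
  have hinner : ∀ x, ∫⁻ y in Ioo (-π) π,
      ENNReal.ofReal x * {p : ℝ × ℝ | circleMap 0 p.1 p.2 ∈ U}.indicator 1 (x, y) =
      ENNReal.ofReal x * volume {θ ∈ Ioc (-π) π | circleMap 0 x θ ∈ U} := by
    intro x
    have hx : MeasurableSet {θ | circleMap 0 x θ ∈ U} :=
      (continuous_circleMap 0 x).measurable hU.measurableSet
    rw [lintegral_const_mul' _ _ ENNReal.ofReal_ne_top]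
    congr 1
    have : ∀ y, {p : ℝ × ℝ | circleMap 0 p.1 p.2 ∈ U}.indicator (1 : ℝ × ℝ → ℝ≥0∞) (x, y) =
        {θ | circleMap 0 x θ ∈ U}.indicator 1 y := fun y => by
      simp [indicator]
    simp only [this]
    rw [lintegral_indicator_one hx, restrict_Ioo_eq_restrict_Ioc, Measure.restrict_apply hx,
      inter_comm]
    rfl
  simp only [hinner] at hpolar
  rw [hpolar]
  have h_int : ∫⁻ x in Ioo 0 r, ENNReal.ofReal (x * π) = ENNReal.ofReal (π * r ^ 2 / 2) := by
    rw [restrict_Ioo_eq_restrict_Ioc, ← ofReal_integral_eq_lintegral_ofReal,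
      ← intervalIntegral.integral_of_le hr.le, intervalIntegral.integral_mul_const, integral_id]
    · ring_nf
    · have : Continuous fun x : ℝ => x * π := by fun_prop
      exact (this.integrableOn_Icc (a := 0) (b := r)).mono_set Ioc_subset_Icc_self
    · filter_upwards [ae_restrict_mem measurableSet_Ioc] with x hx
      exact mul_nonneg hx.1.le hpi.le
  rw [← h_int]
  refine (setLIntegral_mono' measurableSet_Ioo fun x hx => ?_).trans
    (lintegral_mono_set Ioo_subset_Ioi_self)
  rw [ENNReal.ofReal_mul hx.1.le]
  gcongr
  exact hcon x hx

theorem isClosed_zero_proj {f : ℂ × ℂ → ℂ} {r : ℝ}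
    (hf : ContinuousOn f (closedBall 0 r ×ˢ closedBall 0 r)) :
    IsClosed {t : ℂ | t ∈ closedBall 0 r ∧ ∃ w ∈ closedBall (0 : ℂ) r, f (t, w) = 0} := by
  have hDc : IsCompact (closedBall (0 : ℂ) r ×ˢ closedBall (0 : ℂ) r) :=
    (isCompact_closedBall _ _).prod (isCompact_closedBall _ _)
  have hZc : IsCompact (closedBall (0 : ℂ) r ×ˢ closedBall (0 : ℂ) r ∩ f ⁻¹' {0}) :=
    hDc.of_isClosed_subset (hf.preimage_isClosed_of_isClosed hDc.isClosed isClosed_singleton)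
      inter_subset_left
  convert (hZc.image continuous_fst).isClosed using 1
  ext t
  simp only [mem_ofPred_eq, mem_image, mem_inter_iff, mem_prod, mem_preimage, mem_singleton_iff,
    Prod.exists, exists_and_right, exists_eq_right]
  tauto

theorem volume_zero_proj_zero {f : ℂ × ℂ → ℂ} {ρ r : ℝ} (hr : 0 < r) (hrρ : r < ρ)
    (hf : DifferentiableOn ℂ f (ball 0 ρ)) (hf0 : f 0 = 0) :
    ENNReal.ofReal (π * r ^ 2 / 2) ≤
        volume {t : ℂ | t ∈ closedBall 0 r ∧ ∃ w ∈ closedBall (0 : ℂ) r, f (t, w) = 0} ∨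
      ENNReal.ofReal (π * r ^ 2 / 2) ≤
        volume {t : ℂ | t ∈ closedBall 0 r ∧ ∃ w ∈ closedBall (0 : ℂ) r, f (w, t) = 0} := by
  by_contra! hcon
  have hfc : ContinuousOn f (closedBall 0 r ×ˢ closedBall 0 r) := by
    refine hf.continuousOn.mono ?_
    rw [closedBall_prod_same]
    exact closedBall_subset_ball hrρ
  have hU := isClosed_zero_proj hfc
  have hV := isClosed_zero_proj (f := f ∘ Prod.swap) (r := r)
    (hfc.comp continuous_swap.continuousOn fun p hp => ⟨hp.2, hp.1⟩)
  simp only [Function.comp_apply, Prod.swap_prod_mk] at hV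
  obtain ⟨s, hs, hsU⟩ := exists_volume_angle_lt hU hr hcon.1
  obtain ⟨s', hs', hsV⟩ := exists_volume_angle_lt hV hr hcon.2
  obtain ⟨A, hA, hA0, hAU, hAz⟩ := exists_entire_re_lt_of_volume_lt hU hs.1 hsU
  obtain ⟨B, hB, hB0, hBV, hBz⟩ := exists_entire_re_lt_of_volume_lt hV hs'.1 hsV
  obtain ⟨z, hz, w, hw, hzw, hor, hle⟩ := exists_zero_boundary_le_re (M := -1) hs.1 hs'.1
    (hs.2.trans hrρ) (hs'.2.trans hrρ) hf hf0 (F := fun p => A p.1 + B p.2)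
    ((hA.comp differentiable_fst).add (hB.comp differentiable_snd)) (by
      simp only [Prod.fst_zero, Prod.snd_zero, Complex.add_re]
      linarith)
  simp only [Complex.add_re] at hle
  have hzr := closedBall_subset_closedBall hs.2.le hz
  have hwr := closedBall_subset_closedBall hs'.2.le hw
  rcases hor with h | h
  · linarith [hAU z h ⟨hzr, w, hwr, hzw⟩, hB0 w hw]
  · linarith [hBV w h ⟨hwr, z, hzr, hzw⟩, hA0 z hz]

/-- One of the two coordinate projections of the zero set of a holomorphic function of two
variables near a zero has large area. -/
theorem volume_zero_proj {f : ℂ × ℂ → ℂ} {p : ℂ × ℂ} {ρ r : ℝ} (hr : 0 < r) (hrρ : r < ρ)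
    (hf : DifferentiableOn ℂ f (ball p ρ)) (hfp : f p = 0) :
    ENNReal.ofReal (π * r ^ 2 / 2) ≤
        volume {t : ℂ | t ∈ closedBall p.1 r ∧ ∃ w ∈ closedBall p.2 r, f (t, w) = 0} ∨
      ENNReal.ofReal (π * r ^ 2 / 2) ≤
        volume {t : ℂ | t ∈ closedBall p.2 r ∧ ∃ w ∈ closedBall p.1 r, f (w, t) = 0} := by
  have h := volume_zero_proj_zero (f := fun z => f (p + z)) hr hrρ
    (hf.comp (f := fun z => p + z) (by fun_prop) fun z hz => by simpa using hz) (by simpa using hfp)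
  have hw : ∀ (a : ℂ) (P : ℂ → Prop), (∃ w ∈ closedBall (0 : ℂ) r, P (a + w)) →
      ∃ w ∈ closedBall a r, P w := by
    rintro a P ⟨w, hw, h⟩
    exact ⟨a + w, by simpa using hw, h⟩
  refine h.imp (fun h => h.trans ?_) fun h => h.trans ?_
  · refine (measure_mono ?_).trans_eq (measure_preimage_add volume p.1 _)
    rintro t ⟨ht, h⟩
    exact ⟨by simpa using ht, hw p.2 (fun w => f (p.1 + t, w) = 0) h⟩
  · refine (measure_mono ?_).trans_eq (measure_preimage_add volume p.2 _)
    rintro t ⟨ht, h⟩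
    exact ⟨by simpa using ht, hw p.1 (fun w => f (w, p.2 + t) = 0) h⟩

theorem indicator_one_le_of_imp {α β : Type*} {s : Set α} {t : Set β} {a : α} {b : β}
    (h : a ∈ s → b ∈ t) : s.indicator (1 : α → ℝ≥0∞) a ≤ t.indicator 1 b := by
  by_cases ha : a ∈ s
  · simp [ha, h ha]
  · simp [ha]

section NearProj

variable {ι : Type*} [DecidableEq ι]

/-- The points whose `s`-coordinates are within `r` of those of `p` and which can be moved into `Z`
by changing the `j`-th coordinate to one within `r` of that of `p`. -/
def nearProj (Z : Set (ι → ℂ)) (p : ι → ℂ) (r : ℝ) (s : Finset ι) (j : ι) : Set (ι → ℂ) :=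
  {x | (∀ i ∈ s, x i ∈ closedBall (p i) r) ∧ ∃ w ∈ closedBall (p j) r, Function.update x j w ∈ Z}

theorem isClosed_nearProj {Z : Set (ι → ℂ)} (hZ : IsClosed Z) (p : ι → ℂ) (r : ℝ) (s : Finset ι)
    (j : ι) : IsClosed (nearProj Z p r s j) := by
  have h1 : IsClosed {x : ι → ℂ | ∀ i ∈ s, x i ∈ closedBall (p i) r} := by
    have : {x : ι → ℂ | ∀ i ∈ s, x i ∈ closedBall (p i) r} =
        ⋂ i ∈ s, (fun x => x i) ⁻¹' closedBall (p i) r := by ext; simp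
    rw [this]
    exact isClosed_biInter fun i _ => isClosed_closedBall.preimage (continuous_apply i)
  refine IsClosed.inter (s₂ := {x | ∃ w ∈ closedBall (p j) r, Function.update x j w ∈ Z}) h1 ?_
  have hK : IsCompact (closedBall (p j) r) := isCompact_closedBall _ _
  have : CompactSpace (closedBall (p j) r) := isCompact_iff_compactSpace.1 hK
  have hG : IsClosed {y : (ι → ℂ) × closedBall (p j) r | Function.update y.1 j (y.2 : ℂ) ∈ Z} :=
    hZ.preimage (continuous_fst.update j (continuous_subtype_val.comp continuous_snd))
  have heq : {x : ι → ℂ | ∃ w ∈ closedBall (p j) r, Function.update x j w ∈ Z} =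
      Prod.fst '' {y : (ι → ℂ) × closedBall (p j) r | Function.update y.1 j (y.2 : ℂ) ∈ Z} := by
    ext x
    constructor
    · rintro ⟨w, hw, h⟩
      exact ⟨(x, ⟨w, hw⟩), h, rfl⟩
    · rintro ⟨y, h, rfl⟩
      exact ⟨y.2, y.2.2, h⟩
  rw [heq]
  exact isClosedMap_fst_of_compactSpace _ hG

variable [Fintype ι] {Z : Set (ι → ℂ)}

theorem sum_lmarginal_nearProj_ge_of_proj (hZ : IsClosed Z) {p : ι → ℂ} {r e : ℝ} {M : ℝ≥0∞}
    {s : Finset ι} (hr : 0 < r) {i i' : ι} (hi : i ∈ s) (hi' : i' ∈ s) (hii' : i ≠ i')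
    (hT : ENNReal.ofReal e ≤ volume {t : ℂ | t ∈ closedBall (p i) (r / 2) ∧
      ∃ w ∈ closedBall (p i') (r / 2), Function.update (Function.update p i t) i' w ∈ Z})
    (hM : ∀ q ∈ Z, dist q p ≤ r / 2 → M ≤ ∑ j ∈ s.erase i,
      (∫⋯∫⁻_s.erase i, (nearProj Z q (r / 2) (s.erase i) j).indicator 1 ∂fun _ => volume) q) :
    M * ENNReal.ofReal e ≤
      ∑ j ∈ s, (∫⋯∫⁻_s, (nearProj Z p r s j).indicator 1 ∂fun _ => volume) p := by
  have hme : ∀ j, Measurable ((nearProj Z p r s j).indicator (1 : (ι → ℂ) → ℝ≥0∞)) := fun j =>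
    measurable_one.indicator (isClosed_nearProj hZ p r s j).measurableSet
  have hmm : ∀ j, Measurable fun t => (∫⋯∫⁻_s.erase i, (nearProj Z p r s j).indicator 1
      ∂fun _ => volume) (Function.update p i t) := fun j =>
    ((hme j).lmarginal _).comp (measurable_update p)
  calc M * ENNReal.ofReal e
      ≤ M * volume {t : ℂ | M ≤ ∑ j ∈ s.erase i, (∫⋯∫⁻_s.erase i,
          (nearProj Z p r s j).indicator 1 ∂fun _ => volume) (Function.update p i t)} := by
        gcongr
        refine hT.trans (measure_mono ?_)
        rintro t ⟨ht, w, hw, hq⟩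
        set q := Function.update (Function.update p i t) i' w with hqdef
        have hqi : q i = t := by simp [hqdef, hii']
        have hqp : ∀ l, dist (q l) (p l) ≤ r / 2 := fun l => by
          by_cases h1 : l = i'
          · subst h1; simpa [hqdef] using hw
          · by_cases h2 : l = i
            · subst h2; rw [hqi]; exact ht
            · simp [hqdef, h1, h2]; positivity
        have hd : dist q p ≤ r / 2 := (dist_pi_le_iff (by positivity)).2 hqp
        refine (hM q hq hd).trans (Finset.sum_le_sum fun j _ => ?_)
        rw [lmarginal_congr (x := q) (y := Function.update p i t)]
        · refine lintegral_mono fun y => ?_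
          refine indicator_one_le_of_imp ?_
          set x := Function.updateFinset (Function.update p i t) (s.erase i) y with hx
          have hxi : x i = t := by simp [hx, Function.updateFinset]
          rintro ⟨h1, v, hv, h2⟩
          refine ⟨fun l hl => ?_, v, ?_, h2⟩
          · by_cases hli : l = i
            · subst hli
              rw [hxi]
              exact closedBall_subset_closedBall (by linarith) ht
            · have h3 := mem_closedBall.1 (h1 l (Finset.mem_erase.2 ⟨hli, hl⟩))
              have := dist_triangle (x l) (q l) (p l)
              exact mem_closedBall.2 (by linarith [hqp l])
          · have := dist_triangle v (q j) (p j)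
            exact mem_closedBall.2 (by linarith [hqp j, mem_closedBall.1 hv])
        · intro l hl
          rw [hqdef, Function.update_of_ne]
          rintro rfl
          exact hl (Finset.mem_erase.2 ⟨hii'.symm, hi'⟩)
    _ ≤ ∫⁻ t, ∑ j ∈ s.erase i, (∫⋯∫⁻_s.erase i,
          (nearProj Z p r s j).indicator 1 ∂fun _ => volume) (Function.update p i t) :=
        mul_meas_ge_le_lintegral (Finset.measurable_fun_sum _ fun j _ => hmm j) M
    _ = ∑ j ∈ s.erase i, (∫⋯∫⁻_s, (nearProj Z p r s j).indicator 1 ∂fun _ => volume) p := by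
        rw [lintegral_finsetSum _ fun j _ => hmm j]
        exact Finset.sum_congr rfl fun j _ =>
            (lmarginal_erase (μ := fun _ => volume) _ (hme j) hi p).symm
    _ ≤ _ := Finset.sum_le_sum_of_subset (Finset.erase_subset _ _)

/-- Near a zero of a holomorphic function of several variables, the coordinate projections of the
zero set have large total volume. -/
theorem exists_le_sum_lmarginal_nearProj (k : ℕ) : ∃ c > 0, ∀ {f : (ι → ℂ) → ℂ},
    DifferentiableOn ℂ f (ball 0 1) → ∀ (s : Finset ι), s.card = k + 1 → ∀ (p : ι → ℂ) (r : ℝ),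
    0 < r → f p = 0 → ‖p‖ + r ≤ 1 / 2 → ENNReal.ofReal (c * r ^ (2 * (k + 1))) ≤
      ∑ j ∈ s, (∫⋯∫⁻_s, (nearProj {z ∈ closedBall 0 (1 / 2) | f z = 0} p r s j).indicator 1
        ∂fun _ => volume) p := by
  have hZc : ∀ {f : (ι → ℂ) → ℂ}, DifferentiableOn ℂ f (ball 0 1) →
      IsClosed {z ∈ closedBall 0 (1 / 2) | f z = 0} := fun hf =>
    (hf.continuousOn.mono (closedBall_subset_ball (by norm_num))).preimage_isClosed_of_isClosed
      isClosed_closedBall isClosed_singleton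
  induction k with
  | zero =>
    refine ⟨π, pi_pos, fun {f} hf s hs p r hr hfp hpr => ?_⟩
    obtain ⟨j, rfl⟩ := Finset.card_eq_one.1 hs
    rw [Finset.sum_singleton, lmarginal_singleton]
    have hsub : closedBall (p j) r ⊆ (fun t => Function.update p j t) ⁻¹'
        nearProj {z ∈ closedBall 0 (1 / 2) | f z = 0} p r {j} j := by
      intro t ht
      refine ⟨fun i hi => ?_, p j, mem_closedBall_self hr.le, ?_⟩
      · rw [Finset.mem_singleton] at hi
        subst hi
        simpa using ht
      · simp only [Function.update_idem, Function.update_eq_self]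
        exact ⟨mem_closedBall_zero_iff.2 (by linarith), hfp⟩
    calc ENNReal.ofReal (π * r ^ (2 * (0 + 1))) = volume (closedBall (p j) r) := by
          rw [Complex.volume_closedBall, ENNReal.ofReal_mul pi_pos.le, mul_comm,
            ENNReal.ofReal_pow hr.le]
          rw [show ((NNReal.pi : ℝ≥0) : ℝ≥0∞) = ENNReal.ofReal π by
            rw [← NNReal.coe_real_pi, ENNReal.ofReal_coe_nnreal]]
      _ = ∫⁻ t, (closedBall (p j) r).indicator 1 t :=
          (lintegral_indicator_one measurableSet_closedBall).symm
      _ ≤ _ := by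
          refine lintegral_mono fun t => ?_
          exact indicator_one_le_of_imp fun h => hsub h
  | succ k ih =>
    obtain ⟨c, hc, ih⟩ := ih
    refine ⟨c * (1 / 2) ^ (2 * (k + 1)) * (π / 8), by positivity,
      fun {f} hf s hs p r hr hfp hpr => ?_⟩
    obtain ⟨a, ha, b, hb, hab⟩ := Finset.one_lt_card.1 (show 1 < s.card by omega)
    set Z := {z ∈ closedBall (0 : ι → ℂ) (1 / 2) | f z = 0} with hZ
    have hrw : ENNReal.ofReal (c * (1 / 2) ^ (2 * (k + 1)) * (π / 8) * r ^ (2 * (k + 1 + 1))) =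
        ENNReal.ofReal (c * (r / 2) ^ (2 * (k + 1))) * ENNReal.ofReal (π * (r / 2) ^ 2 / 2) := by
      rw [← ENNReal.ofReal_mul (by positivity)]
      congr 1
      ring
    rw [hrw]
    have hcl : ∀ (i i' : ι) (t w : ℂ), t ∈ closedBall (p i) (r / 2) →
        w ∈ closedBall (p i') (r / 2) →
        f (Function.update (Function.update p i t) i' w) = 0 →
        Function.update (Function.update p i t) i' w ∈ Z := by
      intro i i' t w ht hw h
      refine ⟨mem_closedBall_zero_iff.2 ?_, h⟩
      refine (pi_norm_le_iff_of_nonneg (by norm_num)).2 fun l => ?_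
      have hpl : ‖p l‖ ≤ ‖p‖ := norm_le_pi_norm p l
      have hor : dist (Function.update (Function.update p i t) i' w l) (p l) ≤ r / 2 := by
        by_cases h1 : l = i'
        · subst h1; simpa using hw
        · by_cases h2 : l = i
          · subst h2; simpa [h1] using ht
          · simp [h1, h2]; positivity
      rw [dist_eq_norm] at hor
      linarith [norm_le_norm_add_norm_sub' (Function.update (Function.update p i t) i' w l) (p l)]
    have hM : ∀ i ∈ s, ∀ q ∈ Z, dist q p ≤ r / 2 → ENNReal.ofReal (c * (r / 2) ^ (2 * (k + 1))) ≤
        ∑ j ∈ s.erase i, (∫⋯∫⁻_s.erase i, (nearProj Z q (r / 2) (s.erase i) j).indicator 1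
          ∂fun _ => volume) q := by
      intro i hi q hq hqp
      refine ih hf _ (by rw [Finset.card_erase_of_mem hi]; omega) q _ (by positivity) hq.2 ?_
      rw [dist_eq_norm] at hqp
      linarith [norm_le_norm_add_norm_sub' q p]
    have hg : DifferentiableOn ℂ
        (fun z : ℂ × ℂ => f (Function.update (Function.update p a z.1) b z.2))
        (ball (p a, p b) (1 / 2)) := by
      refine hf.comp (f := fun z : ℂ × ℂ => Function.update (Function.update p a z.1) b z.2)
        ?_ ?_
      · refine Differentiable.differentiableOn (differentiable_pi.2 fun l => ?_)
        by_cases h1 : l = b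
        · subst h1; simp
        · by_cases h2 : l = a
          · subst h2; simp [h1]
          · simp [h1, h2]
      · intro z hz
        rw [← ball_prod_same] at hz
        refine mem_ball_zero_iff.2 ((pi_norm_lt_iff one_pos).2 fun l => ?_)
        have hpl : ‖p l‖ ≤ ‖p‖ := norm_le_pi_norm p l
        have hor : dist (Function.update (Function.update p a z.1) b z.2 l) (p l) ≤ 1 / 2 := by
          by_cases h1 : l = b
          · subst h1; simpa using (mem_ball.1 hz.2).le
          · by_cases h2 : l = a
            · subst h2; simpa [h1] using (mem_ball.1 hz.1).le
            · simp [h1, h2]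
        rw [dist_eq_norm] at hor
        linarith [norm_le_norm_add_norm_sub' (Function.update (Function.update p a z.1) b z.2 l)
          (p l)]
    rcases volume_zero_proj (p := (p a, p b)) (half_pos hr)
      (show r / 2 < 1 / 2 by linarith [norm_nonneg p]) hg (by simpa using hfp) with h | h
    · refine sum_lmarginal_nearProj_ge_of_proj (hZc hf) hr ha hb hab (h.trans (measure_mono ?_))
        (hM a ha)
      rintro t ⟨ht, w, hw, h⟩
      exact ⟨ht, w, hw, hcl _ _ _ _ ht hw h⟩
    · refine sum_lmarginal_nearProj_ge_of_proj (hZc hf) hr hb ha hab.symm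
        (h.trans (measure_mono ?_)) (hM b hb)
      rintro t ⟨ht, w, hw, h⟩
      exact ⟨ht, w, hw, hcl _ _ _ _ ht hw (by rwa [Function.update_comm hab.symm])⟩

end NearProj

theorem exists_volume_le_hausdorffMeasure (m : ℕ) : ∃ K : ℝ≥0, ∀ T : Set (Fin m → ℂ),
    volume T ≤ K * μH[((2 * m : ℕ) : ℝ)] T := by
  have hfr : Module.finrank ℝ (Fin m → ℂ) = 2 * m := by
    simp [Module.finrank_pi_fintype, Complex.finrank_real_complex, mul_comm]
  have : (μH[((2 * m : ℕ) : ℝ)] : Measure (Fin m → ℂ)).IsAddHaarMeasure := by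
    rw [← hfr]; exact isAddHaarMeasure_hausdorffMeasure
  refine ⟨Measure.addHaarScalarFactor volume (μH[((2 * m : ℕ) : ℝ)] : Measure (Fin m → ℂ)),
    fun T => le_of_eq ?_⟩
  conv_lhs => rw [Measure.isAddLeftInvariant_eq_smul (volume : Measure (Fin m → ℂ))
    (μH[((2 * m : ℕ) : ℝ)] : Measure (Fin m → ℂ))]
  rfl

theorem volume_nearProj_le {m : ℕ} (Z : Set (Fin (m + 1) → ℂ)) (p : Fin (m + 1) → ℂ) (r : ℝ)
    (s : Finset (Fin (m + 1))) {j : Fin (m + 1)} (hj : j ∈ s) :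
    volume (nearProj Z p r s j) ≤ volume (closedBall (p j) r) * volume (j.removeNth '' Z) := by
  have hsub : nearProj Z p r s j ⊆ MeasurableEquiv.piFinSuccAbove (fun _ => ℂ) j ⁻¹'
      (closedBall (p j) r ×ˢ (j.removeNth '' Z)) := by
    rintro x ⟨hx, w, -, hw⟩
    refine ⟨hx j hj, _, hw, ?_⟩
    ext i
    simp [Fin.removeNth, Fin.insertNthEquiv]
  refine (measure_mono hsub).trans ?_
  rw [(volume_preserving_piFinSuccAbove (fun _ : Fin (m + 1) => ℂ) j).measure_preimage_equiv,
    Measure.volume_eq_prod, Measure.prod_prod]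

theorem lipschitzWith_removeNth {m : ℕ} (j : Fin (m + 1)) :
    LipschitzWith 1 (j.removeNth : (Fin (m + 1) → ℂ) → Fin m → ℂ) :=
  LipschitzWith.of_dist_le_mul fun x y => by
    rw [NNReal.coe_one, one_mul, dist_pi_le_iff dist_nonneg]
    exact fun i => dist_le_pi_dist x y _

theorem exists_le_hausdorffMeasure_zeros (m : ℕ) : ∃ c > 0, ∀ g : (Fin (m + 1) → ℂ) → ℂ,
    DifferentiableOn ℂ g (ball 0 1) → g 0 = 0 →
    ENNReal.ofReal c ≤
      μH[((2 * m : ℕ) : ℝ)] {z ∈ closedBall (0 : Fin (m + 1) → ℂ) (1 / 2) | g z = 0} := by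
  obtain ⟨c, hc, h⟩ := exists_le_sum_lmarginal_nearProj (ι := Fin (m + 1)) m
  obtain ⟨K, hK⟩ := exists_volume_le_hausdorffMeasure m
  set V : ℝ≥0∞ := volume (closedBall (0 : ℂ) (1 / 2)) with hV
  have hVt : V ≠ ⊤ := (isCompact_closedBall _ _).measure_lt_top.ne
  set A : ℝ≥0 := (m + 1) * (V.toNNReal * K) with hA
  refine ⟨c * (1 / 2) ^ (2 * (m + 1)) / (A + 1), by positivity, fun g hg hg0 => ?_⟩
  set Z := {z ∈ closedBall (0 : Fin (m + 1) → ℂ) (1 / 2) | g z = 0} with hZ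
  have hcl : IsClosed Z :=
    ((hg.continuousOn.mono (closedBall_subset_ball (by norm_num))).preimage_isClosed_of_isClosed
      isClosed_closedBall isClosed_singleton)
  have key := h hg Finset.univ (by simp) 0 (1 / 2) (by norm_num) hg0 (by simp)
  have hj : ∀ j : Fin (m + 1), volume (nearProj Z 0 (1 / 2) Finset.univ j) ≤
      V * (K * μH[((2 * m : ℕ) : ℝ)] Z) := fun j => by
    refine (volume_nearProj_le Z 0 _ _ (Finset.mem_univ j)).trans ?_
    refine mul_le_mul_right ((hK _).trans (mul_le_mul_right ?_ _)) _
    simpa using (lipschitzWith_removeNth j).hausdorffMeasure_image_le (Nat.cast_nonneg (2 * m)) Z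
  have hsum : ENNReal.ofReal (c * (1 / 2) ^ (2 * (m + 1))) ≤ A * μH[((2 * m : ℕ) : ℝ)] Z := by
    refine key.trans ?_
    simp only [lmarginal_univ]
    calc _ ≤ ∑ _j : Fin (m + 1), V * (K * μH[((2 * m : ℕ) : ℝ)] Z) := by
          refine Finset.sum_le_sum fun j _ => ?_
          rw [← volume_pi, lintegral_indicator_one (isClosed_nearProj hcl _ _ _ _).measurableSet]
          exact hj j
      _ = A * μH[((2 * m : ℕ) : ℝ)] Z := by
          rw [hA, Finset.sum_const, Finset.card_univ, Fintype.card_fin, nsmul_eq_mul]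
          push_cast
          rw [ENNReal.coe_toNNReal hVt]
          ring
  rw [ENNReal.ofReal_div_of_pos (by positivity)]
  refine ENNReal.div_le_of_le_mul (hsum.trans ?_)
  rw [mul_comm]
  refine mul_le_mul_right ?_ _
  rw [ENNReal.ofReal_add (by positivity) zero_le_one, ENNReal.ofReal_coe_nnreal]
  exact le_self_add

theorem exists_le_zeros_cube (m : ℕ) : ∃ c : ℝ, 0 < c ∧
    ∀ (ctr : EuclideanSpace ℂ (Fin (m + 1))) (ℓ : ℝ) (f : EuclideanSpace ℂ (Fin (m + 1)) → ℂ),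
      0 < ℓ → DifferentiableOn ℂ f (cube ctr (2 * ℓ)) → f ctr = 0 →
      ENNReal.ofReal (c * ℓ ^ (2 * m)) ≤
        μH[((2 * m : ℕ) : ℝ)] { z ∈ cube ctr ℓ | f z = 0 } := by
  obtain ⟨c, hc, h⟩ := exists_le_hausdorffMeasure_zeros m
  refine ⟨c, hc, fun ctr ℓ f hℓ hf h0 => ?_⟩
  have hmem : ∀ ξ ∈ ball (0 : Fin (m + 1) → ℂ) 1, cubeChart ctr ℓ ξ ∈ cube ctr (2 * ℓ) :=
    fun ξ hξ => cubeChart_mem_cube hℓ.le (by simpa using (mem_ball_zero_iff.1 hξ).le)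
  have key := h (f ∘ cubeChart ctr ℓ)
    (hf.comp (differentiable_cubeChart (c := ctr) (ℓ := ℓ)).differentiableOn hmem)
    (by simpa [cubeChart] using h0)
  set Φ : EuclideanSpace ℂ (Fin (m + 1)) → Fin (m + 1) → ℂ :=
    fun z => WithLp.ofLp ((ℓ : ℂ)⁻¹ • (z - ctr)) with hΦ
  have hℓ' : (ℓ : ℂ) ≠ 0 := by exact_mod_cast hℓ.ne'
  have hLip : LipschitzWith (Real.toNNReal ℓ⁻¹) Φ := LipschitzWith.of_dist_le_mul fun x y => by
    have h1 := (PiLp.lipschitzWith_ofLp 2 fun _ : Fin (m + 1) => ℂ).dist_le_mul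
      ((ℓ : ℂ)⁻¹ • (x - ctr)) ((ℓ : ℂ)⁻¹ • (y - ctr))
    rw [NNReal.coe_one, one_mul, dist_smul₀, dist_sub_right, norm_inv, Complex.norm_real,
      Real.norm_of_nonneg hℓ.le] at h1
    rwa [Real.coe_toNNReal _ (by positivity)]
  have himg : {z ∈ closedBall (0 : Fin (m + 1) → ℂ) (1 / 2) | (f ∘ cubeChart ctr ℓ) z = 0} ⊆
      Φ '' {z ∈ cube ctr ℓ | f z = 0} := by
    rintro ξ ⟨hξ, hfξ⟩
    refine ⟨cubeChart ctr ℓ ξ, ⟨?_, hfξ⟩, ?_⟩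
    · simpa using cubeChart_mem_cube (r := 1) hℓ.le (mem_closedBall_zero_iff.1 hξ)
    · ext i
      simp [hΦ, cubeChart_apply, hℓ']
  have hle := (key.trans (measure_mono himg)).trans
    (hLip.hausdorffMeasure_image_le (Nat.cast_nonneg (2 * m)) _)
  rw [ENNReal.rpow_natCast] at hle
  rw [mul_comm, ENNReal.ofReal_mul (by positivity), ENNReal.ofReal_pow hℓ.le]
  refine (mul_le_mul_right hle _).trans (le_of_eq ?_)
  rw [← mul_assoc, ← mul_pow, ← ENNReal.ofReal_coe_nnreal, Real.coe_toNNReal _ (by positivity),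
    ← ENNReal.ofReal_mul hℓ.le, mul_inv_cancel₀ hℓ.ne', ENNReal.ofReal_one, one_pow, one_mul]

end

/-- zero sets of holomorphic functions on cubes: for `f` holomorphic on the
doubled cube `2Q`, (a) `ℋ^{2n−2}({f = 0} ∩ Q) ≤ C ℓ(Q)^{2n−2} log(sup_{2Q}|f| / sup_Q|f|)`, and
(b) if `f(c(Q)) = 0` and `f` is not identically zero on `2Q`, then
`ℋ^{2n−2}({f = 0} ∩ Q) ≥ c ℓ(Q)^{2n−2}`, with `C, c > 0` depending only on `n`. -/
theorem zero_set_hausdorff_cube (n : ℕ) :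
    ∃ C : ℝ, 0 < C ∧ ∃ c : ℝ, 0 < c ∧
      ∀ (ctr : EuclideanSpace ℂ (Fin n)) (ℓ : ℝ) (f : EuclideanSpace ℂ (Fin n) → ℂ),
        0 < ℓ → DifferentiableOn ℂ f (cube ctr (2 * ℓ)) →
        0 < sSup ((fun w => ‖f w‖) '' cube ctr ℓ) →
        (μH[(2 * n - 2 : ℝ)] { z ∈ cube ctr ℓ | f z = 0 } ≤
          ENNReal.ofReal (C * ℓ ^ (2 * n - 2) *
            Real.log (sSup ((fun w => ‖f w‖) '' cube ctr (2 * ℓ)) /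
              sSup ((fun w => ‖f w‖) '' cube ctr ℓ)))) ∧
        (f ctr = 0 → (¬ ∀ z ∈ cube ctr (2 * ℓ), f z = 0) →
          ENNReal.ofReal (c * ℓ ^ (2 * n - 2)) ≤
            μH[(2 * n - 2 : ℝ)] { z ∈ cube ctr ℓ | f z = 0 }) := by
  obtain ⟨C, hC, hle⟩ := exists_zeros_cube_le n
  rcases n with _ | m
  · refine ⟨C, hC, 1, one_pos, fun ctr ℓ f hℓ hf hpos => ⟨hle ctr ℓ f hℓ hf hpos, fun h0 _ => ?_⟩⟩
    have himg : (fun w => ‖f w‖) '' cube ctr ℓ = {0} := by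
      refine Set.eq_singleton_iff_unique_mem.2 ⟨⟨ctr, mem_cube_self hℓ, by simp [h0]⟩, ?_⟩
      rintro _ ⟨w, -, rfl⟩
      simp [Subsingleton.elim w ctr, h0]
    simp [himg] at hpos
  · obtain ⟨c, hc, hge⟩ := exists_le_zeros_cube m
    refine ⟨C, hC, c, hc, fun ctr ℓ f hℓ hf hpos => ⟨hle ctr ℓ f hℓ hf hpos, fun h0 _ => ?_⟩⟩
    have hdim : (2 * ((m + 1 : ℕ) : ℝ) - 2 : ℝ) = ((2 * m : ℕ) : ℝ) := by
      push_cast; ring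
    rw [hdim, show 2 * (m + 1) - 2 = 2 * m by omega]
    exact hge ctr ℓ f hℓ hf h0
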